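/- Assume (H3) and (H4), and that, as n → ∞, N^t_n/N^s_n → 0 and ε_n = o(1/(N^t_n log N^s_n)). Let (U_n, M_n) be solutions of the entropy-regularized finite MFG systems on the grids (S_n, T_n) with optimal kernels P̂_n, and let ξ_n ∈ P(Γ) be the induced probability measures on paths. Then: (i) the sequence (ξ_n) has at least one limit point with respect to the narrow topology on P(Γ); and (ii) every such limit point ξ* is a MFG equilibrium for the continuous first order MFG, i.e. t ↦ m(t) := e_t ♯ ξ* belongs to C([0,T]; P_1(R^d)) and ξ*-almost every γ minimizes ∫_0^T [ℓ(γ̇(t)) + f(γ(t), m(t))] dt + g(γ(T), m(T)) among all curves in W^{1,q}([0,T];R^d) with the same initial point γ(0). -/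

import Mathlib

open MeasureTheory Filter Topology Set
open scoped ENNReal

noncomputable section

/-! ### Continuous objects -/

/-- The path space `Γ = C([0,T]; ℝ^d)` with the uniform distance. -/
abbrev PathSpace (T : ℝ) (d : ℕ) := C(Set.Icc (0 : ℝ) T, Fin d → ℝ)

/-- Evaluation of a path at time `t ∈ [0,T]` (times are clamped to `[0,T]`). -/
def ev {T : ℝ} {d : ℕ} (hT : 0 ≤ T) (γ : PathSpace T d) (t : ℝ) : Fin d → ℝ :=
  γ (Set.projIcc 0 T hT t)

/-- The Kantorovich–Rubinstein (Wasserstein-1) distance, via couplings. -/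
def W1 {X : Type*} [MeasurableSpace X] [PseudoMetricSpace X] (μ ν : Measure X) : ℝ :=
  sInf {r : ℝ | ∃ γ : Measure (X × X), γ.map Prod.fst = μ ∧ γ.map Prod.snd = ν ∧
    r = ∫ p, dist p.1 p.2 ∂γ}

/-- `m ∈ P₁(ℝ^d)`: a Borel probability measure with finite first moment. -/
def IsP1 {d : ℕ} (m : Measure (Fin d → ℝ)) : Prop :=
  IsProbabilityMeasure m ∧ (∫⁻ x, ‖x‖₊ ∂m) < ⊤

/-! ### The space/time grids and the associated finite MFG -/

/-- Space step `Δx_n = 1/N^s_n`. -/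
def dxn (Ns : ℕ → ℕ) (n : ℕ) : ℝ := 1 / (Ns n : ℝ)

/-- Time step `Δt_n = T/N^t_n`. -/
def dtn (T : ℝ) (Nt : ℕ → ℕ) (n : ℕ) : ℝ := T / (Nt n : ℝ)

/-- Indices of grid points: `i ∈ ℤ^d` with `|i|_∞ ≤ (N^s_n)²`. -/
def gridIdx (d : ℕ) (Ns : ℕ → ℕ) (n : ℕ) : Finset (Fin d → ℤ) :=
  Finset.Icc (fun _ => -(Ns n : ℤ) ^ 2) fun _ => (Ns n : ℤ) ^ 2

/-- The grid point `x_i = i Δx_n ∈ ℝ^d`. -/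
def gpt (d : ℕ) (Ns : ℕ → ℕ) (n : ℕ) (i : Fin d → ℤ) : Fin d → ℝ :=
  fun j => (i j : ℝ) * dxn Ns n

/-- The simplex of probability vectors indexed by a finite set `A`. -/
def gsimplex {ι : Type*} (A : Finset ι) : Set (ι → ℝ) :=
  {p | (∀ i, 0 ≤ p i) ∧ (∀ i ∉ A, p i = 0) ∧ ∑ i ∈ A, p i = 1}

/-- The (negative) entropy `Σ p log p` (with the convention `0 log 0 = 0`). -/
def entD {ι : Type*} (A : Finset ι) (p : ι → ℝ) : ℝ :=
  ∑ i ∈ A, p i * Real.log (p i)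

/-- The measure on `ℝ^d` induced by masses `M` on the grid points. -/
def discMeas (d : ℕ) (Ns : ℕ → ℕ) (n : ℕ) (M : (Fin d → ℤ) → ℝ) :
    Measure (Fin d → ℝ) :=
  ∑ i ∈ gridIdx d Ns n, ENNReal.ofReal (M i) • Measure.dirac (gpt d Ns n i)

/-- The discretized initial condition `M_{n,0}(x_i) = m₀(E_i^n)`, where `E_i^n` is the
cube of side `Δx_n` centered at `x_i` (a closed ball for the sup norm of `ℝ^d`). -/
def Mzero (d : ℕ) (Ns : ℕ → ℕ) (n : ℕ) (m0 : Measure (Fin d → ℝ)) (i : Fin d → ℤ) : ℝ :=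
  (m0 (Metric.closedBall (gpt d Ns n i) (dxn Ns n / 2))).toReal

/-- The one-step entropy-penalized cost
`p ↦ Σ_j p(j) [Δt_n ℓ((x_j − x_i)/Δt_n) + U(j)] + ε_n E_n(p)`. -/
def stepObj (d : ℕ) (T : ℝ) (Ns Nt : ℕ → ℕ) (n : ℕ) (ℓ : (Fin d → ℝ) → ℝ) (εn : ℝ)
    (U1 : (Fin d → ℤ) → ℝ) (i : Fin d → ℤ) (p : (Fin d → ℤ) → ℝ) : ℝ :=
  (∑ j ∈ gridIdx d Ns n, p j *
      (dtn T Nt n * ℓ ((dtn T Nt n)⁻¹ • (gpt d Ns n j - gpt d Ns n i)) + U1 j)) +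
    εn * entD (gridIdx d Ns n) p

/-- `(U, M, P)` solves the entropy-regularized finite MFG system on the `n`-th grid:
`P(k, i, ·)` is the unique minimizer of the one-step cost, `U` satisfies the dynamic
programming equation, `M` is the induced marginal flow starting from the discretized
initial condition, and `U(N^t_n, ·)` is the terminal cost. -/
def SolvesDiscreteMFG (d : ℕ) (T : ℝ) (Ns Nt : ℕ → ℕ) (eps : ℕ → ℝ)
    (ℓ : (Fin d → ℝ) → ℝ) (f g : (Fin d → ℝ) → Measure (Fin d → ℝ) → ℝ)
    (m0 : Measure (Fin d → ℝ)) (n : ℕ)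
    (U M : ℕ → (Fin d → ℤ) → ℝ) (P : ℕ → (Fin d → ℤ) → (Fin d → ℤ) → ℝ) : Prop :=
  (∀ k < Nt n, ∀ i ∈ gridIdx d Ns n,
    P k i ∈ gsimplex (gridIdx d Ns n) ∧
    (∀ p ∈ gsimplex (gridIdx d Ns n),
      stepObj d T Ns Nt n ℓ (eps n) (U (k + 1)) i (P k i) ≤
        stepObj d T Ns Nt n ℓ (eps n) (U (k + 1)) i p) ∧
    (∀ p ∈ gsimplex (gridIdx d Ns n),
      (∀ p' ∈ gsimplex (gridIdx d Ns n),
        stepObj d T Ns Nt n ℓ (eps n) (U (k + 1)) i p ≤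
          stepObj d T Ns Nt n ℓ (eps n) (U (k + 1)) i p') → p = P k i) ∧
    U k i = stepObj d T Ns Nt n ℓ (eps n) (U (k + 1)) i (P k i) +
      dtn T Nt n * f (gpt d Ns n i) (discMeas d Ns n (M k))) ∧
  (∀ k < Nt n, ∀ j ∈ gridIdx d Ns n,
    M (k + 1) j = ∑ i ∈ gridIdx d Ns n, P k i j * M k i) ∧
  (∀ i ∈ gridIdx d Ns n, M 0 i = Mzero d Ns n m0 i) ∧
  (∀ i ∈ gridIdx d Ns n, U (Nt n) i = g (gpt d Ns n i) (discMeas d Ns n (M (Nt n)))) ∧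
  (∀ k ≤ Nt n, M k ∈ gsimplex (gridIdx d Ns n))

/-- The weight of the discrete trajectory `s` under the kernel `P` with discretized
initial distribution: `M_{n,0}(s_0) Π_k P(s_k, s_{k+1}, t_k)`. -/
def pathWeight (d : ℕ) (Ns Nt : ℕ → ℕ) (n : ℕ) (m0 : Measure (Fin d → ℝ))
    (P : ℕ → (Fin d → ℤ) → (Fin d → ℤ) → ℝ)
    (s : Fin (Nt n + 1) → Fin d → ℤ) : ℝ :=
  Mzero d Ns n m0 (s 0) * ∏ k : Fin (Nt n), P (k : ℕ) (s k.castSucc) (s k.succ)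

/-- The probability measure `ξ_n` on `Γ` induced by the discrete MFG solution: the sum
over discrete trajectories of their weights times the Dirac mass at the corresponding
piecewise affine path `interp s`. -/
def xiMeas (d : ℕ) (T : ℝ) [MeasurableSpace (PathSpace T d)] (Ns Nt : ℕ → ℕ)
    (m0 : Measure (Fin d → ℝ)) (n : ℕ)
    (P : ℕ → (Fin d → ℤ) → (Fin d → ℤ) → ℝ)
    (interp : (Fin (Nt n + 1) → Fin d → ℤ) → PathSpace T d) : Measure (PathSpace T d) :=
  ∑ s ∈ Fintype.piFinset (fun _ : Fin (Nt n + 1) => gridIdx d Ns n),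
    ENNReal.ofReal (pathWeight d Ns Nt n m0 P s) • Measure.dirac (interp s)

/-- `z` is an `L^q` weak derivative of `γ` on `[0,T]`:
`z ∈ L^q((0,T);ℝ^d)` and `γ(t) = γ(0) + ∫_0^t z(s) ds` for all `t ∈ [0,T]`.
This says exactly that `γ ∈ W^{1,q}([0,T];ℝ^d)` with representative derivative `z`. -/
def HasWDeriv (T q : ℝ) {d : ℕ} (hT : 0 ≤ T) (γ : PathSpace T d) (z : ℝ → Fin d → ℝ) :
    Prop :=
  MeasureTheory.IntegrableOn z (Set.Icc 0 T) volume ∧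
  MeasureTheory.IntegrableOn (fun s => ‖z s‖ ^ q) (Set.Icc 0 T) volume ∧
  ∀ t ∈ Set.Icc (0 : ℝ) T, ev hT γ t = ev hT γ 0 + ∫ s in Set.Icc 0 t, z s

/-- `ξs` is a limit point of the sequence `ξ` for the narrow (weak) topology on
probability measures over paths: some subsequence of `ξ` converges narrowly to `ξs`. -/
def IsNarrowLimitPoint {Ω : Type*} [TopologicalSpace Ω] [MeasurableSpace Ω]
    (ξ : ℕ → Measure Ω) (ξs : Measure Ω) : Prop :=
  ∃ φ : ℕ → ℕ, StrictMono φ ∧ ∀ F : BoundedContinuousFunction Ω ℝ,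
    Tendsto (fun j => ∫ γ, F γ ∂(ξ (φ j))) atTop (𝓝 (∫ γ, F γ ∂ξs))

/-- `ξs` is a MFG equilibrium for the continuous first order MFG: its time-`0` marginal
is `m₀`, its time marginals `m(t) = e_t ♯ ξs` form a curve in `C([0,T]; P₁(ℝ^d))`, and
`ξs`-almost every `γ` minimizes
`∫_0^T [ℓ(γ̇) + f(γ(t), m(t))] dt + g(γ(T), m(T))`
among all `W^{1,q}` curves with the same initial point. -/
def IsMFGEquilibrium (d : ℕ) (T : ℝ) (hT : 0 ≤ T) (q : ℝ)
    [MeasurableSpace (PathSpace T d)]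
    (ℓ : (Fin d → ℝ) → ℝ) (f g : (Fin d → ℝ) → Measure (Fin d → ℝ) → ℝ)
    (m0 : Measure (Fin d → ℝ)) (ξs : Measure (PathSpace T d)) : Prop :=
  ξs.map (fun γ => ev hT γ 0) = m0 ∧
  (∀ t ∈ Set.Icc (0 : ℝ) T, IsP1 (ξs.map (fun γ => ev hT γ t))) ∧
  (∀ ε > (0 : ℝ), ∃ δ > (0 : ℝ), ∀ s ∈ Set.Icc (0 : ℝ) T, ∀ t ∈ Set.Icc (0 : ℝ) T,
    |t - s| < δ →
      W1 (ξs.map (fun γ => ev hT γ t)) (ξs.map (fun γ => ev hT γ s)) < ε) ∧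
  ∀ᵐ γ ∂ξs, ∃ z, HasWDeriv T q hT γ z ∧
    MeasureTheory.IntegrableOn
      (fun s => ℓ (z s) + f (ev hT γ s) (ξs.map fun γ' => ev hT γ' s))
      (Set.Icc 0 T) volume ∧
    ∀ γ₁ z₁, HasWDeriv T q hT γ₁ z₁ → ev hT γ₁ 0 = ev hT γ 0 →
      MeasureTheory.IntegrableOn
        (fun s => ℓ (z₁ s) + f (ev hT γ₁ s) (ξs.map fun γ' => ev hT γ' s))
        (Set.Icc 0 T) volume →
      (∫ s in Set.Icc (0 : ℝ) T,
          (ℓ (z s) + f (ev hT γ s) (ξs.map fun γ' => ev hT γ' s))) +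
          g (ev hT γ T) (ξs.map fun γ' => ev hT γ' T) ≤
        (∫ s in Set.Icc (0 : ℝ) T,
          (ℓ (z₁ s) + f (ev hT γ₁ s) (ξs.map fun γ' => ev hT γ' s))) +
          g (ev hT γ₁ T) (ξs.map fun γ' => ev hT γ' T)

/-! ### Step functions and piecewise affine curves -/

section Step

variable {F : Type*} [NormedAddCommGroup F]

lemma floor_div_eq {h t : ℝ} (hh : 0 < h) {k : ℕ} (h1 : k * h ≤ t) (h2 : t < (k + 1) * h) :
    ⌊t / h⌋₊ = k := by
  have h0 : 0 ≤ t := le_trans (by positivity) h1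
  rw [Nat.floor_eq_iff (by positivity)]
  exact ⟨(le_div_iff₀ hh).2 h1, (div_lt_iff₀ hh).2 h2⟩

lemma ae_floor_div_eq {h a b : ℝ} (hh : 0 < h) {k : ℕ} (ha : k * h ≤ a) (hab : a ≤ b)
    (hb : b ≤ (k + 1) * h) : ∀ᵐ t : ℝ, t ∈ uIoc a b → ⌊t / h⌋₊ = k := by
  have : ∀ᵐ t : ℝ, t ≠ b := by simp [ae_iff]
  filter_upwards [this] with t htb ht
  rw [uIoc_of_le hab] at ht
  exact floor_div_eq hh (ha.trans ht.1.le) (lt_of_lt_of_le (lt_of_le_of_ne ht.2 htb) hb)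

lemma intervalIntegrable_floor_cell {h a b : ℝ} (hh : 0 < h) (c : ℕ → F) {k : ℕ}
    (ha : k * h ≤ a) (hab : a ≤ b) (hb : b ≤ (k + 1) * h) :
    IntervalIntegrable (fun t => c ⌊t / h⌋₊) volume a b := by
  refine (intervalIntegrable_const (c := c k)).congr_ae ?_
  rw [EventuallyEq, ae_restrict_iff' measurableSet_uIoc]
  filter_upwards [ae_floor_div_eq hh ha hab hb] with t ht hts
  rw [ht hts]

lemma integral_floor_cell [NormedSpace ℝ F] [CompleteSpace F] {h a b : ℝ} (hh : 0 < h) (c : ℕ → F)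
    {k : ℕ} (ha : k * h ≤ a) (hab : a ≤ b) (hb : b ≤ (k + 1) * h) :
    ∫ t in a..b, c ⌊t / h⌋₊ = (b - a) • c k := by
  rw [← intervalIntegral.integral_const]
  refine intervalIntegral.integral_congr_ae ?_
  filter_upwards [ae_floor_div_eq hh ha hab hb] with t ht hts
  rw [ht hts]

lemma intervalIntegrable_floor {h : ℝ} (hh : 0 < h) (c : ℕ → F) (N : ℕ) :
    IntervalIntegrable (fun t => c ⌊t / h⌋₊) volume 0 (N * h) := by
  have := IntervalIntegrable.trans_iterate (μ := volume) (f := fun t => c ⌊t / h⌋₊)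
    (a := fun k : ℕ => (k : ℝ) * h) (n := N) (fun k _ =>
      intervalIntegrable_floor_cell hh c le_rfl (by push_cast; nlinarith) (by push_cast; rfl))
  simpa using this

lemma integral_floor [NormedSpace ℝ F] [CompleteSpace F] {h : ℝ} (hh : 0 < h) (c : ℕ → F) (N : ℕ) :
    ∫ t in 0..(N * h), c ⌊t / h⌋₊ = ∑ k ∈ Finset.range N, h • c k := by
  have := intervalIntegral.sum_integral_adjacent_intervals (μ := volume)
    (f := fun t => c ⌊t / h⌋₊)
    (a := fun k : ℕ => (k : ℝ) * h) (n := N) (fun k _ =>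
      intervalIntegrable_floor_cell hh c le_rfl (by push_cast; nlinarith) (by push_cast; rfl))
  simp only [Nat.cast_zero, zero_mul] at this
  rw [← this]
  refine Finset.sum_congr rfl fun k _ => ?_
  rw [integral_floor_cell hh c (k := k) le_rfl (by push_cast; nlinarith) (by push_cast; rfl)]
  congr 1
  push_cast
  ring

lemma integral_slope [NormedSpace ℝ F] [CompleteSpace F] {h : ℝ} (hh : 0 < h) (x : ℕ → F)
    {k : ℕ} {t : ℝ} (h1 : k * h ≤ t) (h2 : t ≤ (k + 1) * h) :
    ∫ s in 0..t, h⁻¹ • (x (⌊s / h⌋₊ + 1) - x ⌊s / h⌋₊) =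
      x k + ((t - k * h) / h) • (x (k + 1) - x k) - x 0 := by
  have hc := integral_floor hh (fun k => h⁻¹ • (x (k + 1) - x k)) k
  have hi := intervalIntegrable_floor hh (fun k => h⁻¹ • (x (k + 1) - x k)) k
  rw [← intervalIntegral.integral_add_adjacent_intervals hi
    (intervalIntegrable_floor_cell hh (fun k => h⁻¹ • (x (k + 1) - x k)) le_rfl h1 h2), hc,
    integral_floor_cell hh (fun k => h⁻¹ • (x (k + 1) - x k)) le_rfl h1 h2]
  simp only [smul_smul, mul_inv_cancel₀ hh.ne', one_smul, Finset.sum_range_sub, ← div_eq_mul_inv]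
  abel

end Step

section Curve

variable {d : ℕ}

/-- The action of the piecewise affine interpolation of `γ` on `N` equal time steps, for the
running cost `φ` of the velocity. -/
def actionOn {T : ℝ} (hT : 0 ≤ T) (φ : (Fin d → ℝ) → ℝ) (N : ℕ) (γ : PathSpace T d) : ℝ :=
  ∑ k ∈ Finset.range N, T / N * φ ((T / N)⁻¹ •
    (ev hT γ (((k : ℝ) + 1) * (T / N)) - ev hT γ (k * (T / N))))

@[fun_prop]
lemma continuous_ev {T : ℝ} (hT : 0 ≤ T) (γ : PathSpace T d) : Continuous (ev hT γ) :=
  γ.continuous.comp continuous_projIcc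

@[fun_prop]
lemma continuous_ev_left {T : ℝ} (hT : 0 ≤ T) (t : ℝ) :
    Continuous (fun γ : PathSpace T d => ev hT γ t) :=
  continuous_eval_const _

lemma norm_ev_sub_le {T : ℝ} (hT : 0 ≤ T) (γ γ' : PathSpace T d) (t : ℝ) :
    ‖ev hT γ t - ev hT γ' t‖ ≤ dist γ γ' := by
  rw [← dist_eq_norm]
  exact ContinuousMap.dist_apply_le_dist _

lemma norm_ev_le {T : ℝ} (hT : 0 ≤ T) (γ : PathSpace T d) (t : ℝ) : ‖ev hT γ t‖ ≤ ‖γ‖ :=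
  γ.norm_coe_le_norm _

lemma continuous_actionOn {T : ℝ} (hT : 0 ≤ T) {φ : (Fin d → ℝ) → ℝ} (hφ : Continuous φ)
    (N : ℕ) : Continuous (actionOn (d := d) hT φ N) := by
  unfold actionOn
  fun_prop

lemma node_le {T : ℝ} (hT : 0 < T) {N k : ℕ} (hk : k ≤ N) (hN : 0 < N) :
    (k : ℝ) * (T / N) ≤ T := by
  have h1 : (0 : ℝ) < N := by exact_mod_cast hN
  have h2 : (k : ℝ) ≤ N := by exact_mod_cast hk
  rw [mul_div_assoc', div_le_iff₀ h1]
  nlinarith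

lemma node_mem {T : ℝ} (hT : 0 < T) {N k : ℕ} (hk : k ≤ N) (hN : 0 < N) :
    (k : ℝ) * (T / N) ∈ Icc 0 T :=
  ⟨by positivity, node_le hT hk hN⟩

lemma exists_cell {T t : ℝ} (hT : 0 < T) {N : ℕ} (hN : 0 < N) (ht : t ∈ Icc 0 T) :
    ∃ k < N, (k : ℝ) * (T / N) ≤ t ∧ t ≤ ((k : ℝ) + 1) * (T / N) := by
  have h1 : (0 : ℝ) < N := by exact_mod_cast hN
  have hh : 0 < T / N := by positivity
  rcases lt_or_ge ⌊t / (T / N)⌋₊ N with h | h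
  · refine ⟨_, h, ?_, ?_⟩
    · exact (le_div_iff₀ hh).1 (Nat.floor_le (div_nonneg ht.1 hh.le))
    · exact (div_le_iff₀ hh).1 (Nat.lt_floor_add_one _).le
  · have h2 : (N : ℝ) ≤ t / (T / N) := (Nat.le_floor_iff (div_nonneg ht.1 hh.le)).1 h
    have h3 : T ≤ t := by
      have := (le_div_iff₀ hh).1 h2
      rwa [mul_div_cancel₀ _ h1.ne'] at this
    have ht' : t = T := le_antisymm ht.2 h3
    refine ⟨N - 1, by omega, ?_, ?_⟩
    · rw [ht']; exact node_le hT (by omega) hN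
    · rw [ht']
      have : ((N - 1 : ℕ) : ℝ) + 1 = N := by
        rw [← Nat.cast_add_one]; congr 1; omega
      rw [this, mul_div_cancel₀ _ h1.ne']

lemma integral_Icc_eq_interval {F : Type*} [NormedAddCommGroup F] [NormedSpace ℝ F]
    {a b : ℝ} (hab : a ≤ b) (u : ℝ → F) : ∫ s in Icc a b, u s = ∫ s in a..b, u s := by
  rw [integral_Icc_eq_integral_Ioc, intervalIntegral.integral_of_le hab]

lemma exists_hasWDeriv_of_affine {T : ℝ} (hT : 0 < T) (q : ℝ) {N : ℕ} (hN : 0 < N)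
    (γ : PathSpace T d)
    (hγ : ∀ k < N, ∀ t, (k : ℝ) * (T / N) ≤ t → t ≤ ((k : ℝ) + 1) * (T / N) →
      ev hT.le γ t = ev hT.le γ (k * (T / N)) + ((t - k * (T / N)) / (T / N)) •
        (ev hT.le γ (((k : ℝ) + 1) * (T / N)) - ev hT.le γ (k * (T / N)))) :
    ∃ z, HasWDeriv T q hT.le γ z ∧ ∀ φ : (Fin d → ℝ) → ℝ,
      ∫ t in Icc 0 T, φ (z t) = actionOn hT.le φ N γ := by
  have h1 : (0 : ℝ) < N := by exact_mod_cast hN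
  have hh : 0 < T / N := by positivity
  have hNT : (N : ℝ) * (T / N) = T := mul_div_cancel₀ _ h1.ne'
  set x : ℕ → Fin d → ℝ := fun k => ev hT.le γ (k * (T / N)) with hx
  have hz {F : Type} [NormedAddCommGroup F] [NormedSpace ℝ F] (φ : (Fin d → ℝ) → F) :
      IntegrableOn (fun t => φ ((T / N)⁻¹ • (x (⌊t / (T / N)⌋₊ + 1) - x ⌊t / (T / N)⌋₊)))
        (Icc 0 T) := by
    have := intervalIntegrable_floor hh (fun k => φ ((T / N)⁻¹ • (x (k + 1) - x k))) N
    rw [hNT] at this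
    exact (intervalIntegrable_iff_integrableOn_Icc_of_le hT.le).1 this
  refine ⟨fun t => (T / N)⁻¹ • (x (⌊t / (T / N)⌋₊ + 1) - x ⌊t / (T / N)⌋₊), ⟨?_, ?_, ?_⟩, ?_⟩
  · exact hz id
  · exact hz fun v => ‖v‖ ^ q
  · intro t ht
    obtain ⟨k, hk, hk1, hk2⟩ := exists_cell hT hN ht
    rw [integral_Icc_eq_interval ht.1, integral_slope hh x hk1 hk2, hγ k hk t hk1 hk2]
    simp only [hx, Nat.cast_add, Nat.cast_one, Nat.cast_zero, zero_mul]
    abel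
  · intro φ
    rw [integral_Icc_eq_interval hT.le]
    have := integral_floor hh (fun k => φ ((T / N)⁻¹ • (x (k + 1) - x k))) N
    rw [hNT] at this
    rw [this, actionOn]
    simp only [hx, Nat.cast_add, Nat.cast_one, smul_eq_mul]

/-! ### Convexity estimates along `W^{1,q}` curves -/

lemma young_rpow {q K r : ℝ} (hq : 1 < q) (hK : 0 < K) (hr : 0 ≤ r) :
    r ≤ K + K ^ (1 - q) * r ^ q := by
  rcases le_or_gt r K with h | h
  · have : 0 ≤ K ^ (1 - q) * r ^ q := by positivity
    linarith
  · have hr' : 0 < r := hK.trans h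
    have h1 : r = r ^ (1 - q) * r ^ q := by
      rw [← Real.rpow_add hr']; simp
    have h2 : r ^ (1 - q) ≤ K ^ (1 - q) :=
      Real.rpow_le_rpow_of_nonpos hK h.le (by linarith)
    have h3 : 0 ≤ r ^ q := by positivity
    nlinarith [mul_le_mul_of_nonneg_right h2 h3]

lemma add_rpow_le {q a b : ℝ} (hq : 1 < q) (ha : 0 ≤ a) (hb : 0 ≤ b) :
    (a + b) ^ q ≤ 2 ^ q * (a ^ q + b ^ q) := by
  wlog hab : a ≤ b generalizing a b
  · rw [add_comm a, add_comm (a ^ q)]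
    exact this hb ha (by linarith)
  have h1 : (a + b) ^ q ≤ (2 * b) ^ q := Real.rpow_le_rpow (by linarith) (by linarith) (by linarith)
  rw [Real.mul_rpow (by norm_num) hb] at h1
  have h2 : 0 ≤ (2 : ℝ) ^ q * a ^ q := by positivity
  linarith

lemma tendsto_rpow_one_sub {q : ℝ} (hq : 1 < q) :
    Tendsto (fun K : ℝ => K ^ (1 - q)) atTop (𝓝 0) := by
  have := tendsto_rpow_neg_atTop (y := q - 1) (by linarith)
  simpa using this

lemma continuous_norm_rpow {q : ℝ} (hq : 1 < q) :
    Continuous (fun v : Fin d → ℝ => ‖v‖ ^ q) :=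
  continuous_norm.rpow_const fun _ => Or.inr (by linarith)

lemma convexOn_norm_rpow {q : ℝ} (hq : 1 < q) :
    ConvexOn ℝ univ (fun v : Fin d → ℝ => ‖v‖ ^ q) := by
  have him : (fun v : Fin d → ℝ => ‖v‖) '' univ ⊆ Ici 0 := by
    rintro _ ⟨v, -, rfl⟩; exact norm_nonneg v
  have hmono : MonotoneOn (fun x : ℝ => x ^ q) (Ici 0) := fun a ha b _ hab =>
    Real.rpow_le_rpow ha hab (by linarith)
  refine ⟨convex_univ, fun v _ w _ a b ha hb hab => ?_⟩
  have h1 := (convexOn_univ_norm (E := Fin d → ℝ)).2 (mem_univ v) (mem_univ w) ha hb hab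
  have h2 := (convexOn_rpow hq.le).2 (norm_nonneg v) (norm_nonneg w) ha hb hab
  refine le_trans (hmono (norm_nonneg _) ?_ h1) h2
  exact add_nonneg (smul_nonneg ha (norm_nonneg _)) (smul_nonneg hb (norm_nonneg _))

section WDeriv

variable {T q : ℝ} {hT : 0 ≤ T} {γ : PathSpace T d} {z : ℝ → Fin d → ℝ}

lemma HasWDeriv.sub_eq (hz : HasWDeriv T q hT γ z) {a b : ℝ} (ha : 0 ≤ a) (hab : a ≤ b)
    (hb : b ≤ T) : ev hT γ b - ev hT γ a = ∫ s in Icc a b, z s := by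
  have hi (a b : ℝ) (ha : 0 ≤ a) (hab : a ≤ b) (hb : b ≤ T) : IntervalIntegrable z volume a b :=
    (intervalIntegrable_iff_integrableOn_Icc_of_le hab).2
      (hz.1.mono_set (Icc_subset_Icc ha hb))
  rw [hz.2.2 b ⟨ha.trans hab, hb⟩, hz.2.2 a ⟨ha, hab.trans hb⟩,
    integral_Icc_eq_interval (ha.trans hab), integral_Icc_eq_interval ha,
    integral_Icc_eq_interval hab,
    ← intervalIntegral.integral_add_adjacent_intervals (hi 0 a le_rfl ha (hab.trans hb))
      (hi a b ha hab hb)]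
  abel

lemma HasWDeriv.jensen (hz : HasWDeriv T q hT γ z) {φ : (Fin d → ℝ) → ℝ}
    (hφ : ConvexOn ℝ univ φ) (hφc : Continuous φ)
    (hi : IntegrableOn (fun s => φ (z s)) (Icc 0 T)) {a b : ℝ} (ha : 0 ≤ a) (hab : a < b)
    (hb : b ≤ T) :
    (b - a) * φ ((b - a)⁻¹ • (ev hT γ b - ev hT γ a)) ≤ ∫ s in Icc a b, φ (z s) := by
  have hsub : Icc a b ⊆ Icc 0 T := Icc_subset_Icc ha hb
  have h := hφ.map_set_average_le (μ := volume) (t := Icc a b) (f := z) hφc.continuousOn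
    isClosed_univ (by simp [hab]) (by simp) (by simp) (hz.1.mono_set hsub) (hi.mono_set hsub)
  rw [setAverage_eq, setAverage_eq] at h
  have hv : volume.real (Icc a b) = b - a := by simp [hab.le]
  rw [hv, ← hz.sub_eq ha hab.le hb, smul_eq_mul] at h
  have hba : 0 < b - a := by linarith
  calc _ ≤ (b - a) * ((b - a)⁻¹ * ∫ s in Icc a b, φ (z s)) := by gcongr
    _ = _ := by field_simp

lemma HasWDeriv.actionOn_le (hT' : 0 < T) (hz : HasWDeriv T q hT γ z) {φ : (Fin d → ℝ) → ℝ}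
    (hφ : ConvexOn ℝ univ φ) (hφc : Continuous φ)
    (hi : IntegrableOn (fun s => φ (z s)) (Icc 0 T)) {N : ℕ} (hN : 0 < N) :
    actionOn hT φ N γ ≤ ∫ s in Icc 0 T, φ (z s) := by
  have h1 : (0 : ℝ) < N := by exact_mod_cast hN
  have hh : 0 < T / N := by positivity
  have key := intervalIntegral.sum_integral_adjacent_intervals (μ := volume)
    (f := fun s => φ (z s)) (a := fun k : ℕ => (k : ℝ) * (T / N)) (n := N) (fun k hk =>
      (intervalIntegrable_iff_integrableOn_Icc_of_le (by push_cast; nlinarith)).2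
        (hi.mono_set (Icc_subset_Icc (by positivity) (node_le hT' hk hN))))
  simp only [Nat.cast_zero, zero_mul, mul_div_cancel₀ _ h1.ne'] at key
  rw [integral_Icc_eq_interval hT, ← key, actionOn]
  refine Finset.sum_le_sum fun k hk => ?_
  have hk' := node_le hT' (Nat.succ_le_of_lt (Finset.mem_range.1 hk)) hN
  rw [Nat.succ_eq_add_one, Nat.cast_add_one] at hk'
  have hlt : (k : ℝ) * (T / N) < ((k : ℝ) + 1) * (T / N) := by nlinarith
  have := hz.jensen hφ hφc hi (a := k * (T / N)) (b := ((k : ℝ) + 1) * (T / N)) (by positivity)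
    hlt hk'
  rw [integral_Icc_eq_interval hlt.le] at this
  have e : ((k : ℝ) + 1) * (T / N) - k * (T / N) = T / N := by ring
  rw [e] at this
  push_cast
  exact this

lemma HasWDeriv.norm_sub_le (hq : 1 < q) (hz : HasWDeriv T q hT γ z) {a b : ℝ} (ha : a ∈ Icc 0 T)
    (hb : b ∈ Icc 0 T) {K : ℝ} (hK : 0 < K) :
    ‖ev hT γ b - ev hT γ a‖ ≤ K * |b - a| + K ^ (1 - q) * ∫ s in Icc 0 T, ‖z s‖ ^ q := by
  wlog hab : a ≤ b generalizing a b
  · rw [norm_sub_rev, abs_sub_comm]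
    exact this hb ha (by linarith)
  have hsub : Icc a b ⊆ Icc 0 T := Icc_subset_Icc ha.1 hb.2
  have hKq : 0 ≤ K ^ (1 - q) := by positivity
  rw [hz.sub_eq ha.1 hab hb.2]
  calc ‖∫ s in Icc a b, z s‖ ≤ ∫ s in Icc a b, ‖z s‖ := norm_integral_le_integral_norm _
    _ ≤ ∫ s in Icc a b, (K + K ^ (1 - q) * ‖z s‖ ^ q) := by
        refine integral_mono (hz.1.mono_set hsub).norm ?_ fun s => young_rpow hq hK (norm_nonneg _)
        exact (integrable_const _).add ((hz.2.1.mono_set hsub).const_mul _)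
    _ = K * |b - a| + K ^ (1 - q) * ∫ s in Icc a b, ‖z s‖ ^ q := by
        rw [integral_add (integrable_const _) ((hz.2.1.mono_set hsub).const_mul _),
          integral_const_mul]
        simp [abs_of_nonneg (sub_nonneg.2 hab), hab, mul_comm]
    _ ≤ _ := by
        gcongr
        · filter_upwards with s; positivity
        · exact hz.2.1

lemma HasWDeriv.norm_ev_rpow_le (hq : 1 < q) (hz : HasWDeriv T q hT γ z) {t : ℝ}
    (ht : t ∈ Icc 0 T) :
    ‖ev hT γ t‖ ^ q ≤ 2 ^ q * (‖ev hT γ 0‖ ^ q + T ^ (q - 1) * ∫ s in Icc 0 T, ‖z s‖ ^ q) := by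
  have hE : 0 ≤ ∫ s in Icc 0 T, ‖z s‖ ^ q := integral_nonneg fun _ => by positivity
  have key : ‖ev hT γ t - ev hT γ 0‖ ^ q ≤ T ^ (q - 1) * ∫ s in Icc 0 T, ‖z s‖ ^ q := by
    rcases ht.1.eq_or_lt with h0 | h0
    · rw [← h0, sub_self, norm_zero, Real.zero_rpow (by linarith)]
      positivity
    have hj := hz.jensen (convexOn_norm_rpow hq) (continuous_norm_rpow hq) hz.2.1 le_rfl h0 ht.2
    have hmono : ∫ s in Icc 0 t, ‖z s‖ ^ q ≤ ∫ s in Icc 0 T, ‖z s‖ ^ q := by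
      refine setIntegral_mono_set hz.2.1 ?_ (Icc_subset_Icc_right ht.2).eventuallyLE
      filter_upwards with s; positivity
    simp only [sub_zero] at hj
    rw [norm_smul, Real.mul_rpow (by positivity) (by positivity), norm_inv,
      Real.norm_of_nonneg h0.le, Real.inv_rpow h0.le] at hj
    have e : t * ((t ^ q)⁻¹ * ‖ev hT γ t - ev hT γ 0‖ ^ q) =
        (t ^ (q - 1))⁻¹ * ‖ev hT γ t - ev hT γ 0‖ ^ q := by
      rw [Real.rpow_sub_one h0.ne']
      field_simp
    rw [e, inv_mul_le_iff₀ (by positivity)] at hj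
    refine hj.trans ?_
    have : t ^ (q - 1) ≤ T ^ (q - 1) := Real.rpow_le_rpow h0.le ht.2 (by linarith)
    exact mul_le_mul this hmono (integral_nonneg fun _ => by positivity)
      (by have := ht.1.trans ht.2; positivity)
  have h1 : ‖ev hT γ t‖ ≤ ‖ev hT γ 0‖ + ‖ev hT γ t - ev hT γ 0‖ := by
    have := norm_add_le (ev hT γ 0) (ev hT γ t - ev hT γ 0)
    simpa using this
  calc ‖ev hT γ t‖ ^ q ≤ (‖ev hT γ 0‖ + ‖ev hT γ t - ev hT γ 0‖) ^ q :=
        Real.rpow_le_rpow (norm_nonneg _) h1 (by linarith)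
    _ ≤ _ := add_rpow_le hq (norm_nonneg _) (norm_nonneg _)
    _ ≤ _ := by gcongr

end WDeriv

/-- A continuous integrand of `q`-growth is integrable along the velocity of a `W^{1,q}` curve. -/
lemma HasWDeriv.integrableOn_comp {T q : ℝ} {hT : 0 ≤ T} {γ : PathSpace T d} {z : ℝ → Fin d → ℝ}
    (hz : HasWDeriv T q hT γ z) {φ : (Fin d → ℝ) → ℝ} (hφ : Continuous φ) {A B : ℝ}
    (hgr : ∀ v, |φ v| ≤ A * ‖v‖ ^ q + B) : IntegrableOn (fun s => φ (z s)) (Icc 0 T) := by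
  refine Integrable.mono' ((hz.2.1.const_mul A).add (integrable_const B))
    (hφ.comp_aestronglyMeasurable hz.1.aestronglyMeasurable) ?_
  filter_upwards with s
  exact hgr _

/-! ### Lower semicontinuity of the action under refinement of the time grid -/

/-- The piecewise constant difference quotient of `γ` on the uniform grid with `N` cells. -/
def slopeOn {T : ℝ} (hT : 0 ≤ T) (N : ℕ) (γ : PathSpace T d) (t : ℝ) : Fin d → ℝ :=
  (T / N)⁻¹ • (ev hT γ (((⌊t / (T / N)⌋₊ + 1 : ℕ) : ℝ) * (T / N)) -
    ev hT γ (⌊t / (T / N)⌋₊ * (T / N)))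

lemma integrableOn_slopeOn {T : ℝ} (hT : 0 < T) {N : ℕ} (hN : 0 < N) (γ : PathSpace T d)
    {F : Type*} [NormedAddCommGroup F] (φ : (Fin d → ℝ) → F) :
    IntegrableOn (fun t => φ (slopeOn hT.le N γ t)) (Icc 0 T) := by
  have h1 : (0 : ℝ) < N := by exact_mod_cast hN
  have := intervalIntegrable_floor (show 0 < T / N by positivity)
    (fun k : ℕ => φ ((T / N)⁻¹ • (ev hT.le γ (((k + 1 : ℕ) : ℝ) * (T / N)) -
      ev hT.le γ (k * (T / N))))) N
  rw [mul_div_cancel₀ _ h1.ne'] at this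
  exact (intervalIntegrable_iff_integrableOn_Icc_of_le hT.le).1 this

lemma integral_slopeOn {T : ℝ} (hT : 0 < T) {N : ℕ} (hN : 0 < N) (γ : PathSpace T d)
    (φ : (Fin d → ℝ) → ℝ) :
    ∫ t in Icc 0 T, φ (slopeOn hT.le N γ t) = actionOn hT.le φ N γ := by
  have h1 : (0 : ℝ) < N := by exact_mod_cast hN
  have := integral_floor (show 0 < T / N by positivity)
    (fun k : ℕ => φ ((T / N)⁻¹ • (ev hT.le γ (((k + 1 : ℕ) : ℝ) * (T / N)) -
      ev hT.le γ (k * (T / N))))) N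
  rw [mul_div_cancel₀ _ h1.ne'] at this
  rw [integral_Icc_eq_interval hT.le]
  simp only [slopeOn]
  rw [this, actionOn]
  simp only [Nat.cast_add, Nat.cast_one, smul_eq_mul]

lemma uniformContinuous_ev {T : ℝ} (hT : 0 ≤ T) (γ : PathSpace T d) :
    UniformContinuous (ev hT γ) :=
  (CompactSpace.uniformContinuous_of_continuous γ.continuous).comp
    (LipschitzWith.projIcc hT).uniformContinuous

lemma tendsto_mesh (T : ℝ) {φ : ℕ → ℕ} (hφ : Tendsto φ atTop atTop) :
    Tendsto (fun j => T / (φ j : ℝ)) atTop (𝓝 0) :=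
  (tendsto_natCast_atTop_atTop.comp hφ).const_div_atTop T

lemma tendsto_integral_slopeOn {T : ℝ} (hT : 0 < T) (γ : PathSpace T d) {φ : ℕ → ℕ}
    (hφ : Tendsto φ atTop atTop) (hφ0 : ∀ j, 0 < φ j) {t : ℝ} (ht : t ∈ Icc 0 T) :
    Tendsto (fun j => ∫ s in 0..t, slopeOn hT.le (φ j) γ s) atTop
      (𝓝 (ev hT.le γ t - ev hT.le γ 0)) := by
  rw [Metric.tendsto_nhds]
  intro ε hε
  obtain ⟨δ, hδ, hu⟩ := Metric.uniformContinuous_iff.1 (uniformContinuous_ev hT.le γ) ε hε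
  filter_upwards [(tendsto_mesh T hφ).eventually (gt_mem_nhds hδ)] with j hj
  have h1 : (0 : ℝ) < φ j := by exact_mod_cast hφ0 j
  have hh : 0 < T / φ j := by positivity
  obtain ⟨k, hk, hk1, hk2⟩ := exists_cell hT (hφ0 j) ht
  have := integral_slope hh (fun k : ℕ => ev hT.le γ (k * (T / φ j))) hk1 hk2
  simp only [slopeOn]
  rw [this]
  simp only [Nat.cast_zero, zero_mul, dist_sub_right]
  set θ := (t - k * (T / φ j)) / (T / φ j) with hθ
  have hθ0 : 0 ≤ θ := div_nonneg (by linarith) hh.le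
  have hθ1 : θ ≤ 1 := by
    rw [hθ, div_le_one hh]; linarith
  have ha : dist (ev hT.le γ (k * (T / φ j))) (ev hT.le γ t) < ε := by
    refine hu ?_
    rw [Real.dist_eq, abs_lt]
    constructor <;> linarith
  have hb : dist (ev hT.le γ (((k + 1 : ℕ) : ℝ) * (T / φ j))) (ev hT.le γ t) < ε := by
    refine hu ?_
    push_cast
    rw [Real.dist_eq, abs_lt]
    constructor <;> linarith
  have := (convex_ball (ev hT.le γ t) ε) (Metric.mem_ball.2 ha) (Metric.mem_ball.2 hb)
    (sub_nonneg.2 hθ1) hθ0 (by ring)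
  rw [Metric.mem_ball] at this
  convert this using 2
  module

lemma tendsto_slopeOn {T : ℝ} (hT : 0 < T) (γ : PathSpace T d) {φ : ℕ → ℕ}
    (hφ : Tendsto φ atTop atTop) (hφ0 : ∀ j, 0 < φ j) {t : ℝ} (ht : 0 ≤ t) {D : Fin d → ℝ}
    (hD : HasDerivAt (ev hT.le γ) D t) :
    Tendsto (fun j => slopeOn hT.le (φ j) γ t) atTop (𝓝 D) := by
  rw [Metric.tendsto_nhds]
  intro ε hε
  have ho := (hasDerivAt_iff_isLittleO.1 hD).def (show 0 < ε / 3 by positivity)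
  obtain ⟨δ, hδ, hu⟩ := Metric.eventually_nhds_iff.1 ho
  filter_upwards [(tendsto_mesh T hφ).eventually (gt_mem_nhds hδ)] with j hj
  have h1 : (0 : ℝ) < φ j := by exact_mod_cast hφ0 j
  have hh : 0 < T / φ j := by positivity
  set h := T / (φ j : ℝ) with hhdef
  set k := ⌊t / h⌋₊ with hk
  have hk1 : (k : ℝ) * h ≤ t := (le_div_iff₀ hh).1 (Nat.floor_le (div_nonneg ht hh.le))
  have hk2 : t ≤ ((k : ℝ) + 1) * h := (div_le_iff₀ hh).1 (Nat.lt_floor_add_one _).le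
  have key : ∀ s, |s - t| ≤ h →
      ‖ev hT.le γ s - ev hT.le γ t - (s - t) • D‖ ≤ ε / 3 * h := by
    intro s hs
    refine (hu (by rw [Real.dist_eq]; exact hs.trans_lt hj)).trans ?_
    rw [Real.norm_eq_abs]
    gcongr
  have ka := key (k * h) (by rw [abs_le]; constructor <;> linarith)
  have kb := key (((k : ℝ) + 1) * h) (by rw [abs_le]; constructor <;> linarith)
  have e : slopeOn hT.le (φ j) γ t - D = h⁻¹ •
      ((ev hT.le γ (((k : ℝ) + 1) * h) - ev hT.le γ t - (((k : ℝ) + 1) * h - t) • D) -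
      (ev hT.le γ (k * h) - ev hT.le γ t - (k * h - t) • D)) := by
    have : D = h⁻¹ • (h • D) := by rw [smul_smul, inv_mul_cancel₀ hh.ne', one_smul]
    conv_lhs => rw [this]
    simp only [slopeOn, ← hhdef, ← hk, Nat.cast_add, Nat.cast_one, ← smul_sub]
    congr 1
    module
  rw [dist_eq_norm, e, norm_smul, norm_inv, Real.norm_of_nonneg hh.le, inv_mul_lt_iff₀ hh]
  refine (norm_sub_le _ _).trans_lt ?_
  nlinarith

lemma absolutelyContinuousOnInterval_of_actionOn {T q : ℝ} (hT : 0 < T) (hq : 1 < q)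
    (γ : PathSpace T d) {φ : ℕ → ℕ} (hφ : Tendsto φ atTop atTop) (hφ0 : ∀ j, 0 < φ j) {C : ℝ}
    (hC : ∀ j, actionOn hT.le (fun v => ‖v‖ ^ q) (φ j) γ ≤ C) :
    AbsolutelyContinuousOnInterval (ev hT.le γ) 0 T := by
  have hC0 : 0 ≤ C := le_trans (by
    rw [← integral_slopeOn hT (hφ0 0)]
    exact integral_nonneg fun s => by positivity) (hC 0)
  rw [absolutelyContinuousOnInterval_iff]
  intro ε hε
  obtain ⟨K, hK, hKε⟩ : ∃ K : ℝ, 0 < K ∧ K ^ (1 - q) * C < ε / 2 := by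
    have h2 : Tendsto (fun K : ℝ => K ^ (1 - q) * C) atTop (𝓝 0) := by
      simpa using (tendsto_rpow_one_sub hq).mul_const C
    exact ((eventually_gt_atTop 0).and (h2.eventually (gt_mem_nhds (half_pos hε)))).exists
  refine ⟨ε / 2 / K, by positivity, ?_⟩
  rintro ⟨n, I⟩ hE hlen
  have hsub := AbsolutelyContinuousOnInterval.biUnion_uIoc_subset_of_mem_disjWithin hE
  rw [uIoc_of_le hT.le] at hsub
  obtain ⟨hE1, hE2⟩ := hE
  simp only [uIcc_of_le hT.le] at hE1 hE2 hlen ⊢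
  have hlim : Tendsto (fun j => ∑ i ∈ Finset.range n,
      ‖∫ s in (I i).1..(I i).2, slopeOn hT.le (φ j) γ s‖) atTop
      (𝓝 (∑ i ∈ Finset.range n, dist (ev hT.le γ (I i).1) (ev hT.le γ (I i).2))) := by
    refine tendsto_finsetSum _ fun i hi => ?_
    rw [dist_comm, dist_eq_norm]
    refine Tendsto.norm ?_
    have := (tendsto_integral_slopeOn hT γ hφ hφ0 (hE1 i hi).2).sub
      (tendsto_integral_slopeOn hT γ hφ hφ0 (hE1 i hi).1)
    rw [sub_sub_sub_cancel_right] at this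
    refine this.congr fun j => ?_
    have hint : ∀ t ∈ Icc 0 T, IntervalIntegrable (slopeOn hT.le (φ j) γ) volume 0 t := by
      intro t ht
      rw [intervalIntegrable_iff_integrableOn_Icc_of_le ht.1]
      exact (integrableOn_slopeOn hT (hφ0 j) γ id).mono_set (Icc_subset_Icc_right ht.2)
    rw [intervalIntegral.integral_interval_sub_left (hint _ (hE1 i hi).2) (hint _ (hE1 i hi).1)]
  refine lt_of_le_of_lt (le_of_tendsto' hlim fun j => ?_)
    (show K * (∑ i ∈ Finset.range n, dist (I i).1 (I i).2) + K ^ (1 - q) * C < ε from ?_)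
  · set A := ⋃ i ∈ Finset.range n, uIoc (I i).1 (I i).2 with hA
    have hAm : MeasurableSet A :=
      Finset.measurableSet_biUnion _ fun i _ => measurableSet_uIoc
    have hAsub : A ⊆ Icc 0 T := hsub.trans Ioc_subset_Icc_self
    have hi1 : IntegrableOn (fun s => ‖slopeOn hT.le (φ j) γ s‖) A :=
      (integrableOn_slopeOn hT (hφ0 j) γ norm).mono_set hAsub
    have hiq := integrableOn_slopeOn hT (hφ0 j) γ (fun v => ‖v‖ ^ q)
    have hvol : volume A ≠ ⊤ := (measure_mono hAsub).trans_lt measure_Icc_lt_top |>.ne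
    have hvolr : volume.real A = ∑ i ∈ Finset.range n, dist (I i).1 (I i).2 := by
      rw [hA, measureReal_def, measure_biUnion_finset hE2 fun i _ => measurableSet_uIoc,
        ENNReal.toReal_sum]
      · refine Finset.sum_congr rfl fun i _ => ?_
        rw [Real.volume_uIoc, ENNReal.toReal_ofReal (abs_nonneg _), dist_comm, Real.dist_eq]
      · intro i _
        simp [Real.volume_uIoc]
    calc ∑ i ∈ Finset.range n, ‖∫ s in (I i).1..(I i).2, slopeOn hT.le (φ j) γ s‖
        ≤ ∑ i ∈ Finset.range n, ∫ s in uIoc (I i).1 (I i).2, ‖slopeOn hT.le (φ j) γ s‖ :=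
          Finset.sum_le_sum fun i _ => intervalIntegral.norm_integral_le_integral_norm_uIoc
      _ = ∫ s in A, ‖slopeOn hT.le (φ j) γ s‖ := by
          rw [hA, integral_biUnion_finset _ (fun i _ => measurableSet_uIoc) hE2]
          intro i hi
          exact hi1.mono_set (subset_biUnion_of_mem (u := fun i => uIoc (I i).1 (I i).2) hi)
      _ ≤ ∫ s in A, (K + K ^ (1 - q) * ‖slopeOn hT.le (φ j) γ s‖ ^ q) := by
          refine integral_mono hi1 ?_ fun s => young_rpow hq hK (norm_nonneg _)
          exact (integrableOn_const hvol).add ((hiq.mono_set hAsub).const_mul _)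
      _ = K * volume.real A + K ^ (1 - q) * ∫ s in A, ‖slopeOn hT.le (φ j) γ s‖ ^ q := by
          have : IsFiniteMeasure (volume.restrict A) := ⟨by simpa using hvol.lt_top⟩
          rw [integral_add (integrable_const _) ((hiq.mono_set hAsub).const_mul _),
            integral_const_mul, setIntegral_const, smul_eq_mul, mul_comm]
      _ ≤ _ := by
          rw [hvolr]
          gcongr
          refine le_trans ?_ (hC j)
          rw [← integral_slopeOn hT (hφ0 j)]
          exact setIntegral_mono_set hiq (ae_of_all _ fun s => by positivity)
            hAsub.eventuallyLE
  · have : K * (∑ i ∈ Finset.range n, dist (I i).1 (I i).2) < ε / 2 := by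
      rw [mul_comm]
      exact (lt_div_iff₀ hK).1 hlen
    linarith

lemma actionOn_add_const {T : ℝ} (hT : 0 ≤ T) (φ : (Fin d → ℝ) → ℝ) (c : ℝ) {N : ℕ} (hN : 0 < N)
    (γ : PathSpace T d) : actionOn hT (fun v => φ v + c) N γ = actionOn hT φ N γ + T * c := by
  have h1 : (N : ℝ) ≠ 0 := by exact_mod_cast hN.ne'
  simp only [actionOn, mul_add, Finset.sum_add_distrib, Finset.sum_const, Finset.card_range,
    nsmul_eq_mul]
  field_simp

lemma actionOn_mono {T : ℝ} (hT : 0 ≤ T) {φ ψ : (Fin d → ℝ) → ℝ} (h : ∀ v, φ v ≤ ψ v) (N : ℕ)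
    (γ : PathSpace T d) : actionOn hT φ N γ ≤ actionOn hT ψ N γ :=
  Finset.sum_le_sum fun _ _ => mul_le_mul_of_nonneg_left (h _) (by positivity)

lemma actionOn_const_mul {T : ℝ} (hT : 0 ≤ T) (φ : (Fin d → ℝ) → ℝ) (c : ℝ) (N : ℕ)
    (γ : PathSpace T d) : actionOn hT (fun v => c * φ v) N γ = c * actionOn hT φ N γ := by
  simp only [actionOn, Finset.mul_sum]
  exact Finset.sum_congr rfl fun _ _ => by ring

lemma actionOn_rpow_le {T q : ℝ} (hT : 0 ≤ T) {ℓ : (Fin d → ℝ) → ℝ} {lo Cℓ : ℝ} (hlo : 0 < lo)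
    (hgrowth : ∀ α : Fin d → ℝ, lo * ‖α‖ ^ q - Cℓ ≤ ℓ α) {N : ℕ} (hN : 0 < N)
    (γ : PathSpace T d) :
    actionOn hT (fun v => ‖v‖ ^ q) N γ ≤ (actionOn hT ℓ N γ + T * Cℓ) / lo := by
  rw [le_div_iff₀ hlo, mul_comm, ← actionOn_const_mul, ← actionOn_add_const hT ℓ Cℓ hN]
  exact actionOn_mono hT (fun v => by linarith [hgrowth v]) N γ

lemma exists_hasWDeriv_of_actionOn_le {T q : ℝ} (hT : 0 < T) (hq : 1 < q)
    {ℓ : (Fin d → ℝ) → ℝ} (hl : Continuous ℓ) {lo Cℓ : ℝ} (hlo : 0 < lo)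
    (hgrowth : ∀ α : Fin d → ℝ, lo * ‖α‖ ^ q - Cℓ ≤ ℓ α)
    (γ : PathSpace T d) {φ : ℕ → ℕ} (hφ : Tendsto φ atTop atTop) (hφ0 : ∀ j, 0 < φ j)
    {a : ℕ → ℝ} {L : ℝ} (ha : Tendsto a atTop (𝓝 L))
    (hle : ∀ j, actionOn hT.le ℓ (φ j) γ ≤ a j) :
    ∃ z, HasWDeriv T q hT.le γ z ∧ ∫ t in Icc 0 T, ℓ (z t) ≤ L := by
  have hψ0 : ∀ v : Fin d → ℝ, 0 ≤ ℓ v + Cℓ := fun v => by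
    have : 0 ≤ lo * ‖v‖ ^ q := by positivity
    linarith [hgrowth v]
  obtain ⟨A, hA⟩ := ha.bddAbove_range
  have hA' : ∀ j, a j ≤ A := fun j => hA ⟨j, rfl⟩
  have hAC := absolutelyContinuousOnInterval_of_actionOn hT hq γ hφ hφ0
    (C := (A + T * Cℓ) / lo) fun j => (actionOn_rpow_le hT.le hlo hgrowth (hφ0 j) γ).trans (by
      gcongr; exact (hle j).trans (hA' j))
  have hACj : ∀ i, AbsolutelyContinuousOnInterval (fun t => ev hT.le γ t i) 0 T := by
    intro i
    rw [absolutelyContinuousOnInterval_iff] at hAC ⊢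
    intro ε hε
    obtain ⟨δ, hδ, h⟩ := hAC ε hε
    exact ⟨δ, hδ, fun E hE hE' => (Finset.sum_le_sum fun k _ => dist_le_pi_dist _ _ i).trans_lt
      (h E hE hE')⟩
  set z : ℝ → Fin d → ℝ := fun t i => deriv (fun t => ev hT.le γ t i) t with hz
  have hzi : IntegrableOn z (Icc 0 T) := Integrable.of_eval fun i =>
    (intervalIntegrable_iff_integrableOn_Icc_of_le hT.le).1 (hACj i).intervalIntegrable_deriv
  have hder : ∀ᵐ t ∂(volume.restrict (Icc 0 T)), Tendsto (fun j => slopeOn hT.le (φ j) γ t)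
      atTop (𝓝 (z t)) := by
    rw [ae_restrict_iff' measurableSet_Icc]
    have : ∀ᵐ t : ℝ, ∀ i, t ∈ uIcc 0 T → DifferentiableAt ℝ (fun t => ev hT.le γ t i) t :=
      ae_all_iff.2 fun i => (hACj i).ae_differentiableAt
    filter_upwards [this] with t ht htT
    rw [uIcc_of_le hT.le] at ht
    exact tendsto_slopeOn hT γ hφ hφ0 htT.1 (hasDerivAt_pi.2 fun i => (ht i htT).hasDerivAt)
  have hfatou : ∫⁻ t in Icc 0 T, ENNReal.ofReal (ℓ (z t) + Cℓ) ≤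
      ENNReal.ofReal (L + T * Cℓ) := by
    have h1 : ∀ᵐ t ∂(volume.restrict (Icc 0 T)), ENNReal.ofReal (ℓ (z t) + Cℓ) =
        liminf (fun j => ENNReal.ofReal (ℓ (slopeOn hT.le (φ j) γ t) + Cℓ)) atTop := by
      filter_upwards [hder] with t ht
      refine (Tendsto.liminf_eq ?_).symm
      exact ENNReal.tendsto_ofReal (((hl.tendsto _).comp ht).add_const _)
    rw [lintegral_congr_ae h1]
    refine (lintegral_liminf_le' fun j => ?_).trans ?_
    · exact (integrableOn_slopeOn hT (hφ0 j) γ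
        fun v => ℓ v + Cℓ).aestronglyMeasurable.aemeasurable.ennreal_ofReal
    · have h2 : Tendsto (fun j => ENNReal.ofReal (a j + T * Cℓ)) atTop
          (𝓝 (ENNReal.ofReal (L + T * Cℓ))) := ENNReal.tendsto_ofReal (ha.add_const _)
      rw [← h2.liminf_eq]
      refine liminf_le_liminf (Eventually.of_forall fun j => ?_)
      rw [← ofReal_integral_eq_lintegral_ofReal (integrableOn_slopeOn hT (hφ0 j) γ
        fun v => ℓ v + Cℓ) (ae_of_all _ fun t => hψ0 _), integral_slopeOn hT (hφ0 j) γ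
        fun v => ℓ v + Cℓ, actionOn_add_const _ _ _ (hφ0 j)]
      gcongr
      exact hle j
  have hψm : AEStronglyMeasurable (fun t => ℓ (z t) + Cℓ) (volume.restrict (Icc 0 T)) :=
    (hl.comp_aestronglyMeasurable hzi.aestronglyMeasurable).add aestronglyMeasurable_const
  have hψi : IntegrableOn (fun t => ℓ (z t) + Cℓ) (Icc 0 T) := by
    refine ⟨hψm, ?_⟩
    rw [hasFiniteIntegral_iff_ofReal (ae_of_all _ fun t => hψ0 _)]
    exact hfatou.trans_lt ENNReal.ofReal_lt_top
  have hW : HasWDeriv T q hT.le γ z := by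
    refine ⟨hzi, ?_, ?_⟩
    · refine Integrable.mono' (hψi.const_mul lo⁻¹)
        ((hzi.aestronglyMeasurable.norm.aemeasurable.pow_const q).aestronglyMeasurable)
        (ae_of_all _ fun t => ?_)
      rw [Real.norm_of_nonneg (by positivity), ← div_eq_inv_mul, le_div_iff₀ hlo]
      linarith [hgrowth (z t)]
    · intro t ht
      ext i
      have hsub : uIcc 0 t ⊆ uIcc 0 T := by
        rw [uIcc_of_le ht.1, uIcc_of_le hT.le]; exact Icc_subset_Icc_right ht.2
      rw [Pi.add_apply, eval_integral fun i => (hzi.mono_set (Icc_subset_Icc_right ht.2)).eval i,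
        integral_Icc_eq_interval ht.1]
      simp only [hz]
      rw [((hACj i).mono hsub).integral_deriv_eq_sub]
      ring
  refine ⟨z, hW, ?_⟩
  have hli : IntegrableOn (fun t => ℓ (z t)) (Icc 0 T) := by
    have := hψi.sub (integrable_const (μ := volume.restrict (Icc 0 T)) Cℓ)
    simpa [IntegrableOn, Pi.sub_def] using this
  have hL : 0 ≤ L + T * Cℓ := by
    refine ge_of_tendsto' (ha.add_const (T * Cℓ)) fun j => ?_
    have : 0 ≤ actionOn hT.le (fun v => ℓ v + Cℓ) (φ j) γ := by
      rw [← integral_slopeOn hT (hφ0 j)]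
      exact integral_nonneg fun s => hψ0 _
    rw [actionOn_add_const _ _ _ (hφ0 j)] at this
    linarith [hle j]
  have := (ENNReal.ofReal_le_ofReal_iff hL).1
    ((ofReal_integral_eq_lintegral_ofReal hψi (ae_of_all _ fun t => hψ0 _)).trans_le hfatou)
  rw [integral_add hli (integrable_const _)] at this
  simp [hT.le] at this
  linarith

end Curve

/-! ### Couplings and narrow convergence -/

section Coupling

variable {X : Type*} [MeasurableSpace X]

lemma exists_coupling_of_le {μ ν : Measure X} [IsProbabilityMeasure μ] [IsProbabilityMeasure ν]
    {κ : Measure (X × X)} (h1 : κ.map Prod.fst ≤ μ) (h2 : κ.map Prod.snd ≤ ν) :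
    ∃ π : Measure (X × X), π.map Prod.fst = μ ∧ π.map Prod.snd = ν ∧
      ∀ B, π B ≤ κ B + (1 - κ univ) := by
  have hf : IsFiniteMeasure (κ.map Prod.fst) := isFiniteMeasure_of_le μ h1
  have hs : IsFiniteMeasure (κ.map Prod.snd) := isFiniteMeasure_of_le ν h2
  have hu1 : (κ.map Prod.fst) univ = κ univ := by
    rw [Measure.map_apply measurable_fst MeasurableSet.univ, preimage_univ]
  have hu2 : (κ.map Prod.snd) univ = κ univ := by
    rw [Measure.map_apply measurable_snd MeasurableSet.univ, preimage_univ]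
  set σ := μ - κ.map Prod.fst with hσ
  set τ := ν - κ.map Prod.snd with hτ
  have hσu : σ univ = 1 - κ univ := by
    rw [hσ, Measure.sub_apply MeasurableSet.univ h1, hu1, measure_univ]
  have hτu : τ univ = 1 - κ univ := by
    rw [hτ, Measure.sub_apply MeasurableSet.univ h2, hu2, measure_univ]
  have hfσ : IsFiniteMeasure σ := inferInstance
  have hfτ : IsFiniteMeasure τ := inferInstance
  set r := 1 - κ univ with hr
  have hrt : r ≠ ⊤ := (tsub_le_self.trans_lt ENNReal.one_lt_top).ne
  have key : ∀ ρ : Measure X, ρ univ = r → r⁻¹ • r • ρ = ρ := by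
    intro ρ hρ
    rcases eq_or_ne r 0 with h0 | h0
    · rw [h0, Measure.measure_univ_eq_zero] at hρ
      simp [hρ]
    · rw [smul_smul, ENNReal.inv_mul_cancel h0 hrt, one_smul]
  refine ⟨κ + r⁻¹ • σ.prod τ, ?_, ?_, fun B => ?_⟩
  · rw [Measure.map_add _ _ measurable_fst, Measure.map_smul, Measure.map_fst_prod, hτu,
      key σ hσu, add_comm, Measure.sub_add_cancel_of_le h1]
  · rw [Measure.map_add _ _ measurable_snd, Measure.map_smul, Measure.map_snd_prod, hσu,
      key τ hτu, add_comm, Measure.sub_add_cancel_of_le h2]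
  · rw [Measure.add_apply, Measure.smul_apply, smul_eq_mul]
    gcongr
    calc r⁻¹ * σ.prod τ B ≤ r⁻¹ * σ.prod τ univ := by gcongr; exact subset_univ B
      _ = r⁻¹ * r * r := by
          rw [← univ_prod_univ, Measure.prod_prod, hσu, hτu, mul_assoc]
      _ ≤ 1 * r := by gcongr; exact ENNReal.inv_mul_le_one r
      _ = r := one_mul r

/-- Restrictions of two probability measures to finitely many disjoint sets can be coupled. -/
lemma exists_subcoupling {μ ν : Measure X} [IsProbabilityMeasure μ] [IsProbabilityMeasure ν]
    {G : ℕ → Set X} (hG : ∀ i, MeasurableSet (G i)) (hd : Pairwise (Function.onFun Disjoint G))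
    (m : ℕ) :
    ∃ κ : Measure (X × X), κ.map Prod.fst ≤ μ ∧ κ.map Prod.snd ≤ ν ∧
      κ univ = ∑ i ∈ Finset.range m, min (μ (G i)) (ν (G i)) ∧
      κ (⋃ i, G i ×ˢ G i)ᶜ = 0 := by
  set c : ℕ → ℝ≥0∞ := fun i => min (μ (G i)) (ν (G i)) * (μ (G i))⁻¹ * (ν (G i))⁻¹ with hc
  have hc1 : ∀ i, c i * ν (G i) ≤ 1 := by
    intro i
    calc c i * ν (G i) = (min (μ (G i)) (ν (G i)) * (μ (G i))⁻¹) * ((ν (G i))⁻¹ * ν (G i)) := by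
          rw [hc]; ring
      _ ≤ (μ (G i) * (μ (G i))⁻¹) * ((ν (G i))⁻¹ * ν (G i)) := by
          gcongr; exact min_le_left _ _
      _ ≤ 1 * 1 := by
          gcongr
          · exact ENNReal.mul_inv_le_one _
          · exact ENNReal.inv_mul_le_one _
      _ = 1 := one_mul 1
  have hc2 : ∀ i, c i * μ (G i) ≤ 1 := by
    intro i
    calc c i * μ (G i) = (min (μ (G i)) (ν (G i)) * (ν (G i))⁻¹) * ((μ (G i))⁻¹ * μ (G i)) := by
          rw [hc]; ring
      _ ≤ (ν (G i) * (ν (G i))⁻¹) * ((μ (G i))⁻¹ * μ (G i)) := by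
          gcongr; exact min_le_right _ _
      _ ≤ 1 * 1 := by
          gcongr
          · exact ENNReal.mul_inv_le_one _
          · exact ENNReal.inv_mul_le_one _
      _ = 1 := one_mul 1
  have hsum : ∀ ρ : Measure X, ∀ b : ℕ → ℝ≥0∞, (∀ i, b i ≤ 1) →
      ∑ i ∈ Finset.range m, b i • ρ.restrict (G i) ≤ ρ := by
    intro ρ b hb
    refine (Finset.sum_le_sum fun i _ => show b i • ρ.restrict (G i) ≤ ρ.restrict (G i) from
      ?_).trans ?_
    · exact Measure.le_iff.2 fun s _ => by
        rw [Measure.smul_apply, smul_eq_mul]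
        exact mul_le_of_le_one_left' (hb i)
    · refine Measure.le_iff.2 fun s hs => ?_
      rw [Measure.finsetSum_apply]
      simp only [Measure.restrict_apply hs]
      rw [← measure_biUnion_finset (fun i _ j _ hij =>
        (hd hij).mono inter_subset_right inter_subset_right) fun i _ => hs.inter (hG i)]
      exact measure_mono (iUnion₂_subset fun i _ => inter_subset_left)
  refine ⟨∑ i ∈ Finset.range m, c i • (μ.restrict (G i)).prod (ν.restrict (G i)), ?_, ?_, ?_, ?_⟩
  · rw [← Measure.mapₗ_apply_of_measurable measurable_fst, map_sum]
    simp only [Measure.mapₗ_apply_of_measurable measurable_fst, Measure.map_smul,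
      Measure.map_fst_prod, smul_smul, Measure.restrict_apply_univ]
    exact hsum μ _ hc1
  · rw [← Measure.mapₗ_apply_of_measurable measurable_snd, map_sum]
    simp only [Measure.mapₗ_apply_of_measurable measurable_snd, Measure.map_smul,
      Measure.map_snd_prod, smul_smul, Measure.restrict_apply_univ]
    exact hsum ν _ hc2
  · rw [Measure.finsetSum_apply]
    refine Finset.sum_congr rfl fun i _ => ?_
    rw [Measure.smul_apply, ← univ_prod_univ, Measure.prod_prod, Measure.restrict_apply_univ,
      Measure.restrict_apply_univ, smul_eq_mul, hc]
    rcases eq_or_ne (μ (G i)) 0 with h | h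
    · simp [h]
    rcases eq_or_ne (ν (G i)) 0 with h' | h'
    · simp [h']
    calc _ = min (μ (G i)) (ν (G i)) * ((μ (G i))⁻¹ * μ (G i)) * ((ν (G i))⁻¹ * ν (G i)) := by
          ring
      _ = _ := by
          rw [ENNReal.inv_mul_cancel h (measure_ne_top _ _),
            ENNReal.inv_mul_cancel h' (measure_ne_top _ _), mul_one, mul_one]
  · rw [Measure.finsetSum_apply]
    refine Finset.sum_eq_zero fun i _ => ?_
    rw [Measure.smul_apply, Measure.prod_restrict, Measure.restrict_apply]
    · have : (⋃ i, G i ×ˢ G i)ᶜ ∩ G i ×ˢ G i = ∅ := by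
        rw [← disjoint_iff_inter_eq_empty, disjoint_compl_left_iff_subset]
        exact subset_iUnion (fun i => G i ×ˢ G i) i
      rw [this, measure_empty, smul_zero]
    · exact (MeasurableSet.iUnion fun i => (hG i).prod (hG i)).compl

end Coupling

section Narrow

variable {X : Type*} [MeasurableSpace X]

section Top

variable [TopologicalSpace X] [OpensMeasurableSpace X] [HasOuterApproxClosed X]
  {μs : ℕ → Measure X} {μ : Measure X} [∀ n, IsProbabilityMeasure (μs n)] [IsProbabilityMeasure μ]

lemma le_liminf_measure_open (h : ∀ F : BoundedContinuousFunction X ℝ,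
    Tendsto (fun n => ∫ x, F x ∂(μs n)) atTop (𝓝 (∫ x, F x ∂μ))) {G : Set X} (hG : IsOpen G) :
    μ G ≤ liminf (fun n => μs n G) atTop :=
  ProbabilityMeasure.le_liminf_measure_open_of_tendsto
    (μ := ⟨μ, inferInstance⟩) (μs := fun n => ⟨μs n, inferInstance⟩)
    (ProbabilityMeasure.tendsto_iff_forall_integral_tendsto.2 h) hG

lemma integrable_and_integral_le_of_narrow (h : ∀ F : BoundedContinuousFunction X ℝ,
    Tendsto (fun n => ∫ x, F x ∂(μs n)) atTop (𝓝 (∫ x, F x ∂μ))) {F : X → ℝ} (hF : Continuous F)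
    (hF0 : ∀ x, 0 ≤ F x) {c : ℕ → ℝ} {C : ℝ} (hc : Tendsto c atTop (𝓝 C))
    (hi : ∀ n, Integrable F (μs n)) (hC : ∀ᶠ n in atTop, ∫ x, F x ∂(μs n) ≤ c n) :
    Integrable F μ ∧ ∫ x, F x ∂μ ≤ C := by
  have h1 : ∫⁻ x, ENNReal.ofReal (F x) ∂μ ≤ ENNReal.ofReal C := by
    refine (lintegral_le_liminf_lintegral_of_forall_isOpen_measure_le_liminf_measure hF hF0
      fun G hG => le_liminf_measure_open h hG).trans ?_
    rw [← (ENNReal.tendsto_ofReal hc).liminf_eq]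
    refine liminf_le_liminf ?_
    filter_upwards [hC] with n hn
    rw [← ofReal_integral_eq_lintegral_ofReal (hi n) (ae_of_all _ hF0)]
    exact ENNReal.ofReal_le_ofReal hn
  have h2 : Integrable F μ := by
    refine ⟨hF.measurable.aestronglyMeasurable, ?_⟩
    rw [hasFiniteIntegral_iff_ofReal (ae_of_all _ hF0)]
    exact h1.trans_lt ENNReal.ofReal_lt_top
  refine ⟨h2, ?_⟩
  have hC0 : 0 ≤ C := ge_of_tendsto hc (hC.mono fun n hn => (integral_nonneg hF0).trans hn)
  rw [← ofReal_integral_eq_lintegral_ofReal h2 (ae_of_all _ hF0)] at h1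
  exact (ENNReal.ofReal_le_ofReal_iff hC0).1 h1

end Top

variable [PseudoMetricSpace X] [SecondCountableTopology X] [BorelSpace X]

/-- Disjoint open sets of small diameter covering almost everything. -/
lemma exists_disjoint_open_cover [Nonempty X] (μ : Measure X) [IsFiniteMeasure μ] {δ : ℝ}
    (hδ : 0 < δ) :
    ∃ G : ℕ → Set X, (∀ i, IsOpen (G i)) ∧ Pairwise (Function.onFun Disjoint G) ∧
      (∀ i, ∀ x ∈ G i, ∀ y ∈ G i, dist x y ≤ δ) ∧ μ (⋃ i, G i)ᶜ = 0 := by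
  obtain ⟨u, hu⟩ := TopologicalSpace.exists_dense_seq X
  choose r hr hr0 using fun i : ℕ =>
    exists_null_frontier_thickening μ {u i} (show δ / 4 < δ / 2 by linarith)
  simp only [Metric.thickening_singleton] at hr0
  set G : ℕ → Set X := fun i =>
    Metric.ball (u i) (r i) \ ⋃ j ∈ Finset.range i, closure (Metric.ball (u j) (r j)) with hGdef
  have hlt : ∀ i j, i < j → Disjoint (G i) (G j) := by
    intro i j hij
    rw [Set.disjoint_left]
    intro x hx hx'
    refine hx'.2 (mem_iUnion₂.2 ⟨i, Finset.mem_range.2 hij, subset_closure hx.1⟩)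
  refine ⟨G, fun i => ?_, ?_, ?_, ?_⟩
  · exact Metric.isOpen_ball.sdiff
      ((Finset.range i).finite_toSet.isClosed_biUnion fun _ _ => isClosed_closure)
  · intro i j hij
    rcases lt_or_gt_of_ne hij with h | h
    · exact hlt i j h
    · exact (hlt j i h).symm
  · intro i x hx y hy
    have h1 := Metric.mem_ball.1 hx.1
    have h2 := Metric.mem_ball'.1 hy.1
    have := (hr i).2
    linarith [dist_triangle x (u i) y]
  · have hsub : (⋃ i, G i)ᶜ ⊆ ⋃ j, frontier (Metric.ball (u j) (r j)) := by
      intro x hx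
      by_contra hcon
      simp only [mem_iUnion, not_exists] at hcon
      have hex : ∃ i, x ∈ Metric.ball (u i) (r i) := by
        obtain ⟨i, hi⟩ := hu.exists_dist_lt x (show 0 < δ / 4 by positivity)
        exact ⟨i, Metric.mem_ball.2 (hi.trans (hr i).1)⟩
      classical
      refine hx (mem_iUnion.2 ⟨Nat.find hex, Nat.find_spec hex, ?_⟩)
      simp only [mem_iUnion, not_exists, Finset.mem_range]
      intro j hj hxj
      refine hcon j ⟨hxj, ?_⟩
      rw [Metric.isOpen_ball.interior_eq]
      exact Nat.find_min hex hj
    exact measure_mono_null hsub (measure_iUnion_null fun j => hr0 j)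

variable {μs : ℕ → Measure X} {μ : Measure X} [∀ n, IsProbabilityMeasure (μs n)]
  [IsProbabilityMeasure μ]

lemma eventually_exists_coupling (h : ∀ F : BoundedContinuousFunction X ℝ,
    Tendsto (fun n => ∫ x, F x ∂(μs n)) atTop (𝓝 (∫ x, F x ∂μ))) {δ : ℝ} (hδ : 0 < δ) :
    ∀ᶠ n in atTop, ∃ π : Measure (X × X), π.map Prod.fst = μs n ∧ π.map Prod.snd = μ ∧
      π {p | δ < dist p.1 p.2} ≤ ENNReal.ofReal δ := by
  have : Nonempty X := nonempty_of_isProbabilityMeasure μ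
  obtain ⟨G, hGo, hGd, hGδ, hG0⟩ := exists_disjoint_open_cover μ hδ
  have hsum : HasSum (fun i => μ (G i)) 1 := by
    have h1 : μ (⋃ i, G i) = 1 := by
      rw [← prob_compl_eq_zero_iff (MeasurableSet.iUnion fun i => (hGo i).measurableSet)]
      exact hG0
    rw [← h1, measure_iUnion hGd fun i => (hGo i).measurableSet]
    exact ENNReal.summable.hasSum
  have hlt1 : 1 - ENNReal.ofReal δ < 1 :=
    ENNReal.sub_lt_self ENNReal.one_ne_top one_ne_zero (by simpa using hδ)
  obtain ⟨m, hm⟩ := (hsum.tendsto_sum_nat.eventually (lt_mem_nhds hlt1)).exists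
  have hmin : Tendsto (fun n => ∑ i ∈ Finset.range m, min (μs n (G i)) (μ (G i))) atTop
      (𝓝 (∑ i ∈ Finset.range m, μ (G i))) := by
    refine tendsto_finsetSum _ fun i _ => ?_
    refine tendsto_of_le_liminf_of_limsup_le ?_ ?_
    · rw [liminf_min]
      exact le_min (le_liminf_measure_open h (hGo i)) (liminf_const _).ge
    · exact limsup_le_of_le (h := Eventually.of_forall fun n => min_le_right _ _)
  filter_upwards [hmin.eventually (lt_mem_nhds hm)] with n hn
  obtain ⟨κ, h1, h2, h3, h4⟩ := exists_subcoupling (μ := μs n) (ν := μ)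
    (fun i => (hGo i).measurableSet) hGd m
  obtain ⟨π, hπ1, hπ2, hπ⟩ := exists_coupling_of_le h1 h2
  refine ⟨π, hπ1, hπ2, (hπ _).trans ?_⟩
  have h5 : κ {p | δ < dist p.1 p.2} = 0 := by
    refine measure_mono_null (fun p hp => ?_) h4
    intro hcon
    obtain ⟨i, hi⟩ := mem_iUnion.1 hcon
    exact absurd (hGδ i _ hi.1 _ hi.2) (not_le.2 hp)
  rw [h5, zero_add, h3, tsub_le_iff_left]
  rw [← tsub_le_iff_right]
  exact hn.le

end Narrow

section WOne

variable {X : Type*} [MeasurableSpace X] [PseudoMetricSpace X]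

lemma W1_nonneg (μ ν : Measure X) : 0 ≤ W1 μ ν := by
  refine Real.sInf_nonneg ?_
  rintro r ⟨γ, -, -, rfl⟩
  exact integral_nonneg fun _ => dist_nonneg

lemma W1_map_le [SecondCountableTopology X] [BorelSpace X] {Y : Type*} [MeasurableSpace Y]
    (π : Measure Y) {a b : Y → X} (ha : Measurable a) (hb : Measurable b) :
    W1 (π.map a) (π.map b) ≤ ∫ y, dist (a y) (b y) ∂π := by
  refine csInf_le ⟨0, ?_⟩ ⟨π.map fun y => (a y, b y), ?_, ?_, ?_⟩
  · rintro r ⟨γ, -, -, rfl⟩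
    exact integral_nonneg fun _ => dist_nonneg
  · rw [Measure.map_map measurable_fst (ha.prodMk hb)]
    rfl
  · rw [Measure.map_map measurable_snd (ha.prodMk hb)]
    rfl
  · rw [integral_map (ha.prodMk hb).aemeasurable]
    exact (continuous_dist.measurable).aestronglyMeasurable

end WOne

lemma isProbabilityMeasure_of_map {X Y : Type*} [MeasurableSpace X] [MeasurableSpace Y]
    {π : Measure X} {a : X → Y} (ha : Measurable a) {μ : Measure Y} [IsProbabilityMeasure μ]
    (h : π.map a = μ) : IsProbabilityMeasure π :=
  ⟨by rw [← preimage_univ (f := a), ← Measure.map_apply ha MeasurableSet.univ, h, measure_univ]⟩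

/-- Narrow convergence together with bounded `q`-moments yields couplings of small cost. -/
lemma eventually_exists_coupling_dist {E : Type*} [NormedAddCommGroup E] [MeasurableSpace E]
    [SecondCountableTopology E] [BorelSpace E] {μs : ℕ → Measure E} {μ : Measure E}
    [∀ n, IsProbabilityMeasure (μs n)] [IsProbabilityMeasure μ]
    (h : ∀ F : BoundedContinuousFunction E ℝ,
      Tendsto (fun n => ∫ x, F x ∂(μs n)) atTop (𝓝 (∫ x, F x ∂μ))) {q C : ℝ} (hq : 1 < q)
    (hi : ∀ n, Integrable (fun x => ‖x‖ ^ q) (μs n)) (hC : ∀ n, ∫ x, ‖x‖ ^ q ∂(μs n) ≤ C)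
    (hi' : Integrable (fun x => ‖x‖ ^ q) μ) (hC' : ∫ x, ‖x‖ ^ q ∂μ ≤ C) {η : ℝ} (hη : 0 < η) :
    ∀ᶠ n in atTop, ∃ π : Measure (E × E), π.map Prod.fst = μs n ∧ π.map Prod.snd = μ ∧
      Integrable (fun p => dist p.1 p.2) π ∧ ∫ p, dist p.1 p.2 ∂π ≤ η := by
  obtain ⟨K, hK, hKη⟩ : ∃ K : ℝ, 0 < K ∧ K ^ (1 - q) * (2 ^ q * (2 * C)) < η / 2 := by
    have h2 : Tendsto (fun K : ℝ => K ^ (1 - q) * (2 ^ q * (2 * C))) atTop (𝓝 0) := by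
      simpa using (tendsto_rpow_one_sub hq).mul_const (2 ^ q * (2 * C))
    exact ((eventually_gt_atTop 0).and (h2.eventually (gt_mem_nhds (half_pos hη)))).exists
  set δ := η / 2 / (1 + K) with hδ
  have hδ0 : 0 < δ := by positivity
  filter_upwards [eventually_exists_coupling h hδ0] with n hn
  obtain ⟨π, h1, h2, h3⟩ := hn
  have hπ : IsProbabilityMeasure π := isProbabilityMeasure_of_map measurable_fst h1
  have hqm : ∀ ρ : Measure E, AEStronglyMeasurable (fun x : E => ‖x‖ ^ q) ρ := fun ρ =>
    (continuous_norm.rpow_const fun _ => Or.inr (by linarith)).measurable.aestronglyMeasurable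
  have i1 : Integrable (fun p : E × E => ‖p.1‖ ^ q) π := by
    have := hi n
    rw [← h1, integrable_map_measure (hqm _) measurable_fst.aemeasurable] at this
    exact this
  have i2 : Integrable (fun p : E × E => ‖p.2‖ ^ q) π := by
    rw [← h2, integrable_map_measure (hqm _) measurable_snd.aemeasurable] at hi'
    exact hi'
  have e1 : ∫ p, ‖p.1‖ ^ q ∂π ≤ C := by
    have := hC n
    rw [← h1, integral_map measurable_fst.aemeasurable (hqm _)] at this
    exact this
  have e2 : ∫ p, ‖p.2‖ ^ q ∂π ≤ C := by
    rw [← h2, integral_map measurable_snd.aemeasurable (hqm _)] at hC'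
    exact hC'
  set S : Set (E × E) := {p | δ < dist p.1 p.2} with hS
  have hSm : MeasurableSet S :=
    (isOpen_lt continuous_const continuous_dist).measurableSet
  have hSδ : π.real S ≤ δ := by
    rw [measureReal_def]
    exact (ENNReal.toReal_mono ENNReal.ofReal_ne_top h3).trans (ENNReal.toReal_ofReal hδ0.le).le
  have hpt : ∀ p : E × E, dist p.1 p.2 ≤ δ + S.indicator (fun _ => K) p +
      K ^ (1 - q) * 2 ^ q * (‖p.1‖ ^ q + ‖p.2‖ ^ q) := by
    intro p
    have hnn : 0 ≤ K ^ (1 - q) * 2 ^ q * (‖p.1‖ ^ q + ‖p.2‖ ^ q) := by positivity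
    by_cases hp : p ∈ S
    · rw [indicator_of_mem hp]
      have hy := young_rpow hq hK (dist_nonneg (x := p.1) (y := p.2))
      have hd : dist p.1 p.2 ^ q ≤ 2 ^ q * (‖p.1‖ ^ q + ‖p.2‖ ^ q) := by
        refine le_trans ?_ (add_rpow_le hq (norm_nonneg _) (norm_nonneg _))
        rw [dist_eq_norm]
        exact Real.rpow_le_rpow (norm_nonneg _) (norm_sub_le _ _) (by linarith)
      have := mul_le_mul_of_nonneg_left hd (show 0 ≤ K ^ (1 - q) by positivity)
      linarith
    · rw [indicator_of_notMem hp]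
      have : dist p.1 p.2 ≤ δ := not_lt.1 hp
      linarith
  have iS : Integrable (fun p => S.indicator (fun _ => K) p) π :=
    (integrable_const K).indicator hSm
  have iA : Integrable (fun p => δ + S.indicator (fun _ => K) p) π := (integrable_const δ).add iS
  have iq : Integrable (fun p : E × E => ‖p.1‖ ^ q + ‖p.2‖ ^ q) π := i1.add i2
  have hI : Integrable (fun p => δ + S.indicator (fun _ => K) p +
      K ^ (1 - q) * 2 ^ q * (‖p.1‖ ^ q + ‖p.2‖ ^ q)) π := iA.add (iq.const_mul _)
  have hd : Integrable (fun p : E × E => dist p.1 p.2) π :=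
    hI.mono' continuous_dist.measurable.aestronglyMeasurable (ae_of_all _ fun p => by
      rw [Real.norm_of_nonneg dist_nonneg]; exact hpt p)
  refine ⟨π, h1, h2, hd, (integral_mono hd hI hpt).trans ?_⟩
  rw [integral_add iA (iq.const_mul _), integral_add (integrable_const δ) iS, integral_const_mul,
    integral_add i1 i2, integral_indicator_const _ hSm, integral_const, probReal_univ, smul_eq_mul,
    smul_eq_mul, one_mul]
  have hδK : δ * (1 + K) = η / 2 := div_mul_cancel₀ _ (by positivity)
  have h4 : π.real S * K ≤ δ * K := by gcongr
  have h5 : K ^ (1 - q) * 2 ^ q * (∫ p, ‖p.1‖ ^ q ∂π + ∫ p, ‖p.2‖ ^ q ∂π) ≤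
      K ^ (1 - q) * (2 ^ q * (2 * C)) := by
    rw [mul_assoc]
    gcongr
    linarith
  nlinarith

/-! ### Tightness of path measures with bounded energy -/

section Tight

variable {d : ℕ} {T : ℝ}

lemma isCompact_equicontinuous_paths {q : ℝ} (hq : 1 < q) (R A : ℝ) :
    IsCompact {γ : PathSpace T d | (∀ t : Icc 0 T, ‖γ t‖ ≤ R) ∧ ∀ K : ℝ, 0 < K →
      ∀ a b : Icc 0 T, ‖γ b - γ a‖ ≤ K * |(b : ℝ) - a| + K ^ (1 - q) * A} := by
  set P : (Icc 0 T → Fin d → ℝ) → Prop := fun γ => (∀ t : Icc 0 T, ‖γ t‖ ≤ R) ∧ ∀ K : ℝ, 0 < K →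
      ∀ a b : Icc 0 T, ‖γ b - γ a‖ ≤ K * |(b : ℝ) - a| + K ^ (1 - q) * A with hP
  have hmod : ∀ ε > 0, ∃ δ > 0, ∀ γ, P γ → ∀ a b : Icc 0 T,
      dist a b < δ → dist (γ a) (γ b) < ε := by
    intro ε hε
    obtain ⟨K, hK, hKε⟩ : ∃ K : ℝ, 0 < K ∧ K ^ (1 - q) * A < ε / 2 := by
      have h2 : Tendsto (fun K : ℝ => K ^ (1 - q) * A) atTop (𝓝 0) := by
        simpa using (tendsto_rpow_one_sub hq).mul_const A
      exact ((eventually_gt_atTop 0).and (h2.eventually (gt_mem_nhds (half_pos hε)))).exists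
    refine ⟨ε / 2 / K, by positivity, fun γ hγ a b hab => ?_⟩
    rw [dist_comm, dist_eq_norm]
    refine (hγ.2 K hK a b).trans_lt ?_
    rw [dist_comm, Subtype.dist_eq, Real.dist_eq, lt_div_iff₀ hK] at hab
    linarith
  refine ArzelaAscoli.isCompact_of_equicontinuous _ ?_ ?_
  · have himg : (ContinuousMap.toFun '' {γ : PathSpace T d | P γ}) = {f | P f} := by
      ext f
      constructor
      · rintro ⟨γ, hγ, rfl⟩
        exact hγ
      · intro hf
        refine ⟨⟨f, ?_⟩, hf, rfl⟩
        refine (Metric.uniformContinuous_iff.2 fun ε hε => ?_).continuous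
        obtain ⟨δ, hδ, h⟩ := hmod ε hε
        exact ⟨δ, hδ, fun {a b} hab => h f hf a b hab⟩
    have hcl : IsClosed {f | P f} := by
      simp only [hP, ofPred_and, ofPred_forall]
      refine IsClosed.inter (isClosed_iInter fun t => ?_) (isClosed_iInter fun K =>
        isClosed_iInter fun _ => isClosed_iInter fun a => isClosed_iInter fun b => ?_)
      · exact isClosed_le (by fun_prop) continuous_const
      · exact isClosed_le (by fun_prop) continuous_const
    change IsCompact (ContinuousMap.toFun '' {γ : PathSpace T d | P γ})
    rw [himg]
    refine (isCompact_univ_pi fun _ : Icc 0 T =>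
      isCompact_closedBall (0 : Fin d → ℝ) R).of_isClosed_subset hcl fun f hf t _ => ?_
    simpa using hf.1 t
  · refine (Metric.uniformEquicontinuous_iff.2 fun ε hε => ?_).equicontinuous
    obtain ⟨δ, hδ, h⟩ := hmod ε hε
    exact ⟨δ, hδ, fun a b hab γ => h _ γ.2 a b hab⟩

lemma exists_isNarrowLimitPoint [MeasurableSpace (PathSpace T d)] [BorelSpace (PathSpace T d)]
    (hT : 0 < T) {q : ℝ} (hq : 1 < q) {ξ : ℕ → Measure (PathSpace T d)}
    [∀ n, IsProbabilityMeasure (ξ n)] {R C : ℝ} (E : ℕ → PathSpace T d → ℝ)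
    (hξ : ∀ n, ∀ᵐ γ ∂(ξ n), ‖ev hT.le γ 0‖ ≤ R ∧ ∃ z, HasWDeriv T q hT.le γ z ∧
      ∫ t in Icc 0 T, ‖z t‖ ^ q = E n γ)
    (hE : ∀ n, Integrable (E n) (ξ n)) (hEC : ∀ n, ∫ γ, E n γ ∂(ξ n) ≤ C) :
    ∃ ξs : Measure (PathSpace T d), IsProbabilityMeasure ξs ∧ IsNarrowLimitPoint ξ ξs := by
  set μ : ℕ → ProbabilityMeasure (PathSpace T d) := fun n => ⟨ξ n, inferInstance⟩ with hμ
  have htight : IsTightMeasureSet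
      {x : Measure (PathSpace T d) | ∃ ν ∈ range μ, (ν : Measure _) = x} := by
    rw [isTightMeasureSet_iff_exists_isCompact_measure_compl_le]
    intro ε hε
    obtain ⟨A, hA0, hA⟩ : ∃ A : ℝ, 0 < A ∧ ENNReal.ofReal (C / A) < ε := by
      have h1 : Tendsto (fun A : ℝ => ENNReal.ofReal (C / A)) atTop (𝓝 0) := by
        simpa using ENNReal.tendsto_ofReal (tendsto_id.const_div_atTop C)
      exact ((eventually_gt_atTop 0).and (h1.eventually (gt_mem_nhds hε))).exists
    refine ⟨_, isCompact_equicontinuous_paths (d := d) hq (R + (1 * T + (1 : ℝ) ^ (1 - q) * A)) A,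
      ?_⟩
    rintro _ ⟨_, ⟨n, rfl⟩, rfl⟩
    change ξ n _ ≤ ε
    have hmark : ξ n {γ | A ≤ E n γ} ≤ ENNReal.ofReal (C / A) := by
      have hnn : 0 ≤ᵐ[ξ n] E n := by
        filter_upwards [hξ n] with γ hγ
        obtain ⟨-, z, hz, hzE⟩ := hγ
        rw [← hzE]
        exact integral_nonneg fun s => by positivity
      have := mul_meas_ge_le_integral_of_nonneg hnn (hE n) A
      rw [← ENNReal.ofReal_toReal (measure_ne_top (ξ n) _)]
      refine ENNReal.ofReal_le_ofReal ?_
      rw [le_div_iff₀ hA0, mul_comm]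
      exact this.trans (hEC n)
    refine (measure_mono_ae ?_).trans (hmark.trans hA.le)
    filter_upwards [hξ n] with γ hγ hγK
    obtain ⟨h0, z, hz, hzE⟩ := hγ
    by_contra hlt
    have hlt' : E n γ < A := not_le.1 hlt
    have hev : ∀ t : Icc 0 T, ev hT.le γ t = γ t := fun t => by
      simp [ev, projIcc_val]
    have hinc : ∀ K : ℝ, 0 < K → ∀ a b : Icc 0 T,
        ‖γ b - γ a‖ ≤ K * |(b : ℝ) - a| + K ^ (1 - q) * A := by
      intro K hK a b
      rw [← hev a, ← hev b]
      refine (hz.norm_sub_le hq a.2 b.2 hK).trans ?_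
      rw [hzE]
      have : 0 ≤ K ^ (1 - q) := by positivity
      gcongr
    refine hγK ⟨fun t => ?_, hinc⟩
    have h1 := hinc 1 one_pos ⟨0, left_mem_Icc.2 hT.le⟩ t
    have h2 : ‖γ ⟨0, left_mem_Icc.2 hT.le⟩‖ ≤ R := by
      rw [← hev]; exact h0
    have h3 : |(t : ℝ) - 0| ≤ T := by
      rw [sub_zero, abs_of_nonneg t.2.1]; exact t.2.2
    have h4 := norm_le_insert' (γ t) (γ ⟨0, left_mem_Icc.2 hT.le⟩)
    simp only at h1
    linarith
  obtain ⟨ν, -, φ, hφ, hlim⟩ := (isCompact_closure_of_isTightMeasureSet htight).tendsto_subseq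
    (fun n => subset_closure (mem_range_self n))
  exact ⟨ν, inferInstance, φ, hφ, ProbabilityMeasure.tendsto_iff_forall_integral_tendsto.1 hlim⟩

end Tight

section Chain

variable {ι : Type*}

/-- The weight of a finite trajectory of the Markov chain with initial masses `p` and transition
kernels `P`. -/
def chainWeight (p : ι → ℝ) (P : ℕ → ι → ι → ℝ) (N : ℕ) (s : Fin (N + 1) → ι) : ℝ :=
  p (s 0) * ∏ k : Fin N, P (k : ℕ) (s k.castSucc) (s k.succ)

lemma sum_piFinset_snoc (A : Finset ι) (N : ℕ) (F : (Fin (N + 1) → ι) → ℝ) :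
    ∑ s ∈ Fintype.piFinset (fun _ : Fin (N + 1) => A), F s =
      ∑ s ∈ Fintype.piFinset (fun _ : Fin N => A), ∑ j ∈ A,
        F (Fin.snoc (α := fun _ => ι) s j) := by
  rw [← Finset.sum_product']
  refine Finset.sum_nbij' (fun s => (Fin.init s, s (Fin.last N)))
    (fun x => Fin.snoc (α := fun _ => ι) x.1 x.2) ?_ ?_ ?_ ?_ ?_
  · intro s hs
    rw [Fintype.mem_piFinset] at hs
    simp only [Finset.mem_product, Fintype.mem_piFinset]
    exact ⟨fun k => hs _, hs _⟩
  · rintro ⟨s, j⟩ hs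
    simp only [Finset.mem_product, Fintype.mem_piFinset] at hs
    rw [Fintype.mem_piFinset]
    intro k
    induction k using Fin.lastCases with
    | last => simpa using hs.2
    | cast k => simpa using hs.1 k
  · intro s _
    simp
  · rintro ⟨s, j⟩ _
    simp
  · intro s _
    simp

lemma chainWeight_snoc (p : ι → ℝ) (P : ℕ → ι → ι → ℝ) (N : ℕ) (s : Fin (N + 1) → ι) (j : ι) :
    chainWeight p P (N + 1) (Fin.snoc (α := fun _ => ι) s j) =
      chainWeight p P N s * P N (s (Fin.last N)) j := by
  have h0 : (Fin.snoc (α := fun _ => ι) s j : Fin (N + 2) → ι) 0 = s 0 :=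
    Fin.snoc_castSucc (α := fun _ => ι) j s 0
  rw [chainWeight, chainWeight, Fin.prod_univ_castSucc, h0]
  simp only [Fin.snoc_castSucc, Fin.succ_last, Fin.snoc_last, Fin.val_last, Fin.val_castSucc,
    Fin.succ_castSucc]
  ring

lemma chainWeight_nonneg {p : ι → ℝ} {P : ℕ → ι → ι → ℝ} {N : ℕ} {A : Finset ι}
    (hp : ∀ i ∈ A, 0 ≤ p i) (hP : ∀ k < N, ∀ i ∈ A, P k i ∈ gsimplex A) {s : Fin (N + 1) → ι}
    (hs : s ∈ Fintype.piFinset (fun _ : Fin (N + 1) => A)) : 0 ≤ chainWeight p P N s := by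
  rw [Fintype.mem_piFinset] at hs
  exact mul_nonneg (hp _ (hs _)) (Finset.prod_nonneg fun k _ => (hP k k.2 _ (hs _)).1 _)

lemma sum_chainWeight_init {p : ι → ℝ} {P : ℕ → ι → ι → ℝ} {N : ℕ} {A : Finset ι}
    (hP : ∀ k < N + 1, ∀ i ∈ A, P k i ∈ gsimplex A) (G : (Fin (N + 2) → ι) → ℝ)
    (H : (Fin (N + 1) → ι) → ℝ) (hG : ∀ s j, G (Fin.snoc (α := fun _ => ι) s j) = H s) :
    ∑ s ∈ Fintype.piFinset (fun _ : Fin (N + 2) => A), chainWeight p P (N + 1) s * G s =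
      ∑ s ∈ Fintype.piFinset (fun _ : Fin (N + 1) => A), chainWeight p P N s * H s := by
  rw [sum_piFinset_snoc]
  refine Finset.sum_congr rfl fun s hs => ?_
  rw [Fintype.mem_piFinset] at hs
  simp only [hG, chainWeight_snoc]
  have := (hP N (Nat.lt_succ_self N) (s (Fin.last N)) (hs _)).2.2
  calc _ = (chainWeight p P N s * H s) * ∑ j ∈ A, P N (s (Fin.last N)) j := by
        rw [Finset.mul_sum]
        exact Finset.sum_congr rfl fun j _ => by ring
    _ = _ := by rw [this, mul_one]

lemma sum_piFinset_one (A : Finset ι) (F : ι → ℝ) :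
    ∑ s ∈ Fintype.piFinset (fun _ : Fin 1 => A), F (s 0) = ∑ i ∈ A, F i := by
  refine Finset.sum_nbij' (fun s => s 0) (fun i _ => i) ?_ ?_ ?_ ?_ ?_
  · intro s hs
    exact Fintype.mem_piFinset.1 hs 0
  · intro i hi
    exact Fintype.mem_piFinset.2 fun _ => hi
  · intro s _
    ext k
    rw [Subsingleton.elim k 0]
  · intro i _
    rfl
  · intro i _
    rfl

lemma sum_chainWeight_apply {p : ι → ℝ} {P : ℕ → ι → ι → ℝ} {M : ℕ → ι → ℝ} {A : Finset ι} (N : ℕ)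
    (hP : ∀ k < N, ∀ i ∈ A, P k i ∈ gsimplex A) (hM0 : ∀ i ∈ A, M 0 i = p i)
    (hM : ∀ k < N, ∀ j ∈ A, M (k + 1) j = ∑ i ∈ A, P k i j * M k i) (k : Fin (N + 1)) (φ : ι → ℝ) :
    ∑ s ∈ Fintype.piFinset (fun _ : Fin (N + 1) => A), chainWeight p P N s * φ (s k) =
      ∑ i ∈ A, M k i * φ i := by
  induction N generalizing φ with
  | zero =>
    obtain rfl : k = 0 := Fin.fin_one_eq_zero k
    have := sum_piFinset_one A fun i => p i * φ i
    simp only [chainWeight, Finset.univ_eq_empty, Finset.prod_empty, mul_one]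
    rw [this]
    exact Finset.sum_congr rfl fun i hi => by rw [Fin.val_zero, hM0 i hi]
  | succ N ih =>
    have ih' := fun k φ => ih (fun k hk => hP k (by omega)) (fun k hk => hM k (by omega)) k φ
    induction k using Fin.lastCases with
    | cast k =>
      rw [sum_chainWeight_init hP _ (fun s => φ (s k)) (fun s j => by rw [Fin.snoc_castSucc]), ih']
      rfl
    | last =>
      rw [sum_piFinset_snoc]
      simp only [chainWeight_snoc, Fin.snoc_last]
      have := ih' (Fin.last N) fun i => ∑ j ∈ A, P N i j * φ j
      calc _ = ∑ s ∈ Fintype.piFinset (fun _ : Fin (N + 1) => A), chainWeight p P N s *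
              ∑ j ∈ A, P N (s (Fin.last N)) j * φ j :=
            Finset.sum_congr rfl fun s _ => by
              rw [Finset.mul_sum]
              exact Finset.sum_congr rfl fun j _ => by ring
        _ = _ := by
            rw [this]
            simp only [Finset.mul_sum, Fin.val_last]
            rw [Finset.sum_comm]
            refine Finset.sum_congr rfl fun j hj => ?_
            rw [hM N (Nat.lt_succ_self N) j hj, Finset.sum_mul]
            exact Finset.sum_congr rfl fun i _ => by ring

lemma sum_chainWeight_cost_le {p : ι → ℝ} {P : ℕ → ι → ι → ℝ} {U : ℕ → ι → ℝ}
    {c : ℕ → ι → ι → ℝ} {e : ℝ} {A : Finset ι} (N : ℕ) (hp : ∀ i ∈ A, 0 ≤ p i)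
    (hp1 : ∑ i ∈ A, p i = 1)
    (hP : ∀ k < N, ∀ i ∈ A, P k i ∈ gsimplex A)
    (hU : ∀ k < N, ∀ i ∈ A, ∑ j ∈ A, P k i j * (c k i j + U (k + 1) j) - e ≤ U k i) :
    ∑ s ∈ Fintype.piFinset (fun _ : Fin (N + 1) => A), chainWeight p P N s = 1 ∧
    ∑ s ∈ Fintype.piFinset (fun _ : Fin (N + 1) => A), chainWeight p P N s *
        (∑ k : Fin N, c k (s k.castSucc) (s k.succ) + U N (s (Fin.last N))) ≤
      ∑ s ∈ Fintype.piFinset (fun _ : Fin (N + 1) => A), chainWeight p P N s * U 0 (s 0) +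
        N * e := by
  induction N with
  | zero =>
    have := sum_piFinset_one A p
    simp [chainWeight, this, hp1]
  | succ N ih =>
    obtain ⟨ih1, ih2⟩ := ih (fun k hk => hP k (by omega)) (fun k hk => hU k (by omega))
    constructor
    · have := sum_chainWeight_init (p := p) hP (fun _ => 1) (fun _ => 1) (fun _ _ => rfl)
      simpa [ih1] using this
    have h0 : ∀ (s : Fin (N + 1) → ι) j,
        (Fin.snoc (α := fun _ => ι) s j : Fin (N + 2) → ι) 0 = s 0 := fun s j =>
      Fin.snoc_castSucc (α := fun _ => ι) j s 0
    rw [sum_chainWeight_init hP (fun s => U 0 (s 0)) (fun s => U 0 (s 0))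
      (fun s j => by simp only [h0]), sum_piFinset_snoc]
    have key : ∀ s ∈ Fintype.piFinset (fun _ : Fin (N + 1) => A),
        ∑ j ∈ A, chainWeight p P (N + 1) (Fin.snoc (α := fun _ => ι) s j) *
          (∑ k : Fin (N + 1), c k ((Fin.snoc (α := fun _ => ι) s j : Fin (N + 2) → ι) k.castSucc)
            ((Fin.snoc (α := fun _ => ι) s j : Fin (N + 2) → ι) k.succ) +
            U (N + 1) ((Fin.snoc (α := fun _ => ι) s j : Fin (N + 2) → ι) (Fin.last (N + 1)))) ≤
        chainWeight p P N s * (∑ k : Fin N, c k (s k.castSucc) (s k.succ) + U N (s (Fin.last N))) +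
          chainWeight p P N s * e := by
      intro s hs
      have hw := chainWeight_nonneg hp (fun k hk => hP k (by omega)) hs
      have hsA := Fintype.mem_piFinset.1 hs
      have h1 := hU N (Nat.lt_succ_self N) _ (hsA (Fin.last N))
      have h2 := (hP N (Nat.lt_succ_self N) _ (hsA (Fin.last N))).2.2
      set S := ∑ k : Fin N, c k (s k.castSucc) (s k.succ) with hS
      have : ∑ j ∈ A, chainWeight p P (N + 1) (Fin.snoc (α := fun _ => ι) s j) *
          (∑ k : Fin (N + 1), c k ((Fin.snoc (α := fun _ => ι) s j : Fin (N + 2) → ι) k.castSucc)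
            ((Fin.snoc (α := fun _ => ι) s j : Fin (N + 2) → ι) k.succ) +
            U (N + 1) ((Fin.snoc (α := fun _ => ι) s j : Fin (N + 2) → ι) (Fin.last (N + 1)))) =
          chainWeight p P N s * (S + ∑ j ∈ A, P N (s (Fin.last N)) j *
            (c N (s (Fin.last N)) j + U (N + 1) j)) := by
        have hS' : S = ∑ j ∈ A, P N (s (Fin.last N)) j * S := by rw [← Finset.sum_mul, h2, one_mul]
        conv_rhs => rw [hS', ← Finset.sum_add_distrib, Finset.mul_sum]
        refine Finset.sum_congr rfl fun j _ => ?_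
        rw [chainWeight_snoc, Fin.sum_univ_castSucc]
        simp only [Fin.snoc_castSucc, Fin.succ_last, Fin.snoc_last, Fin.val_last, Fin.val_castSucc,
          Fin.succ_castSucc]
        rw [← hS]
        ring
      rw [this]
      nlinarith
    calc _ ≤ _ := Finset.sum_le_sum key
      _ ≤ _ := by
        rw [Finset.sum_add_distrib, ← Finset.sum_mul, ih1]
        push_cast
        linarith

lemma neg_log_card_le_entD {A : Finset ι} {p : ι → ℝ} (hp : p ∈ gsimplex A) :
    -Real.log (A.card : ℝ) ≤ entD A p := by
  obtain ⟨h0, -, h1⟩ := hp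
  have hA : A.Nonempty := by
    by_contra h
    rw [Finset.not_nonempty_iff_eq_empty] at h
    simp [h] at h1
  have hc : 0 < (A.card : ℝ) := by exact_mod_cast hA.card_pos
  have key : ∀ i ∈ A, p i * (-Real.log (A.card : ℝ)) - ((A.card : ℝ)⁻¹ - p i) ≤
      p i * Real.log (p i) := by
    intro i _
    rcases (h0 i).eq_or_lt with h | h
    · rw [← h]
      simp
    · have h2 := Real.log_le_sub_one_of_pos (x := (A.card : ℝ)⁻¹ / p i) (by positivity)
      rw [Real.log_div (by positivity) h.ne', Real.log_inv] at h2
      have h3 := mul_le_mul_of_nonneg_left h2 h.le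
      rw [mul_sub, mul_sub, mul_div_cancel₀ _ h.ne'] at h3
      linarith
  have := Finset.sum_le_sum key
  rw [Finset.sum_sub_distrib, ← Finset.sum_mul, h1, Finset.sum_sub_distrib, h1, Finset.sum_const,
    nsmul_eq_mul, mul_inv_cancel₀ hc.ne'] at this
  simpa [entD] using this

lemma single_mem_gsimplex [DecidableEq ι] {A : Finset ι} {j : ι} (hj : j ∈ A) :
    (Pi.single j (1 : ℝ) : ι → ℝ) ∈ gsimplex A := by
  refine ⟨fun i => ?_, fun i hi => ?_, ?_⟩
  · by_cases h : i = j
    · subst h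
      simp
    · simp [h]
  · exact Pi.single_eq_of_ne (fun h => hi (by rwa [h])) _
  · simp [hj]

lemma entD_single [DecidableEq ι] (A : Finset ι) (j : ι) :
    entD A (Pi.single j (1 : ℝ) : ι → ℝ) = 0 := by
  refine Finset.sum_eq_zero fun i _ => ?_
  by_cases h : i = j
  · subst h
    simp
  · simp [h]

end Chain

section Discrete

variable {d : ℕ} {T : ℝ}

lemma integrable_finset_sum_dirac {Ω S : Type*} [MeasurableSpace Ω] [MeasurableSingletonClass Ω]
    (B : Finset S) (w : S → ℝ) (a : S → Ω) (F : Ω → ℝ) :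
    Integrable F (∑ s ∈ B, ENNReal.ofReal (w s) • Measure.dirac (a s)) :=
  integrable_finsetSum_measure.2 fun _ _ =>
    (integrable_dirac (by simp)).smul_measure ENNReal.ofReal_ne_top

lemma integral_finset_sum_dirac {Ω S : Type*} [MeasurableSpace Ω] [MeasurableSingletonClass Ω]
    {B : Finset S} {w : S → ℝ} (hw : ∀ s ∈ B, 0 ≤ w s) (a : S → Ω) (F : Ω → ℝ) :
    ∫ x, F x ∂(∑ s ∈ B, ENNReal.ofReal (w s) • Measure.dirac (a s)) = ∑ s ∈ B, w s * F (a s) := by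
  rw [integral_finsetSum_measure fun _ _ =>
    (integrable_dirac (by simp)).smul_measure ENNReal.ofReal_ne_top]
  refine Finset.sum_congr rfl fun s hs => ?_
  rw [integral_smul_measure, integral_dirac, ENNReal.toReal_ofReal (hw s hs), smul_eq_mul]

lemma ae_finset_sum_dirac {Ω S : Type*} [MeasurableSpace Ω] [MeasurableSingletonClass Ω]
    {B : Finset S} {w : S → ℝ} {a : S → Ω} {p : Ω → Prop}
    (h : ∀ s ∈ B, w s ≠ 0 → p (a s)) :
    ∀ᵐ x ∂(∑ s ∈ B, ENNReal.ofReal (w s) • Measure.dirac (a s)), p x := by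
  rw [ae_iff, Measure.finsetSum_apply]
  refine Finset.sum_eq_zero fun s hs => ?_
  by_cases hws : w s = 0
  · simp [hws]
  · have : a s ∉ {x | ¬ p x} := fun hx => hx (h s hs hws)
    simp [Measure.dirac_apply, this]

lemma isProbabilityMeasure_finset_sum_dirac {Ω S : Type*} [MeasurableSpace Ω]
    {B : Finset S} {w : S → ℝ} (hw : ∀ s ∈ B, 0 ≤ w s) (h1 : ∑ s ∈ B, w s = 1) (a : S → Ω) :
    IsProbabilityMeasure (∑ s ∈ B, ENNReal.ofReal (w s) • Measure.dirac (a s)) := by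
  constructor
  rw [Measure.finsetSum_apply]
  simp only [Measure.smul_apply, measure_univ, smul_eq_mul, mul_one]
  rw [← ENNReal.ofReal_sum_of_nonneg hw, h1, ENNReal.ofReal_one]

/-- The total cost of the polygonal path with vertices `y 0, …, y N`, at equally spaced times,
against the flow of time marginals of `ξ`. -/
def nodeCost (hT : 0 ≤ T) [MeasurableSpace (PathSpace T d)] (ℓ : (Fin d → ℝ) → ℝ)
    (f g : (Fin d → ℝ) → Measure (Fin d → ℝ) → ℝ) (ξ : Measure (PathSpace T d)) (N : ℕ)
    (y : ℕ → Fin d → ℝ) : ℝ :=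
  ∑ k ∈ Finset.range N, T / N * (ℓ ((T / N)⁻¹ • (y (k + 1) - y k)) +
      f (y k) (ξ.map fun γ => ev hT γ (k * (T / N)))) +
    g (y N) (ξ.map fun γ => ev hT γ T)

/-- `ξ` is concentrated on polygonal paths with `N` pieces starting in `G`, and is optimal up to
an error `e` among polygonal paths with vertices in `G`. -/
structure IsApproxEquilibrium (hT : 0 < T) [MeasurableSpace (PathSpace T d)] (q : ℝ)
    (ℓ : (Fin d → ℝ) → ℝ) (f g : (Fin d → ℝ) → Measure (Fin d → ℝ) → ℝ) (N : ℕ)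
    (G : Set (Fin d → ℝ)) (R e : ℝ) (ξ : Measure (PathSpace T d)) : Prop where
  prob : IsProbabilityMeasure ξ
  integrable : ∀ F : PathSpace T d → ℝ, Integrable F ξ
  ae_start : ∀ᵐ γ ∂ξ, ‖ev hT.le γ 0‖ ≤ R
  ae_deriv : ∀ᵐ γ ∂ξ, ∃ z, HasWDeriv T q hT.le γ z ∧
    ∀ φ : (Fin d → ℝ) → ℝ, ∫ t in Icc 0 T, φ (z t) = actionOn hT.le φ N γ
  le : ∀ (u : (Fin d → ℝ) → ℝ) (c : ℝ),
    (∀ x ∈ G, ‖x‖ ≤ R → ∃ y : ℕ → Fin d → ℝ, y 0 = x ∧ (∀ k ≤ N, y k ∈ G) ∧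
      nodeCost hT.le ℓ f g ξ N y ≤ u x + c) →
    ∫ γ, nodeCost hT.le ℓ f g ξ N (fun k => ev hT.le γ (k * (T / N))) ∂ξ ≤
      ∫ γ, u (ev hT.le γ 0) ∂ξ + c + e

lemma gpt_injective {Ns : ℕ → ℕ} {n : ℕ} (h : 0 < Ns n) : Function.Injective (gpt d Ns n) := by
  intro i j hij
  ext k
  have := congrFun hij k
  have hne : dxn Ns n ≠ 0 := by
    have : (0 : ℝ) < Ns n := by exact_mod_cast h
    simp [dxn, this.ne']
  simp only [gpt] at this
  exact_mod_cast mul_right_cancel₀ hne this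

lemma SolvesDiscreteMFG.le_nodeCost {Ns Nt : ℕ → ℕ} {eps : ℕ → ℝ}
    {ℓ : (Fin d → ℝ) → ℝ} {f g : (Fin d → ℝ) → Measure (Fin d → ℝ) → ℝ}
    {m0 : Measure (Fin d → ℝ)} {n : ℕ} {U M : ℕ → (Fin d → ℤ) → ℝ}
    {P : ℕ → (Fin d → ℤ) → (Fin d → ℤ) → ℝ}
    (hsol : SolvesDiscreteMFG d T Ns Nt eps ℓ f g m0 n U M P) {y : ℕ → Fin d → ℤ}
    (hy : ∀ k ≤ Nt n, y k ∈ gridIdx d Ns n) {k : ℕ} (hk : k ≤ Nt n) :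
    U 0 (y 0) ≤ ∑ k ∈ Finset.range k, dtn T Nt n *
      (ℓ ((dtn T Nt n)⁻¹ • (gpt d Ns n (y (k + 1)) - gpt d Ns n (y k))) +
        f (gpt d Ns n (y k)) (discMeas d Ns n (M k))) + U k (y k) := by
  classical
  induction k with
  | zero => simp
  | succ k ih =>
    obtain ⟨-, h1, -, h2⟩ := hsol.1 k (by omega) _ (hy k (by omega))
    have h3 := h1 _ (single_mem_gsimplex (hy (k + 1) hk))
    have h4 : stepObj d T Ns Nt n ℓ (eps n) (U (k + 1)) (y k) (Pi.single (y (k + 1)) 1) =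
        dtn T Nt n * ℓ ((dtn T Nt n)⁻¹ • (gpt d Ns n (y (k + 1)) - gpt d Ns n (y k))) +
          U (k + 1) (y (k + 1)) := by
      rw [stepObj, entD_single, mul_zero, add_zero, Finset.sum_eq_single (y (k + 1))]
      · simp
      · intro j _ hj
        simp [hj]
      · exact fun h => absurd (hy _ hk) h
    rw [Finset.sum_range_succ, mul_add]
    linarith [ih (by omega)]

lemma SolvesDiscreteMFG.isApproxEquilibrium (hT : 0 < T) (q : ℝ) [MeasurableSpace (PathSpace T d)]
    [BorelSpace (PathSpace T d)] {Ns Nt : ℕ → ℕ} {eps : ℕ → ℝ} (heps : ∀ n, 0 < eps n)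
    {ℓ : (Fin d → ℝ) → ℝ} {f g : (Fin d → ℝ) → Measure (Fin d → ℝ) → ℝ}
    {m0 : Measure (Fin d → ℝ)} {R : ℝ} (hR : m0 (Metric.closedBall 0 R)ᶜ = 0) {n : ℕ}
    (hNs : 0 < Ns n) (hNt : 0 < Nt n) {U M : ℕ → (Fin d → ℤ) → ℝ}
    {P : ℕ → (Fin d → ℤ) → (Fin d → ℤ) → ℝ}
    (hsol : SolvesDiscreteMFG d T Ns Nt eps ℓ f g m0 n U M P)
    {interp : (Fin (Nt n + 1) → Fin d → ℤ) → PathSpace T d}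
    (hinterp : ∀ s : Fin (Nt n + 1) → Fin d → ℤ, ∀ k : Fin (Nt n), ∀ t : ℝ,
      t ∈ Set.Icc (((k : ℕ) : ℝ) * dtn T Nt n) ((((k : ℕ) : ℝ) + 1) * dtn T Nt n) →
      ev hT.le (interp s) t = gpt d Ns n (s k.castSucc) +
        ((t - ((k : ℕ) : ℝ) * dtn T Nt n) / dtn T Nt n) •
          (gpt d Ns n (s k.succ) - gpt d Ns n (s k.castSucc))) :
    IsApproxEquilibrium hT q ℓ f g (Nt n) (gpt d Ns n '' gridIdx d Ns n) (R + 1)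
      (Nt n * (eps n * Real.log (gridIdx d Ns n).card)) (xiMeas d T Ns Nt m0 n P interp) ∧
    (xiMeas d T Ns Nt m0 n P interp).map (fun γ => ev hT.le γ 0) =
      discMeas d Ns n (Mzero d Ns n m0) := by
  set A := gridIdx d Ns n with hA
  set h := dtn T Nt n with hh
  have hNt' : (0 : ℝ) < Nt n := by exact_mod_cast hNt
  have hpos : 0 < h := div_pos hT hNt'
  obtain ⟨hs1, hs2, hs3, hs4, hs5⟩ := hsol
  have hsol' : SolvesDiscreteMFG d T Ns Nt eps ℓ f g m0 n U M P := ⟨hs1, hs2, hs3, hs4, hs5⟩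
  have hP : ∀ k < Nt n, ∀ i ∈ A, P k i ∈ gsimplex A := fun k hk i hi => (hs1 k hk i hi).1
  have hp : ∀ i ∈ A, 0 ≤ Mzero d Ns n m0 i := fun i _ => ENNReal.toReal_nonneg
  have hp1 : ∑ i ∈ A, Mzero d Ns n m0 i = 1 := by
    rw [← (hs5 0 (Nat.zero_le _)).2.2]
    exact Finset.sum_congr rfl fun i hi => (hs3 i hi).symm
  set w := chainWeight (Mzero d Ns n m0) P (Nt n) with hw
  set B := Fintype.piFinset (fun _ : Fin (Nt n + 1) => A) with hB
  have hξ : xiMeas d T Ns Nt m0 n P interp =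
    ∑ s ∈ B, ENNReal.ofReal (w s) • Measure.dirac (interp s) := rfl
  have hw0 : ∀ s ∈ B, 0 ≤ w s := fun s hs => chainWeight_nonneg hp hP hs
  have hU : ∀ k < Nt n, ∀ i ∈ A, ∑ j ∈ A, P k i j *
      (h * (ℓ (h⁻¹ • (gpt d Ns n j - gpt d Ns n i)) + f (gpt d Ns n i) (discMeas d Ns n (M k))) +
        U (k + 1) j) - eps n * Real.log A.card ≤ U k i := by
    intro k hk i hi
    obtain ⟨h1, -, -, h2⟩ := hs1 k hk i hi
    have h3 := mul_le_mul_of_nonneg_left (neg_log_card_le_entD h1) (heps n).le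
    have h4 : ∑ j ∈ A, P k i j * (h * (ℓ (h⁻¹ • (gpt d Ns n j - gpt d Ns n i)) +
        f (gpt d Ns n i) (discMeas d Ns n (M k))) + U (k + 1) j) =
        ∑ j ∈ A, P k i j * (h * ℓ (h⁻¹ • (gpt d Ns n j - gpt d Ns n i)) + U (k + 1) j) +
          h * f (gpt d Ns n i) (discMeas d Ns n (M k)) := by
      have : h * f (gpt d Ns n i) (discMeas d Ns n (M k)) =
          ∑ j ∈ A, P k i j * (h * f (gpt d Ns n i) (discMeas d Ns n (M k))) := by
        rw [← Finset.sum_mul, h1.2.2, one_mul]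
      rw [this, ← Finset.sum_add_distrib]
      exact Finset.sum_congr rfl fun j _ => by ring
    rw [h4, h2, stepObj]
    linarith
  obtain ⟨hw1, hcost⟩ := sum_chainWeight_cost_le (c := fun k i j =>
    h * (ℓ (h⁻¹ • (gpt d Ns n j - gpt d Ns n i)) + f (gpt d Ns n i) (discMeas d Ns n (M k))))
    (Nt n) hp hp1 hP hU
  rw [← hw, ← hB] at hw1 hcost
  have hnode : ∀ s (k : Fin (Nt n + 1)), ev hT.le (interp s) (k * h) = gpt d Ns n (s k) := by
    intro s k
    induction k using Fin.lastCases with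
    | cast k =>
      rw [Fin.val_castSucc, hinterp s k _ ⟨le_rfl, by nlinarith⟩]
      simp
    | last =>
      have : Fin.last (Nt n) = (⟨Nt n - 1, by omega⟩ : Fin (Nt n)).succ := by
        ext
        simp only [Fin.val_last, Fin.val_succ]
        omega
      have hc : ((Fin.last (Nt n) : Fin (Nt n + 1)) : ℕ) = (Nt n - 1) + 1 := by
        rw [Fin.val_last]
        omega
      rw [this, hinterp s ⟨Nt n - 1, by omega⟩]
      · simp only [Fin.val_succ]
        push_cast
        rw [add_mul, one_mul, add_sub_cancel_left, div_self hpos.ne', one_smul,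
          add_sub_cancel]
      · simp only [Fin.val_succ]
        push_cast
        exact ⟨by nlinarith, le_rfl⟩
  have hmarg : ∀ (k : Fin (Nt n + 1)) (V : (Fin d → ℤ) → ℝ),
      (∀ i ∈ A, V i = M k i) → (∀ i ∈ A, 0 ≤ V i) →
      (xiMeas d T Ns Nt m0 n P interp).map (fun γ => ev hT.le γ (k * h)) = discMeas d Ns n V := by
    intro k V hV hV0
    have hprob : IsProbabilityMeasure (xiMeas d T Ns Nt m0 n P interp) := by
      rw [hξ]
      exact isProbabilityMeasure_finset_sum_dirac hw0 hw1 _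
    have hmeas : Measurable fun γ : PathSpace T d => ev hT.le γ (k * h) :=
      (continuous_ev_left hT.le _).measurable
    have := hprob
    have h1 := Measure.isProbabilityMeasure_map (μ := xiMeas d T Ns Nt m0 n P interp)
      hmeas.aemeasurable
    have hVs : ∑ i ∈ A, V i = 1 := by
      rw [← (hs5 k (by omega)).2.2]
      exact Finset.sum_congr rfl hV
    have h2 : IsProbabilityMeasure (discMeas d Ns n V) :=
      isProbabilityMeasure_finset_sum_dirac hV0 hVs _
    refine ext_of_forall_integral_eq_of_IsFiniteMeasure fun F => ?_
    rw [integral_map hmeas.aemeasurable F.continuous.aestronglyMeasurable, hξ,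
      integral_finset_sum_dirac hw0, discMeas, integral_finset_sum_dirac hV0]
    simp only [hnode]
    have := sum_chainWeight_apply (p := Mzero d Ns n m0) (Nt n) hP hs3 hs2 k
      (fun i => F (gpt d Ns n i))
    rw [← hw, ← hB] at this
    rw [this]
    exact Finset.sum_congr rfl fun i hi => by rw [hV i hi]
  have hflow : ∀ k : Fin (Nt n + 1), (xiMeas d T Ns Nt m0 n P interp).map
      (fun γ => ev hT.le γ (k * h)) = discMeas d Ns n (M k) := fun k =>
    hmarg k (M k) (fun _ _ => rfl) (fun i _ => (hs5 k (by omega)).1 i)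
  have hTN : (Nt n : ℝ) * h = T := by
    rw [hh, dtn]
    field_simp
  have hflowT : (xiMeas d T Ns Nt m0 n P interp).map (fun γ => ev hT.le γ T) =
      discMeas d Ns n (M (Nt n)) := by
    have := hflow (Fin.last _)
    rwa [Fin.val_last, hTN] at this
  have hnc : ∀ s ∈ B, nodeCost hT.le ℓ f g (xiMeas d T Ns Nt m0 n P interp) (Nt n)
      (fun k => ev hT.le (interp s) (k * (T / Nt n))) =
      ∑ k : Fin (Nt n), h * (ℓ (h⁻¹ • (gpt d Ns n (s k.succ) - gpt d Ns n (s k.castSucc))) +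
        f (gpt d Ns n (s k.castSucc)) (discMeas d Ns n (M k))) +
      U (Nt n) (s (Fin.last (Nt n))) := by
    intro s hs
    rw [nodeCost, hs4 _ (Fintype.mem_piFinset.1 hs _), hflowT, ← Fin.sum_univ_eq_sum_range
      (fun k => T / (Nt n : ℝ) * (ℓ ((T / (Nt n : ℝ))⁻¹ •
        (ev hT.le (interp s) ((k + 1 : ℕ) * (T / (Nt n : ℝ))) -
          ev hT.le (interp s) (k * (T / (Nt n : ℝ))))) +
      f (ev hT.le (interp s) (k * (T / (Nt n : ℝ)))) ((xiMeas d T Ns Nt m0 n P interp).map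
        fun γ => ev hT.le γ (k * (T / (Nt n : ℝ)))))) (Nt n)]
    congr 1
    · refine Finset.sum_congr rfl fun k _ => ?_
      have e1 := hnode s k.castSucc
      have e2 := hnode s k.succ
      have e3 := hflow k.castSucc
      simp only [Fin.val_castSucc, Fin.val_succ] at e1 e2 e3
      rw [hh, dtn] at e1 e2 e3
      rw [e1, e2, e3]
      rfl
    · have := hnode s (Fin.last _)
      rw [Fin.val_last, hh, dtn] at this
      rw [this]
  have hstart : ∀ s ∈ B, w s ≠ 0 → ‖gpt d Ns n (s 0)‖ ≤ R + 1 := by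
    intro s _ hws
    have h0 : Mzero d Ns n m0 (s 0) ≠ 0 := fun h0 => hws (by rw [hw, chainWeight, h0, zero_mul])
    have : ¬ (Metric.closedBall (gpt d Ns n (s 0)) (dxn Ns n / 2) ⊆ (Metric.closedBall 0 R)ᶜ) :=
      fun hsub => h0 (by rw [Mzero, measure_mono_null hsub hR, ENNReal.toReal_zero])
    rw [Set.not_subset] at this
    obtain ⟨x, hx, hx'⟩ := this
    rw [Set.mem_compl_iff, not_not, mem_closedBall_zero_iff] at hx'
    rw [Metric.mem_closedBall, dist_eq_norm] at hx
    have hd1 : dxn Ns n ≤ 1 := by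
      rw [dxn, div_le_one (by exact_mod_cast hNs)]
      exact_mod_cast hNs
    have hd0 : 0 ≤ dxn Ns n := by
      rw [dxn]
      positivity
    have := norm_le_norm_add_norm_sub' (gpt d Ns n (s 0)) x
    rw [norm_sub_rev] at this
    linarith
  have hev0 : ∀ s, ev hT.le (interp s) 0 = gpt d Ns n (s 0) := by
    intro s
    have := hnode s 0
    rwa [Fin.val_zero, Nat.cast_zero, zero_mul] at this
  refine ⟨⟨?_, ?_, ?_, ?_, ?_⟩, ?_⟩
  · rw [hξ]
    exact isProbabilityMeasure_finset_sum_dirac hw0 hw1 _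
  · rw [hξ]
    exact integrable_finset_sum_dirac B w interp
  · rw [hξ]
    exact ae_finset_sum_dirac fun s hs hws => by rw [hev0]; exact hstart s hs hws
  · rw [hξ]
    refine ae_finset_sum_dirac fun s hs _ => exists_hasWDeriv_of_affine hT q hNt (interp s) ?_
    intro k hk t ht1 ht2
    have e1 := hnode s (⟨k, hk⟩ : Fin (Nt n)).castSucc
    have e2 := hnode s (⟨k, hk⟩ : Fin (Nt n)).succ
    simp only [Fin.val_castSucc, Fin.val_succ] at e1 e2
    push_cast at e2
    rw [hh, dtn] at e1 e2
    rw [e1, e2]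
    exact hinterp s ⟨k, hk⟩ t ⟨ht1, ht2⟩
  · intro u c huc
    have hle : ∀ s ∈ B, w s * U 0 (s 0) ≤ w s * (u (gpt d Ns n (s 0)) + c) := by
      intro s hs
      by_cases hws : w s = 0
      · simp [hws]
      refine mul_le_mul_of_nonneg_left ?_ (hw0 s hs)
      obtain ⟨y, hy0, hyG, hy⟩ := huc _ ⟨s 0, Fintype.mem_piFinset.1 hs _, rfl⟩ (hstart s hs hws)
      choose! y' hy' hyy using hyG
      have h1 := hsol'.le_nodeCost hy' le_rfl
      rw [hs4 _ (hy' _ le_rfl)] at h1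
      have h2 : y' 0 = s 0 := gpt_injective hNs (by rw [hyy 0 (Nat.zero_le _), hy0])
      rw [h2] at h1
      refine h1.trans (le_trans (le_of_eq ?_) hy)
      rw [nodeCost, hflowT, hyy _ le_rfl]
      congr 1
      refine Finset.sum_congr rfl fun k hk => ?_
      rw [Finset.mem_range] at hk
      have e3 := hflow ⟨k, by omega⟩
      rw [hyy k hk.le, hyy (k + 1) hk, ← e3]
      rfl
    have h1 : ∫ γ, nodeCost hT.le ℓ f g (xiMeas d T Ns Nt m0 n P interp) (Nt n)
        (fun k => ev hT.le γ (k * (T / Nt n))) ∂(xiMeas d T Ns Nt m0 n P interp) =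
        ∑ s ∈ B, w s * (∑ k : Fin (Nt n), h *
          (ℓ (h⁻¹ • (gpt d Ns n (s k.succ) - gpt d Ns n (s k.castSucc))) +
            f (gpt d Ns n (s k.castSucc)) (discMeas d Ns n (M k))) +
          U (Nt n) (s (Fin.last (Nt n)))) := by
      conv_lhs => rw [hξ]
      rw [integral_finset_sum_dirac hw0]
      refine Finset.sum_congr rfl fun s hs => ?_
      rw [← hnc s hs, hξ]
    have h2 : ∫ γ, u (ev hT.le γ 0) ∂(xiMeas d T Ns Nt m0 n P interp) =
        ∑ s ∈ B, w s * u (gpt d Ns n (s 0)) := by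
      rw [hξ, integral_finset_sum_dirac hw0]
      simp only [hev0]
    have h3 := Finset.sum_le_sum hle
    simp only [mul_add _ _ c] at h3
    rw [Finset.sum_add_distrib, ← Finset.sum_mul, hw1, one_mul] at h3
    rw [h1, h2]
    linarith
  · have := hmarg 0 (Mzero d Ns n m0) (fun i hi => (hs3 i hi).symm) hp
    rwa [Fin.val_zero, Nat.cast_zero, zero_mul] at this

end Discrete

section Cost

variable {d : ℕ} {T : ℝ}

/-- The standing assumptions on the costs of the mean field game: `ℓ` is convex, continuous and of
`q`-growth; `f` and `g` are bounded, Lipschitz in space and continuous, with a modulus of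
continuity in the measure variable. -/
structure IsAdmissibleCost (q lo hi Cl Cb Cw : ℝ) (w : ℝ → ℝ) (ℓ : (Fin d → ℝ) → ℝ)
    (f g : (Fin d → ℝ) → Measure (Fin d → ℝ) → ℝ) : Prop where
  one_lt : 1 < q
  lo_pos : 0 < lo
  hi_pos : 0 < hi
  Cl_pos : 0 < Cl
  Cb_pos : 0 < Cb
  Cw_pos : 0 < Cw
  continuous : Continuous ℓ
  convex : ConvexOn ℝ univ ℓ
  lower : ∀ v, lo * ‖v‖ ^ q - Cl ≤ ℓ v
  upper : ∀ v, ℓ v ≤ hi * ‖v‖ ^ q + Cl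
  bound : ∀ m, IsP1 m → ∀ x, |f x m| ≤ Cb ∧ |g x m| ≤ Cb
  lip : ∀ m, IsP1 m → ∀ x y, |f x m - f y m| ≤ Cb * ‖x - y‖ ∧ |g x m - g y m| ≤ Cb * ‖x - y‖
  cont : ∀ x m, IsP1 m → ∀ ε > (0 : ℝ), ∃ δ > (0 : ℝ), ∀ y m', IsP1 m' →
    ‖y - x‖ < δ → W1 m m' < δ → |f y m' - f x m| < ε ∧ |g y m' - g x m| < ε
  small : ∀ ε > (0 : ℝ), ∃ δ > (0 : ℝ), ∀ r, 0 ≤ r → r ≤ δ → w r ≤ ε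
  mod : ∀ x, ∀ m m', IsP1 m → IsP1 m' →
    |f x m - f x m'| ≤ Cw * (1 + ‖x‖ ^ q) * w (W1 m m') ∧
    |g x m - g x m'| ≤ Cw * (1 + ‖x‖ ^ q) * w (W1 m m')

lemma HasWDeriv.norm_rpow_le {q : ℝ} (hT : 0 < T) (hq : 1 < q) {γ : PathSpace T d}
    {z : ℝ → Fin d → ℝ} (hz : HasWDeriv T q hT.le γ z) :
    ‖γ‖ ^ q ≤ 2 ^ q * (‖ev hT.le γ 0‖ ^ q + T ^ (q - 1) * ∫ s in Icc 0 T, ‖z s‖ ^ q) := by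
  set B := 2 ^ q * (‖ev hT.le γ 0‖ ^ q + T ^ (q - 1) * ∫ s in Icc 0 T, ‖z s‖ ^ q) with hB
  have hE : 0 ≤ ∫ s in Icc 0 T, ‖z s‖ ^ q := integral_nonneg fun _ => by positivity
  have hB0 : 0 ≤ B := by positivity
  have hq0 : 0 < q := by linarith
  have : ‖γ‖ ≤ B ^ q⁻¹ := by
    refine (ContinuousMap.norm_le _ (by positivity)).2 fun t => ?_
    have h1 := hz.norm_ev_rpow_le hq t.2
    rw [ev, projIcc_of_mem hT.le t.2] at h1
    calc ‖γ t‖ = (‖γ t‖ ^ q) ^ q⁻¹ := by rw [Real.rpow_rpow_inv (norm_nonneg _) hq0.ne']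
      _ ≤ _ := Real.rpow_le_rpow (by positivity) h1 (by positivity)
  calc ‖γ‖ ^ q ≤ (B ^ q⁻¹) ^ q := Real.rpow_le_rpow (norm_nonneg _) this hq0.le
    _ = B := Real.rpow_inv_rpow hB0 hq0.ne'

variable [MeasurableSpace (PathSpace T d)]

lemma isP1_map_ev [BorelSpace (PathSpace T d)] (hT : 0 ≤ T) {ξ : Measure (PathSpace T d)}
    [IsProbabilityMeasure ξ] (hi : Integrable (fun γ => ‖γ‖) ξ) (t : ℝ) :
    IsP1 (ξ.map fun γ => ev hT γ t) := by
  have hm : Measurable fun γ : PathSpace T d => ev hT γ t := (continuous_ev_left hT t).measurable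
  refine ⟨Measure.isProbabilityMeasure_map hm.aemeasurable, ?_⟩
  rw [lintegral_map (by fun_prop) hm]
  have : Integrable (fun γ => ev hT γ t) ξ :=
    hi.mono hm.aestronglyMeasurable (ae_of_all _ fun γ => by
      rw [norm_norm]
      exact norm_ev_le hT γ t)
  exact this.2

/-- The part of the cost of a polygonal path that depends on the flow of time marginals. -/
def flowCost (hT : 0 ≤ T) (f g : (Fin d → ℝ) → Measure (Fin d → ℝ) → ℝ)
    (ξ : Measure (PathSpace T d)) (N : ℕ) (y : ℕ → Fin d → ℝ) : ℝ :=
  ∑ k ∈ Finset.range N, T / N * f (y k) (ξ.map fun γ => ev hT γ (k * (T / N))) +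
    g (y N) (ξ.map fun γ => ev hT γ T)

lemma nodeCost_eq (hT : 0 ≤ T) (ℓ : (Fin d → ℝ) → ℝ)
    (f g : (Fin d → ℝ) → Measure (Fin d → ℝ) → ℝ) (ξ : Measure (PathSpace T d)) (N : ℕ)
    (y : ℕ → Fin d → ℝ) :
    nodeCost hT ℓ f g ξ N y =
      ∑ k ∈ Finset.range N, T / N * ℓ ((T / N)⁻¹ • (y (k + 1) - y k)) +
        flowCost hT f g ξ N y := by
  simp only [nodeCost, flowCost, mul_add, Finset.sum_add_distrib]
  ring

lemma nodeCost_ev (hT : 0 ≤ T) (ℓ : (Fin d → ℝ) → ℝ)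
    (f g : (Fin d → ℝ) → Measure (Fin d → ℝ) → ℝ) (ξ : Measure (PathSpace T d)) (N : ℕ)
    (γ : PathSpace T d) :
    nodeCost hT ℓ f g ξ N (fun k => ev hT γ (k * (T / N))) =
      actionOn hT ℓ N γ + flowCost hT f g ξ N (fun k => ev hT γ (k * (T / N))) := by
  simp only [nodeCost_eq, actionOn, Nat.cast_add, Nat.cast_one]

variable {q lo hi Cl Cb Cw : ℝ} {w : ℝ → ℝ} {ℓ : (Fin d → ℝ) → ℝ}
  {f g : (Fin d → ℝ) → Measure (Fin d → ℝ) → ℝ}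

lemma IsAdmissibleCost.abs_flowCost_sub_le (hc : IsAdmissibleCost q lo hi Cl Cb Cw w ℓ f g)
    (hT : 0 ≤ T) {ξ : Measure (PathSpace T d)} (hξ : ∀ t, IsP1 (ξ.map fun γ => ev hT γ t)) {N : ℕ}
    (hN : 0 < N) {x y : ℕ → Fin d → ℝ} {r : ℝ} (hxy : ∀ k ≤ N, ‖x k - y k‖ ≤ r) :
    |flowCost hT f g ξ N x - flowCost hT f g ξ N y| ≤ (T * Cb + Cb) * r := by
  have hN' : (0 : ℝ) < N := by exact_mod_cast hN
  have hCb := hc.Cb_pos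
  rw [flowCost, flowCost, add_sub_add_comm, ← Finset.sum_sub_distrib]
  refine (abs_add_le _ _).trans ?_
  have h1 : |∑ k ∈ Finset.range N, (T / N * f (x k) (ξ.map fun γ => ev hT γ (k * (T / N))) -
      T / N * f (y k) (ξ.map fun γ => ev hT γ (k * (T / N))))| ≤ T * Cb * r := by
    refine (Finset.abs_sum_le_sum_abs _ _).trans ?_
    calc _ ≤ ∑ k ∈ Finset.range N, T / N * (Cb * r) := by
          refine Finset.sum_le_sum fun k hk => ?_
          rw [← mul_sub, abs_mul, abs_of_nonneg (by positivity)]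
          gcongr
          refine ((hc.lip _ (hξ _) _ _).1).trans ?_
          gcongr
          exact hxy k (Finset.mem_range.1 hk).le
      _ = _ := by
          rw [Finset.sum_const, Finset.card_range, nsmul_eq_mul]
          field_simp
  have h2 := ((hc.lip _ (hξ T) (x N) (y N)).2).trans
    (mul_le_mul_of_nonneg_left (hxy N le_rfl) hCb.le)
  linarith

lemma IsAdmissibleCost.abs_flowCost_le (hc : IsAdmissibleCost q lo hi Cl Cb Cw w ℓ f g)
    (hT : 0 ≤ T) {ξ : Measure (PathSpace T d)} (hξ : ∀ t, IsP1 (ξ.map fun γ => ev hT γ t)) {N : ℕ}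
    (hN : 0 < N) (y : ℕ → Fin d → ℝ) : |flowCost hT f g ξ N y| ≤ T * Cb + Cb := by
  have hN' : (0 : ℝ) < N := by exact_mod_cast hN
  refine (abs_add_le _ _).trans (add_le_add ?_ (hc.bound _ (hξ T) _).2)
  refine (Finset.abs_sum_le_sum_abs _ _).trans ?_
  calc _ ≤ ∑ k ∈ Finset.range N, T / N * Cb := by
        refine Finset.sum_le_sum fun k _ => ?_
        rw [abs_mul, abs_of_nonneg (by positivity)]
        gcongr
        exact (hc.bound _ (hξ _) _).1
    _ = _ := by
        rw [Finset.sum_const, Finset.card_range, nsmul_eq_mul]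
        field_simp

namespace IsApproxEquilibrium

variable {hT : 0 < T} {N : ℕ} {G : Set (Fin d → ℝ)} {R e : ℝ}
  {ξ : Measure (PathSpace T d)}

lemma isP1 [BorelSpace (PathSpace T d)] (h : IsApproxEquilibrium hT q ℓ f g N G R e ξ) (t : ℝ) :
    IsP1 (ξ.map fun γ => ev hT.le γ t) :=
  have := h.prob
  isP1_map_ev hT.le (h.integrable _) t

lemma integral_energy_le [BorelSpace (PathSpace T d)]
    (h : IsApproxEquilibrium hT q ℓ f g N G R e ξ)
    (hc : IsAdmissibleCost q lo hi Cl Cb Cw w ℓ f g) (hN : 0 < N) :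
    ∫ γ, actionOn hT.le (fun v => ‖v‖ ^ q) N γ ∂ξ ≤
      (T * ℓ 0 + 2 * (T * Cb + Cb) + e + T * Cl) / lo := by
  have hN' : (0 : ℝ) < N := by exact_mod_cast hN
  have := h.prob
  have h1 := h.le (fun _ => 0) (T * ℓ 0 + (T * Cb + Cb)) fun x hx _ => ⟨fun _ => x, rfl,
    fun _ _ => hx, by
      rw [nodeCost_eq]
      have := (abs_le.1 (hc.abs_flowCost_le hT.le h.isP1 hN fun _ => x)).2
      simp only [sub_self, smul_zero, Finset.sum_const, Finset.card_range, nsmul_eq_mul]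
      have e1 : (N : ℝ) * (T / N * ℓ 0) = T * ℓ 0 := by field_simp
      linarith⟩
  have h2 : ∫ γ, lo * actionOn hT.le (fun v => ‖v‖ ^ q) N γ - (T * Cl + (T * Cb + Cb)) ∂ξ ≤
      ∫ γ, nodeCost hT.le ℓ f g ξ N (fun k => ev hT.le γ (k * (T / N))) ∂ξ := by
    refine integral_mono (h.integrable _) (h.integrable _) fun γ => ?_
    rw [nodeCost_ev]
    have h3 := (abs_le.1 (hc.abs_flowCost_le hT.le h.isP1 hN
      fun k => ev hT.le γ (k * (T / N)))).1
    have h4 := actionOn_rpow_le hT.le hc.lo_pos hc.lower hN γ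
    rw [le_div_iff₀ hc.lo_pos] at h4
    linarith
  rw [integral_sub (h.integrable _) (h.integrable _), integral_const_mul, integral_const] at h2
  simp only [probReal_univ, one_smul, integral_const, smul_zero, zero_add] at h1 h2
  rw [le_div_iff₀ hc.lo_pos]
  linarith

lemma integral_norm_rpow_le (h : IsApproxEquilibrium hT q ℓ f g N G R e ξ) (hq : 1 < q) {C : ℝ}
    (hC : ∫ γ, actionOn hT.le (fun v => ‖v‖ ^ q) N γ ∂ξ ≤ C) :
    ∫ γ, ‖γ‖ ^ q ∂ξ ≤ 2 ^ q * (R ^ q + T ^ (q - 1) * C) := by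
  have := h.prob
  calc _ ≤ ∫ γ, 2 ^ q * (R ^ q + T ^ (q - 1) * actionOn hT.le (fun v => ‖v‖ ^ q) N γ) ∂ξ := by
        refine integral_mono_ae (h.integrable _) (h.integrable _) ?_
        filter_upwards [h.ae_start, h.ae_deriv] with γ h1 h2
        obtain ⟨z, hz, hz'⟩ := h2
        rw [← hz' fun v => ‖v‖ ^ q]
        refine (hz.norm_rpow_le hT hq).trans ?_
        gcongr
    _ = 2 ^ q * (R ^ q + T ^ (q - 1) * ∫ γ, actionOn hT.le (fun v => ‖v‖ ^ q) N γ ∂ξ) := by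
        rw [integral_const_mul, integral_add (h.integrable _) (h.integrable _), integral_const,
          integral_const_mul]
        simp
    _ ≤ _ := by gcongr

lemma integral_norm_ev_sub_le (h : IsApproxEquilibrium hT q ℓ f g N G R e ξ) (hq : 1 < q) {C : ℝ}
    (hC : ∫ γ, actionOn hT.le (fun v => ‖v‖ ^ q) N γ ∂ξ ≤ C) {s t K : ℝ} (hs : s ∈ Icc 0 T)
    (ht : t ∈ Icc 0 T) (hK : 0 < K) :
    ∫ γ, ‖ev hT.le γ t - ev hT.le γ s‖ ∂ξ ≤ K * |t - s| + K ^ (1 - q) * C := by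
  have := h.prob
  calc _ ≤ ∫ γ, K * |t - s| + K ^ (1 - q) * actionOn hT.le (fun v => ‖v‖ ^ q) N γ ∂ξ := by
        refine integral_mono_ae (h.integrable _) (h.integrable _) ?_
        filter_upwards [h.ae_deriv] with γ h2
        obtain ⟨z, hz, hz'⟩ := h2
        rw [← hz' fun v => ‖v‖ ^ q]
        exact hz.norm_sub_le hq hs ht hK
    _ = K * |t - s| + K ^ (1 - q) * ∫ γ, actionOn hT.le (fun v => ‖v‖ ^ q) N γ ∂ξ := by
        rw [integral_add (h.integrable _) (h.integrable _), integral_const, integral_const_mul]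
        simp
    _ ≤ _ := by gcongr

end IsApproxEquilibrium

end Cost

section Limit

variable {d : ℕ} {T : ℝ}

lemma abs_sum_sub_integral_le (hT : 0 < T) {F : ℝ → ℝ} (hF : ContinuousOn F (Icc 0 T)) {N : ℕ}
    (hN : 0 < N) {c : ℕ → ℝ} {κ : ℝ}
    (h : ∀ k < N, ∀ t, (k : ℝ) * (T / N) ≤ t → t ≤ ((k : ℝ) + 1) * (T / N) → |c k - F t| ≤ κ) :
    |∑ k ∈ Finset.range N, T / N * c k - ∫ t in Icc 0 T, F t| ≤ T * κ := by
  have hN' : (0 : ℝ) < N := by exact_mod_cast hN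
  have hh : 0 < T / N := by positivity
  have hsub : ∀ k < N, Icc ((k : ℝ) * (T / N)) (((k + 1 : ℕ) : ℝ) * (T / N)) ⊆ Icc 0 T :=
    fun k hk => Icc_subset_Icc (by positivity) (node_le hT hk hN)
  have hle : ∀ k : ℕ, (k : ℝ) * (T / N) ≤ ((k + 1 : ℕ) : ℝ) * (T / N) := fun k => by
    push_cast
    nlinarith
  have hi : ∀ k < N, IntervalIntegrable F volume ((k : ℝ) * (T / N))
      (((k + 1 : ℕ) : ℝ) * (T / N)) := fun k hk =>
    ContinuousOn.intervalIntegrable (by rw [uIcc_of_le (hle k)]; exact hF.mono (hsub k hk))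
  have key := intervalIntegral.sum_integral_adjacent_intervals (μ := volume) (f := F)
    (a := fun k : ℕ => (k : ℝ) * (T / N)) (n := N) hi
  simp only [Nat.cast_zero, zero_mul, mul_div_cancel₀ T hN'.ne'] at key
  rw [integral_Icc_eq_interval hT.le, ← key, ← Finset.sum_sub_distrib]
  refine (Finset.abs_sum_le_sum_abs _ _).trans ?_
  calc _ ≤ ∑ k ∈ Finset.range N, κ * (T / N) := by
        refine Finset.sum_le_sum fun k hk => ?_
        have hk := Finset.mem_range.1 hk
        have e : T / N * c k = ∫ _ in ((k : ℝ) * (T / N))..(((k + 1 : ℕ) : ℝ) * (T / N)), c k := by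
          rw [intervalIntegral.integral_const, smul_eq_mul]
          push_cast
          ring
        rw [e, ← intervalIntegral.integral_sub intervalIntegrable_const (hi k hk)]
        have := intervalIntegral.norm_integral_le_of_norm_le_const
          (a := (k : ℝ) * (T / N)) (b := ((k + 1 : ℕ) : ℝ) * (T / N)) (C := κ)
          (f := fun t => c k - F t) fun t ht => by
            rw [uIoc_of_le (hle k)] at ht
            refine h k hk t ht.1.le ?_
            have := ht.2
            push_cast at this
            exact this
        rw [Real.norm_eq_abs] at this
        refine this.trans (le_of_eq ?_)
        rw [abs_of_nonneg (by linarith [hle k])]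
        push_cast
        ring
    _ = _ := by
        rw [Finset.sum_const, Finset.card_range, nsmul_eq_mul]
        field_simp

variable [MeasurableSpace (PathSpace T d)]

/-- The measure-dependent part of the cost of a path, against the flow of marginals of `ξ`. -/
def limitCost (hT : 0 ≤ T) (f g : (Fin d → ℝ) → Measure (Fin d → ℝ) → ℝ)
    (ξ : Measure (PathSpace T d)) (γ : PathSpace T d) : ℝ :=
  (∫ t in Icc 0 T, f (ev hT γ t) (ξ.map fun γ' => ev hT γ' t)) +
    g (ev hT γ T) (ξ.map fun γ' => ev hT γ' T)

/-- `ξs` is the narrow limit of approximate equilibria `ξ n` with vanishing mesh and error and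
bounded energy. -/
structure IsLimitOfApprox (hT : 0 < T) (q : ℝ)
    (ℓ : (Fin d → ℝ) → ℝ) (f g : (Fin d → ℝ) → Measure (Fin d → ℝ) → ℝ) (N : ℕ → ℕ)
    (G : ℕ → Set (Fin d → ℝ)) (R C : ℝ) (e : ℕ → ℝ) (ξ : ℕ → Measure (PathSpace T d))
    (ξs : Measure (PathSpace T d)) : Prop where
  approx : ∀ n, IsApproxEquilibrium hT q ℓ f g (N n) (G n) R (e n) (ξ n)
  pos : ∀ n, 0 < N n
  tendsto_N : Tendsto N atTop atTop
  tendsto_e : Tendsto e atTop (𝓝 0)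
  energy_le : ∀ n, ∫ γ, actionOn hT.le (fun v => ‖v‖ ^ q) (N n) γ ∂(ξ n) ≤ C
  prob : IsProbabilityMeasure ξs
  narrow : ∀ F : BoundedContinuousFunction (PathSpace T d) ℝ,
    Tendsto (fun n => ∫ γ, F γ ∂(ξ n)) atTop (𝓝 (∫ γ, F γ ∂ξs))

namespace IsLimitOfApprox

variable [BorelSpace (PathSpace T d)] {q lo hi Cl Cb Cw : ℝ} {w : ℝ → ℝ} {ℓ : (Fin d → ℝ) → ℝ}
  {f g : (Fin d → ℝ) → Measure (Fin d → ℝ) → ℝ} {hT : 0 < T} {N : ℕ → ℕ}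
  {G : ℕ → Set (Fin d → ℝ)} {R C : ℝ} {e : ℕ → ℝ} {ξ : ℕ → Measure (PathSpace T d)}
  {ξs : Measure (PathSpace T d)}

lemma moment (h : IsLimitOfApprox hT q ℓ f g N G R C e ξ ξs) (hq : 1 < q) :
    Integrable (fun γ => ‖γ‖ ^ q) ξs ∧ ∫ γ, ‖γ‖ ^ q ∂ξs ≤ 2 ^ q * (R ^ q + T ^ (q - 1) * C) := by
  have := h.prob
  have := fun n => (h.approx n).prob
  exact integrable_and_integral_le_of_narrow h.narrow
    (continuous_norm.rpow_const fun _ => Or.inr (by linarith)) (fun _ => by positivity)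
    tendsto_const_nhds (fun n => (h.approx n).integrable _)
    (Eventually.of_forall fun n => (h.approx n).integral_norm_rpow_le hq (h.energy_le n))

lemma integrable_norm (h : IsLimitOfApprox hT q ℓ f g N G R C e ξ ξs) (hq : 1 < q) :
    Integrable (fun γ => ‖γ‖) ξs := by
  have := h.prob
  refine ((integrable_const 1).add (h.moment hq).1).mono'
    continuous_norm.aestronglyMeasurable (ae_of_all _ fun γ => ?_)
  have := young_rpow hq one_pos (norm_nonneg γ)
  rw [norm_norm]
  simpa using this

lemma isP1 (h : IsLimitOfApprox hT q ℓ f g N G R C e ξ ξs) (hq : 1 < q) (t : ℝ) :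
    IsP1 (ξs.map fun γ => ev hT.le γ t) :=
  have := h.prob
  isP1_map_ev hT.le (h.integrable_norm hq) t

lemma modulus (h : IsLimitOfApprox hT q ℓ f g N G R C e ξ ξs) (hq : 1 < q) {s t K : ℝ}
    (hs : s ∈ Icc 0 T) (ht : t ∈ Icc 0 T) (hK : 0 < K) :
    Integrable (fun γ => ‖ev hT.le γ t - ev hT.le γ s‖) ξs ∧
    ∫ γ, ‖ev hT.le γ t - ev hT.le γ s‖ ∂ξs ≤ K * |t - s| + K ^ (1 - q) * C := by
  have := h.prob
  have := fun n => (h.approx n).prob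
  exact integrable_and_integral_le_of_narrow h.narrow
    ((continuous_ev_left hT.le t).sub (continuous_ev_left hT.le s)).norm
    (fun _ => norm_nonneg _) tendsto_const_nhds (fun n => (h.approx n).integrable _)
    (Eventually.of_forall fun n => (h.approx n).integral_norm_ev_sub_le hq (h.energy_le n) hs ht hK)

lemma exists_modulus (h : IsLimitOfApprox hT q ℓ f g N G R C e ξ ξs) (hq : 1 < q) {η : ℝ}
    (hη : 0 < η) : ∃ δ > 0, ∀ s ∈ Icc 0 T, ∀ t ∈ Icc 0 T, |t - s| ≤ δ →
      ∫ γ, ‖ev hT.le γ t - ev hT.le γ s‖ ∂ξs ≤ η := by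
  obtain ⟨K, hK, hKη⟩ : ∃ K : ℝ, 0 < K ∧ K ^ (1 - q) * C < η / 2 := by
    have h2 : Tendsto (fun K : ℝ => K ^ (1 - q) * C) atTop (𝓝 0) := by
      simpa using (tendsto_rpow_one_sub hq).mul_const C
    exact ((eventually_gt_atTop 0).and (h2.eventually (gt_mem_nhds (half_pos hη)))).exists
  refine ⟨η / (2 * K), by positivity, fun s hs t ht hst => (h.modulus hq hs ht hK).2.trans ?_⟩
  have : K * |t - s| ≤ K * (η / (2 * K)) := by gcongr
  have e1 : K * (η / (2 * K)) = η / 2 := by field_simp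
  linarith

lemma exists_W1_limit_lt (h : IsLimitOfApprox hT q ℓ f g N G R C e ξ ξs) (hq : 1 < q) {η : ℝ}
    (hη : 0 < η) : ∃ δ > 0, ∀ s ∈ Icc 0 T, ∀ t ∈ Icc 0 T, |t - s| < δ →
      W1 (ξs.map fun γ => ev hT.le γ t) (ξs.map fun γ => ev hT.le γ s) < η := by
  obtain ⟨δ, hδ, H⟩ := h.exists_modulus hq (half_pos hη)
  refine ⟨δ, hδ, fun s hs t ht hst => ?_⟩
  refine (W1_map_le ξs (continuous_ev_left hT.le t).measurable
    (continuous_ev_left hT.le s).measurable).trans_lt ?_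
  simp only [dist_eq_norm]
  linarith [H s hs t ht hst.le]

lemma eventually_W1_le (h : IsLimitOfApprox hT q ℓ f g N G R C e ξ ξs) (hq : 1 < q) {η : ℝ}
    (hη : 0 < η) : ∃ δ > 0, ∀ᶠ n in atTop, ∀ s ∈ Icc 0 T, ∀ t ∈ Icc 0 T, |t - s| ≤ δ →
      W1 ((ξ n).map fun γ => ev hT.le γ t) (ξs.map fun γ => ev hT.le γ s) ≤ η := by
  have := h.prob
  have := fun n => (h.approx n).prob
  obtain ⟨δ, hδ, H⟩ := h.exists_modulus hq (half_pos hη)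
  refine ⟨δ, hδ, ?_⟩
  filter_upwards [eventually_exists_coupling_dist h.narrow hq (fun n => (h.approx n).integrable _)
    (fun n => (h.approx n).integral_norm_rpow_le hq (h.energy_le n)) (h.moment hq).1
    (h.moment hq).2 (half_pos hη)] with n hn s hs t ht hst
  obtain ⟨π, hπ1, hπ2, hπi, hπ⟩ := hn
  have mt := (continuous_ev_left (d := d) hT.le t).measurable
  have ms := (continuous_ev_left (d := d) hT.le s).measurable
  have hms : AEStronglyMeasurable (fun γ : PathSpace T d => ‖ev hT.le γ t - ev hT.le γ s‖)
      (π.map Prod.snd) := (mt.sub ms).norm.aestronglyMeasurable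
  have e1 : (ξ n).map (fun γ => ev hT.le γ t) = π.map fun p => ev hT.le p.1 t := by
    rw [← hπ1, Measure.map_map mt measurable_fst]
    rfl
  have e2 : ξs.map (fun γ => ev hT.le γ s) = π.map fun p => ev hT.le p.2 s := by
    rw [← hπ2, Measure.map_map ms measurable_snd]
    rfl
  have hi2 : Integrable (fun p : PathSpace T d × PathSpace T d =>
      ‖ev hT.le p.2 t - ev hT.le p.2 s‖) π := by
    have := (h.modulus hq hs ht one_pos).1
    rw [← hπ2, integrable_map_measure hms measurable_snd.aemeasurable] at this
    exact this
  have h2 : ∫ p, ‖ev hT.le p.2 t - ev hT.le p.2 s‖ ∂π ≤ η / 2 := by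
    have := H s hs t ht hst
    rw [← hπ2, integral_map measurable_snd.aemeasurable hms] at this
    exact this
  rw [e1, e2]
  refine (W1_map_le π (mt.comp measurable_fst) (ms.comp measurable_snd)).trans ?_
  calc _ ≤ ∫ p, (dist p.1 p.2 + ‖ev hT.le p.2 t - ev hT.le p.2 s‖) ∂π := by
        refine integral_mono_of_nonneg (ae_of_all _ fun _ => dist_nonneg) (hπi.add hi2)
          (ae_of_all _ fun p => ?_)
        refine (dist_triangle _ (ev hT.le p.2 t) _).trans (add_le_add ?_ (dist_eq_norm _ _).le)
        rw [dist_eq_norm]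
        exact norm_ev_sub_le hT.le p.1 p.2 t
    _ ≤ η := by
        rw [integral_add hπi hi2]
        linarith

lemma continuousOn_cost (h : IsLimitOfApprox hT q ℓ f g N G R C e ξ ξs)
    (hc : IsAdmissibleCost q lo hi Cl Cb Cw w ℓ f g) (γ : PathSpace T d) :
    ContinuousOn (fun t => f (ev hT.le γ t) (ξs.map fun γ' => ev hT.le γ' t)) (Icc 0 T) := by
  rw [Metric.continuousOn_iff]
  intro s hs ε hε
  obtain ⟨δ, hδ, H⟩ := hc.cont (ev hT.le γ s) _ (h.isP1 hc.one_lt s) ε hε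
  obtain ⟨δ₁, hδ₁, H₁⟩ := h.exists_W1_limit_lt hc.one_lt hδ
  obtain ⟨δ₂, hδ₂, H₂⟩ := Metric.continuous_iff.1 (continuous_ev hT.le γ) s δ hδ
  refine ⟨min δ₁ δ₂, lt_min hδ₁ hδ₂, fun t ht hts => ?_⟩
  rw [Real.dist_eq]
  refine (H _ _ (h.isP1 hc.one_lt t) ?_ ?_).1
  · rw [← dist_eq_norm]
    exact H₂ t (hts.trans_le (min_le_right _ _))
  · refine H₁ t ht s hs ?_
    rw [← Real.dist_eq, dist_comm]
    exact hts.trans_le (min_le_left _ _)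

lemma abs_limitCost_sub_le (h : IsLimitOfApprox hT q ℓ f g N G R C e ξ ξs)
    (hc : IsAdmissibleCost q lo hi Cl Cb Cw w ℓ f g) {γ γ' : PathSpace T d} {r : ℝ}
    (hr : ∀ t, ‖ev hT.le γ t - ev hT.le γ' t‖ ≤ r) :
    |limitCost hT.le f g ξs γ - limitCost hT.le f g ξs γ'| ≤ (T * Cb + Cb) * r := by
  have hCb := hc.Cb_pos
  have hi : ∀ γ : PathSpace T d, IntegrableOn
      (fun t => f (ev hT.le γ t) (ξs.map fun γ' => ev hT.le γ' t)) (Icc 0 T) := fun γ =>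
    (h.continuousOn_cost hc γ).integrableOn_Icc
  have hP := h.isP1 hc.one_lt
  rw [limitCost, limitCost, add_sub_add_comm, ← integral_sub (hi γ) (hi γ')]
  refine (abs_add_le _ _).trans ?_
  have h1 := ((hc.lip _ (hP T) (ev hT.le γ T) (ev hT.le γ' T)).2).trans
    (mul_le_mul_of_nonneg_left (hr T) hCb.le)
  have h2 := norm_setIntegral_le_of_norm_le_const (μ := volume) (s := Icc 0 T) (C := Cb * r)
    (f := fun t => f (ev hT.le γ t) (ξs.map fun γ' => ev hT.le γ' t) -
      f (ev hT.le γ' t) (ξs.map fun γ' => ev hT.le γ' t)) (by simp) fun t _ =>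
      ((hc.lip _ (hP t) _ _).1).trans (mul_le_mul_of_nonneg_left (hr t) hCb.le)
  rw [Real.norm_eq_abs, Measure.real, Real.volume_Icc, sub_zero, ENNReal.toReal_ofReal hT.le] at h2
  linarith

lemma abs_limitCost_le (h : IsLimitOfApprox hT q ℓ f g N G R C e ξ ξs)
    (hc : IsAdmissibleCost q lo hi Cl Cb Cw w ℓ f g) (γ : PathSpace T d) :
    |limitCost hT.le f g ξs γ| ≤ T * Cb + Cb := by
  have hP := h.isP1 hc.one_lt
  refine (abs_add_le _ _).trans (add_le_add ?_ (hc.bound _ (hP T) _).2)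
  have h2 := norm_setIntegral_le_of_norm_le_const (μ := volume) (s := Icc 0 T) (C := Cb)
    (f := fun t => f (ev hT.le γ t) (ξs.map fun γ' => ev hT.le γ' t)) (by simp) fun t _ =>
      (hc.bound _ (hP t) _).1
  rw [Real.norm_eq_abs, Measure.real, Real.volume_Icc, sub_zero, ENNReal.toReal_ofReal hT.le] at h2
  linarith

lemma eventually_flowCost_close (h : IsLimitOfApprox hT q ℓ f g N G R C e ξ ξs)
    (hc : IsAdmissibleCost q lo hi Cl Cb Cw w ℓ f g) {η : ℝ} (hη : 0 < η) :
    ∀ᶠ n in atTop, ∀ (γ : PathSpace T d) z, HasWDeriv T q hT.le γ z →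
      |flowCost hT.le f g (ξ n) (N n) (fun k => ev hT.le γ (k * (T / N n))) -
        limitCost hT.le f g ξs γ| ≤
      η * (1 + ‖ev hT.le γ 0‖ ^ q + ∫ t in Icc 0 T, ‖z t‖ ^ q) := by
  have hq := hc.one_lt
  have hCb := hc.Cb_pos
  have hCw := hc.Cw_pos
  set A : ℝ := 1 + 2 ^ q + 2 ^ q * T ^ (q - 1) with hA
  have hA0 : 0 < A := by positivity
  set η' := η / (T + 1) with hη'
  have hη'0 : 0 < η' := by positivity
  obtain ⟨K, hK, hKη⟩ : ∃ K : ℝ, 0 < K ∧ Cb * K ^ (1 - q) < η' / 3 := by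
    have h2 : Tendsto (fun K : ℝ => Cb * K ^ (1 - q)) atTop (𝓝 0) := by
      simpa using (tendsto_rpow_one_sub hq).const_mul Cb
    exact ((eventually_gt_atTop 0).and
      (h2.eventually (gt_mem_nhds (show 0 < η' / 3 by positivity)))).exists
  obtain ⟨ρ, hρ, hw⟩ := hc.small (η' / (3 * Cw * A)) (by positivity)
  obtain ⟨δ, hδ, HW⟩ := h.eventually_W1_le hq hρ
  have hmesh := tendsto_mesh T h.tendsto_N
  filter_upwards [HW, hmesh.eventually (gt_mem_nhds hδ),
    hmesh.eventually (gt_mem_nhds (show 0 < η' / (3 * Cb * K) by positivity))]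
    with n hn1 hn2 hn3 γ z hz
  set E := ∫ t in Icc 0 T, ‖z t‖ ^ q with hE
  have hE0 : 0 ≤ E := integral_nonneg fun _ => by positivity
  set X := 1 + ‖ev hT.le γ 0‖ ^ q + E with hX
  have hx0 : 0 ≤ ‖ev hT.le γ 0‖ ^ q := by positivity
  have hX1 : 1 ≤ X := by linarith
  have hNn := h.pos n
  have hN' : (0 : ℝ) < N n := by exact_mod_cast hNn
  have hmod : ∀ s ∈ Icc 0 T, ∀ t ∈ Icc 0 T, |t - s| ≤ T / N n →
      Cw * (1 + ‖ev hT.le γ t‖ ^ q) * w (W1 ((ξ n).map fun γ => ev hT.le γ t)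
        (ξs.map fun γ => ev hT.le γ s)) ≤ η' / 3 * X := by
    intro s hs t ht hst
    have h1 : 1 + ‖ev hT.le γ t‖ ^ q ≤ A * X := by
      have h2 := hz.norm_ev_rpow_le hq ht
      have e1 : 2 ^ q * ‖ev hT.le γ 0‖ ^ q ≤ 2 ^ q * X := by gcongr; linarith
      have e2 : 2 ^ q * T ^ (q - 1) * E ≤ 2 ^ q * T ^ (q - 1) * X := by gcongr; linarith
      rw [hA, add_mul, add_mul, one_mul]
      linarith
    have h2 : w (W1 ((ξ n).map fun γ => ev hT.le γ t) (ξs.map fun γ => ev hT.le γ s)) ≤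
        η' / (3 * Cw * A) := hw _ (W1_nonneg _ _) (hn1 s hs t ht (hst.trans hn2.le))
    calc _ ≤ Cw * (1 + ‖ev hT.le γ t‖ ^ q) * (η' / (3 * Cw * A)) := by gcongr
      _ ≤ Cw * (A * X) * (η' / (3 * Cw * A)) := by gcongr
      _ = η' / 3 * X := by field_simp
  have hterm : |g (ev hT.le γ (N n * (T / N n))) ((ξ n).map fun γ => ev hT.le γ T) -
      g (ev hT.le γ T) (ξs.map fun γ => ev hT.le γ T)| ≤ η' * X := by
    have hTT : T ∈ Icc 0 T := ⟨hT.le, le_rfl⟩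
    rw [mul_div_cancel₀ T hN'.ne']
    refine ((hc.mod _ _ _ ((h.approx n).isP1 T) (h.isP1 hq T)).2).trans
      ((hmod T hTT T hTT (by simp; positivity)).trans ?_)
    nlinarith
  have hrun := abs_sum_sub_integral_le hT (h.continuousOn_cost hc γ) hNn
    (c := fun k => f (ev hT.le γ (k * (T / N n))) ((ξ n).map fun γ => ev hT.le γ (k * (T / N n))))
    (κ := η' * X) fun k hk t ht1 ht2 => by
      have hkm := node_mem hT hk.le hNn
      have htm : t ∈ Icc 0 T := ⟨hkm.1.trans ht1, ht2.trans (by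
        have := node_le hT (show k + 1 ≤ N n from hk) hNn
        push_cast at this
        exact this)⟩
      have hst : |(k : ℝ) * (T / N n) - t| ≤ T / N n := by
        rw [abs_le]
        constructor <;> linarith
      refine (abs_sub_le _
        (f (ev hT.le γ (k * (T / N n))) (ξs.map fun γ => ev hT.le γ t)) _).trans ?_
      have h1 := ((hc.mod _ _ _ ((h.approx n).isP1 (k * (T / N n))) (h.isP1 hq t)).1).trans
        (hmod t htm _ hkm hst)
      have h2 := (hc.lip _ (h.isP1 hq t) (ev hT.le γ (k * (T / N n))) (ev hT.le γ t)).1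
      have h3 := hz.norm_sub_le hq htm hkm hK
      have h4 : Cb * (K * |(k : ℝ) * (T / N n) - t|) ≤ η' / 3 := by
        calc _ ≤ Cb * (K * (η' / (3 * Cb * K))) := by gcongr; exact hst.trans hn3.le
          _ = η' / 3 := by field_simp
      have h5 := mul_le_mul_of_nonneg_left h3 hCb.le
      have h6 : Cb * K ^ (1 - q) * E ≤ η' / 3 * E := by gcongr
      nlinarith
  rw [flowCost, limitCost, add_sub_add_comm]
  refine (abs_add_le _ _).trans ((add_le_add hrun hterm).trans (le_of_eq ?_))
  rw [hη']
  field_simp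

end IsLimitOfApprox

end Limit

section Value

variable {d : ℕ} {T : ℝ}

lemma hasWDeriv_const (hT : 0 ≤ T) (q : ℝ) (x : Fin d → ℝ) :
    HasWDeriv T q hT (ContinuousMap.const _ x) (fun _ => 0) :=
  ⟨integrableOn_zero, integrableOn_const (by simp), fun t _ => by simp [ev]⟩

lemma ev_add_const (hT : 0 ≤ T) (γ : PathSpace T d) (c : Fin d → ℝ) (t : ℝ) :
    ev hT (γ + ContinuousMap.const _ c) t = ev hT γ t + c := rfl

lemma HasWDeriv.add_const {q : ℝ} {hT : 0 ≤ T} {γ : PathSpace T d} {z : ℝ → Fin d → ℝ}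
    (hz : HasWDeriv T q hT γ z) (c : Fin d → ℝ) :
    HasWDeriv T q hT (γ + ContinuousMap.const _ c) z :=
  ⟨hz.1, hz.2.1, fun t ht => by
    rw [ev_add_const, ev_add_const, hz.2.2 t ht]
    abel⟩

variable {q lo hi Cl Cb Cw : ℝ} {w : ℝ → ℝ} {ℓ : (Fin d → ℝ) → ℝ}
  {f g : (Fin d → ℝ) → Measure (Fin d → ℝ) → ℝ}

namespace IsAdmissibleCost

lemma neg_le (hc : IsAdmissibleCost q lo hi Cl Cb Cw w ℓ f g) (v : Fin d → ℝ) : -Cl ≤ ℓ v := by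
  have := hc.lower v
  have : 0 ≤ lo * ‖v‖ ^ q := mul_nonneg hc.lo_pos.le (by positivity)
  linarith

lemma integrableOn_comp (hc : IsAdmissibleCost q lo hi Cl Cb Cw w ℓ f g) {hT : 0 ≤ T}
    {γ : PathSpace T d} {z : ℝ → Fin d → ℝ} (hz : HasWDeriv T q hT γ z) :
    IntegrableOn (fun t => ℓ (z t)) (Icc 0 T) := by
  refine hz.integrableOn_comp hc.continuous (A := hi) (B := Cl) fun v => abs_le.2 ⟨?_, hc.upper v⟩
  have := hc.neg_le v
  have : 0 ≤ hi * ‖v‖ ^ q := mul_nonneg hc.hi_pos.le (by positivity)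
  linarith

lemma neg_le_integral (hc : IsAdmissibleCost q lo hi Cl Cb Cw w ℓ f g) {hT : 0 ≤ T}
    {γ : PathSpace T d} {z : ℝ → Fin d → ℝ} (hz : HasWDeriv T q hT γ z) :
    -(T * Cl) ≤ ∫ t in Icc 0 T, ℓ (z t) := by
  have := setIntegral_mono (μ := volume) (s := Icc 0 T) (f := fun _ => -Cl)
    (integrableOn_const (by simp)) (hc.integrableOn_comp hz) fun t => hc.neg_le _
  simpa [hT] using this

/-- Small perturbations of the velocity change the running cost by a small fraction of the
`q`-energy. -/
lemma add_le (hc : IsAdmissibleCost q lo hi Cl Cb Cw w ℓ f g) {κ : ℝ} (hκ : 0 < κ) (hκ1 : κ ≤ 1)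
    (a : Fin d → ℝ) {e : Fin d → ℝ} (he : ‖e‖ ≤ κ) :
    ℓ (a + e) ≤ ℓ a + κ * (hi * 2 ^ q * ‖a‖ ^ q + (hi * 2 ^ q + 2 * Cl)) := by
  have h1 := hc.convex.2 (mem_univ a) (mem_univ (a + κ⁻¹ • e)) (sub_nonneg.2 hκ1) hκ.le (by ring)
  have e1 : (1 - κ) • a + κ • (a + κ⁻¹ • e) = a + e := by
    rw [smul_add, smul_smul, mul_inv_cancel₀ hκ.ne', one_smul, sub_smul, one_smul]
    abel
  rw [e1, smul_eq_mul, smul_eq_mul] at h1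
  have h2 : ‖a + κ⁻¹ • e‖ ≤ ‖a‖ + 1 := by
    refine (norm_add_le _ _).trans (add_le_add_right ?_ _)
    rw [norm_smul, norm_inv, Real.norm_of_nonneg hκ.le, inv_mul_le_one₀ hκ]
    exact he
  have h3 : ℓ (a + κ⁻¹ • e) ≤ hi * (2 ^ q * (‖a‖ ^ q + 1)) + Cl := by
    refine (hc.upper _).trans (add_le_add_left (mul_le_mul_of_nonneg_left ?_ hc.hi_pos.le) _)
    calc ‖a + κ⁻¹ • e‖ ^ q ≤ (‖a‖ + 1) ^ q :=
          Real.rpow_le_rpow (norm_nonneg _) h2 (by linarith [hc.one_lt])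
      _ ≤ 2 ^ q * (‖a‖ ^ q + 1 ^ q) := add_rpow_le hc.one_lt (norm_nonneg _) zero_le_one
      _ = _ := by rw [Real.one_rpow]
  have h4 := mul_le_mul_of_nonneg_left
    (show ℓ (a + κ⁻¹ • e) - ℓ a ≤ hi * 2 ^ q * ‖a‖ ^ q + (hi * 2 ^ q + 2 * Cl) by
      linarith [hc.neg_le a]) hκ.le
  linarith

end IsAdmissibleCost

variable [MeasurableSpace (PathSpace T d)]

/-- The value function of the control problem against the flow of marginals of `ξ`. -/
def limitValue (hT : 0 ≤ T) (q : ℝ) (ℓ : (Fin d → ℝ) → ℝ)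
    (f g : (Fin d → ℝ) → Measure (Fin d → ℝ) → ℝ) (ξ : Measure (PathSpace T d))
    (x : Fin d → ℝ) : ℝ :=
  sInf {r | ∃ γ z, HasWDeriv T q hT γ z ∧ ev hT γ 0 = x ∧
    r = (∫ t in Icc 0 T, ℓ (z t)) + limitCost hT f g ξ γ}

lemma exists_lt_limitValue_add (hT : 0 ≤ T) (q : ℝ) (ℓ : (Fin d → ℝ) → ℝ)
    (f g : (Fin d → ℝ) → Measure (Fin d → ℝ) → ℝ) (ξs : Measure (PathSpace T d)) (x : Fin d → ℝ)
    {η : ℝ} (hη : 0 < η) :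
    ∃ γ z, HasWDeriv T q hT γ z ∧ ev hT γ 0 = x ∧
      (∫ t in Icc 0 T, ℓ (z t)) + limitCost hT f g ξs γ <
        limitValue hT q ℓ f g ξs x + η := by
  obtain ⟨_, ⟨γ, z, hz, hx, rfl⟩, hlt⟩ := exists_lt_of_csInf_lt
    (s := {r | ∃ γ z, HasWDeriv T q hT γ z ∧ ev hT γ 0 = x ∧
      r = (∫ t in Icc 0 T, ℓ (z t)) + limitCost hT f g ξs γ})
    ⟨_, _, _, hasWDeriv_const hT q x, rfl, rfl⟩ (lt_add_of_pos_right _ hη)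
  exact ⟨γ, z, hz, hx, hlt⟩

variable [BorelSpace (PathSpace T d)]

namespace IsLimitOfApprox

variable {hT : 0 < T} {N : ℕ → ℕ} {G : ℕ → Set (Fin d → ℝ)} {R C : ℝ} {e : ℕ → ℝ}
  {ξ : ℕ → Measure (PathSpace T d)} {ξs : Measure (PathSpace T d)}

lemma limitValue_le (h : IsLimitOfApprox hT q ℓ f g N G R C e ξ ξs)
    (hc : IsAdmissibleCost q lo hi Cl Cb Cw w ℓ f g) {γ : PathSpace T d} {z : ℝ → Fin d → ℝ}
    (hz : HasWDeriv T q hT.le γ z) :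
    limitValue hT.le q ℓ f g ξs (ev hT.le γ 0) ≤
      (∫ t in Icc 0 T, ℓ (z t)) + limitCost hT.le f g ξs γ := by
  refine csInf_le ⟨-(T * Cl) - (T * Cb + Cb), ?_⟩ ⟨γ, z, hz, rfl, rfl⟩
  rintro _ ⟨γ', z', hz', -, rfl⟩
  linarith [hc.neg_le_integral hz', (abs_le.1 (h.abs_limitCost_le hc γ')).1]

lemma limitValue_le_const (h : IsLimitOfApprox hT q ℓ f g N G R C e ξ ξs)
    (hc : IsAdmissibleCost q lo hi Cl Cb Cw w ℓ f g) (x : Fin d → ℝ) :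
    limitValue hT.le q ℓ f g ξs x ≤ T * ℓ 0 + (T * Cb + Cb) := by
  have h1 := h.limitValue_le hc (hasWDeriv_const hT.le q x)
  have h2 := (abs_le.1 (h.abs_limitCost_le hc (ContinuousMap.const _ x))).2
  have h3 : ∫ _ in Icc 0 T, ℓ 0 = T * ℓ 0 := by simp [hT.le]
  rw [h3] at h1
  exact h1.trans (by linarith)

lemma limitValue_le_add (h : IsLimitOfApprox hT q ℓ f g N G R C e ξ ξs)
    (hc : IsAdmissibleCost q lo hi Cl Cb Cw w ℓ f g) (x y : Fin d → ℝ) :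
    limitValue hT.le q ℓ f g ξs x ≤
      limitValue hT.le q ℓ f g ξs y + (T * Cb + Cb) * ‖x - y‖ := by
  refine le_of_forall_pos_le_add fun η hη => ?_
  obtain ⟨γ, z, hz, rfl, hlt⟩ := exists_lt_limitValue_add hT.le q ℓ f g ξs y hη
  have h1 := h.limitValue_le hc (hz.add_const (x - ev hT.le γ 0))
  rw [ev_add_const, add_sub_cancel] at h1
  have h2 := (abs_le.1 (h.abs_limitCost_sub_le hc
    (γ := γ + ContinuousMap.const _ (x - ev hT.le γ 0)) (γ' := γ)
    (r := ‖x - ev hT.le γ 0‖) fun t => by rw [ev_add_const, add_sub_cancel_left])).2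
  linarith

lemma continuous_limitValue (h : IsLimitOfApprox hT q ℓ f g N G R C e ξ ξs)
    (hc : IsAdmissibleCost q lo hi Cl Cb Cw w ℓ f g) :
    Continuous (limitValue hT.le q ℓ f g ξs) :=
  (LipschitzWith.of_le_add_mul (Real.toNNReal (T * Cb + Cb)) fun x y => by
    have := hc.Cb_pos
    rw [Real.coe_toNNReal _ (by positivity), dist_eq_norm]
    exact h.limitValue_le_add hc x y).continuous

lemma continuous_limitCost (h : IsLimitOfApprox hT q ℓ f g N G R C e ξ ξs)
    (hc : IsAdmissibleCost q lo hi Cl Cb Cw w ℓ f g) :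
    Continuous (limitCost hT.le f g ξs) :=
  (LipschitzWith.of_le_add_mul (Real.toNNReal (T * Cb + Cb)) fun γ γ' => by
    have := hc.Cb_pos
    rw [Real.coe_toNNReal _ (by positivity)]
    linarith [(abs_le.1 (h.abs_limitCost_sub_le hc fun t => norm_ev_sub_le hT.le γ γ' t)).2]
    ).continuous

/-- Any `W^{1,q}` curve is approximated by grid competitors starting from nearby grid points. -/
lemma eventually_exists_competitor (h : IsLimitOfApprox hT q ℓ f g N G R C e ξ ξs)
    (hc : IsAdmissibleCost q lo hi Cl Cb Cw w ℓ f g) {δ : ℕ → ℝ} (hδ : ∀ n, 0 < δ n)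
    (hG : ∀ ρ : ℝ, ∀ᶠ n in atTop, ∀ x, ‖x‖ ≤ ρ → ∃ y ∈ G n, ‖y - x‖ ≤ δ n)
    (hδN : Tendsto (fun n => δ n / (T / N n)) atTop (𝓝 0)) {γ : PathSpace T d}
    {z : ℝ → Fin d → ℝ} (hz : HasWDeriv T q hT.le γ z) {η : ℝ} (hη : 0 < η) :
    ∀ᶠ n in atTop, ∀ x ∈ G n, ‖x - ev hT.le γ 0‖ ≤ 1 →
      ∃ y : ℕ → Fin d → ℝ, y 0 = x ∧ (∀ k ≤ N n, y k ∈ G n) ∧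
        nodeCost hT.le ℓ f g (ξ n) (N n) y ≤ (∫ t in Icc 0 T, ℓ (z t)) +
          limitCost hT.le f g ξs γ + (T * Cb + Cb) * ‖x - ev hT.le γ 0‖ + η := by
  have hq := hc.one_lt
  have hCb := hc.Cb_pos
  have hhi := hc.hi_pos
  have hCl := hc.Cl_pos
  set E := ∫ t in Icc 0 T, ‖z t‖ ^ q with hE
  have hE0 : 0 ≤ E := integral_nonneg fun _ => by positivity
  set A := hi * 2 ^ q with hA
  set B := hi * 2 ^ q + 2 * Cl with hB
  have hA0 : 0 < A := by positivity
  set D := 1 + ‖ev hT.le γ 0‖ ^ q + E with hD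
  have hD0 : 0 < D := by positivity
  have hδ0 : Tendsto δ atTop (𝓝 0) := by
    have := hδN.mul (tendsto_mesh T h.tendsto_N)
    rw [zero_mul] at this
    refine this.congr fun n => ?_
    have : (0 : ℝ) < N n := by exact_mod_cast h.pos n
    field_simp
  have hκ : Tendsto (fun n => 2 * (δ n / (T / N n))) atTop (𝓝 0) := by
    simpa using hδN.const_mul 2
  have hκ' : Tendsto (fun n => 2 * (δ n / (T / N n)) * (A * E + T * B)) atTop (𝓝 0) := by
    simpa using hκ.mul_const (A * E + T * B)
  have hδ' : Tendsto (fun n => (T * Cb + Cb) * δ n) atTop (𝓝 0) := by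
    simpa using hδ0.const_mul (T * Cb + Cb)
  have hη3 : 0 < η / 3 := by positivity
  filter_upwards [hκ.eventually (ge_mem_nhds one_pos), hκ'.eventually (ge_mem_nhds hη3),
    hδ'.eventually (ge_mem_nhds hη3), hG (‖γ‖ + 1),
    h.eventually_flowCost_close hc (show 0 < η / 3 / D by positivity)]
    with n hn1 hn2 hn3 hnG hnF x hx hx1
  have hN : (0 : ℝ) < N n := by exact_mod_cast h.pos n
  have hh : 0 < T / N n := by positivity
  choose Y hYG hYle using hnG
  set p : ℕ → Fin d → ℝ := fun k => ev hT.le γ (k * (T / N n)) + (x - ev hT.le γ 0) with hp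
  have hpn : ∀ k, ‖p k‖ ≤ ‖γ‖ + 1 := fun k =>
    (norm_add_le _ _).trans (add_le_add (norm_ev_le _ _ _) hx1)
  set y : ℕ → Fin d → ℝ := fun k => if k = 0 then x else Y (p k) (hpn k) with hy
  have hyp : ∀ k, ‖y k - p k‖ ≤ δ n := by
    intro k
    by_cases hk : k = 0
    · simp only [hy, hk, hp, if_true, Nat.cast_zero, zero_mul, add_sub_cancel, sub_self, norm_zero]
      exact (hδ n).le
    · simp only [hy, hk, if_false]
      exact hYle _ _
  refine ⟨y, by simp [hy], fun k _ => ?_, ?_⟩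
  · by_cases hk : k = 0
    · simpa [hy, hk] using hx
    · simpa [hy, hk] using hYG _ _
  have hrun : ∑ k ∈ Finset.range (N n), T / N n * ℓ ((T / N n)⁻¹ • (y (k + 1) - y k)) ≤
      (∫ t in Icc 0 T, ℓ (z t)) + η / 3 := by
    set κ := 2 * (δ n / (T / N n)) with hκdef
    have hκ0 : 0 < κ := by have := hδ n; positivity
    calc _ ≤ actionOn hT.le (fun v => ℓ v + κ * (A * ‖v‖ ^ q + B)) (N n) γ := by
          refine Finset.sum_le_sum fun k _ => mul_le_mul_of_nonneg_left ?_ hh.le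
          have e1 : (T / N n)⁻¹ • (y (k + 1) - y k) =
              (T / N n)⁻¹ • (ev hT.le γ (((k : ℝ) + 1) * (T / N n)) -
                ev hT.le γ (k * (T / N n))) +
              (T / N n)⁻¹ • ((y (k + 1) - p (k + 1)) - (y k - p k)) := by
            rw [← smul_add]
            congr 1
            simp only [hp, Nat.cast_add, Nat.cast_one]
            abel
          rw [e1]
          refine hc.add_le hκ0 hn1 _ ?_
          rw [norm_smul, norm_inv, Real.norm_of_nonneg hh.le, inv_mul_le_iff₀ hh]
          calc _ ≤ δ n + δ n := (norm_sub_le _ _).trans (add_le_add (hyp _) (hyp _))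
            _ = _ := by
              rw [hκdef]
              field_simp
              ring
      _ = actionOn hT.le ℓ (N n) γ +
          κ * (A * actionOn hT.le (fun v => ‖v‖ ^ q) (N n) γ + T * B) := by
          rw [← actionOn_const_mul, ← actionOn_add_const hT.le _ _ (h.pos n),
            ← actionOn_const_mul]
          simp only [actionOn, mul_add, Finset.sum_add_distrib]
      _ ≤ (∫ t in Icc 0 T, ℓ (z t)) + κ * (A * E + T * B) := by
          gcongr
          · exact hz.actionOn_le hT hc.convex hc.continuous (hc.integrableOn_comp hz) (h.pos n)
          · exact hz.actionOn_le hT (convexOn_norm_rpow hq) (continuous_norm_rpow hq) hz.2.1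
              (h.pos n)
      _ ≤ _ := by gcongr
  have hflow : flowCost hT.le f g (ξ n) (N n) y ≤ limitCost hT.le f g ξs γ + η / 3 +
      (T * Cb + Cb) * ‖x - ev hT.le γ 0‖ + η / 3 := by
    have h1 := (abs_le.1 (hnF γ z hz)).2
    rw [← hE, ← hD, div_mul_cancel₀ _ hD0.ne'] at h1
    have h2 := (abs_le.1 (hc.abs_flowCost_sub_le hT.le (h.approx n).isP1 (h.pos n) (x := y)
      (y := fun k => ev hT.le γ (k * (T / N n))) (r := ‖x - ev hT.le γ 0‖ + δ n) fun k _ => by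
        calc ‖y k - ev hT.le γ (k * (T / N n))‖ = ‖(x - ev hT.le γ 0) + (y k - p k)‖ := by
              simp only [hp]
              congr 1
              abel
          _ ≤ _ := (norm_add_le _ _).trans (by gcongr; exact hyp k))).2
    linarith
  rw [nodeCost_eq]
  linarith

/-- Grid competitors reach the value function uniformly on balls. -/
lemma eventually_exists_le_limitValue (h : IsLimitOfApprox hT q ℓ f g N G R C e ξ ξs)
    (hc : IsAdmissibleCost q lo hi Cl Cb Cw w ℓ f g) {δ : ℕ → ℝ} (hδ : ∀ n, 0 < δ n)
    (hG : ∀ ρ : ℝ, ∀ᶠ n in atTop, ∀ x, ‖x‖ ≤ ρ → ∃ y ∈ G n, ‖y - x‖ ≤ δ n)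
    (hδN : Tendsto (fun n => δ n / (T / N n)) atTop (𝓝 0)) {η : ℝ} (hη : 0 < η) :
    ∀ᶠ n in atTop, ∀ x ∈ G n, ‖x‖ ≤ R →
      ∃ y : ℕ → Fin d → ℝ, y 0 = x ∧ (∀ k ≤ N n, y k ∈ G n) ∧
        nodeCost hT.le ℓ f g (ξ n) (N n) y ≤ limitValue hT.le q ℓ f g ξs x + η := by
  have hCb := hc.Cb_pos
  set K := T * Cb + Cb with hK
  have hK0 : 0 < K := by positivity
  set r := min 1 (η / (4 * K)) with hr
  have hr0 : 0 < r := lt_min one_pos (by positivity)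
  obtain ⟨t, -, ht, hcov⟩ := (isCompact_closedBall (0 : Fin d → ℝ) R).finite_cover_balls hr0
  have hη8 : 0 < η / 8 := by positivity
  choose γ z hz hγ0 hlt using fun c : Fin d → ℝ => exists_lt_limitValue_add hT.le q ℓ f g
    ξs c hη8
  filter_upwards [(eventually_all_finite ht).2 fun c _ =>
    h.eventually_exists_competitor hc hδ hG hδN (hz c) hη8] with n hn x hx hxR
  obtain ⟨c, hct, hxc⟩ := mem_iUnion₂.1 (hcov (mem_closedBall_zero_iff.2 hxR))
  rw [Metric.mem_ball, dist_eq_norm] at hxc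
  have hn' := hn c hct x hx
  rw [hγ0] at hn'
  obtain ⟨y, hy0, hyG, hy⟩ := hn' (hxc.le.trans (min_le_left _ _))
  refine ⟨y, hy0, hyG, ?_⟩
  have h1 := h.limitValue_le_add hc c x
  rw [← hK, norm_sub_rev] at h1
  have h2 : K * ‖x - c‖ ≤ η / 4 := by
    calc K * ‖x - c‖ ≤ K * (η / (4 * K)) := by
          gcongr
          exact hxc.le.trans (min_le_right _ _)
      _ = _ := by field_simp
  linarith [hlt c]

end IsLimitOfApprox

end Value

section Conclusion

variable {d : ℕ} {T : ℝ}

lemma exists_hasWDeriv_of_liminf_actionOn_le {q : ℝ} (hT : 0 < T) (hq : 1 < q)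
    {ℓ : (Fin d → ℝ) → ℝ} (hl : Continuous ℓ) {lo Cl : ℝ} (hlo : 0 < lo)
    (hgrowth : ∀ v : Fin d → ℝ, lo * ‖v‖ ^ q - Cl ≤ ℓ v) (γ : PathSpace T d) {κ s : ℝ}
    (hs : 0 ≤ s) (h : liminf (fun j : ℕ => ENNReal.ofReal (actionOn hT.le ℓ (j + 1) γ + κ)) atTop ≤
      ENNReal.ofReal s) :
    ∃ z, HasWDeriv T q hT.le γ z ∧ ∫ t in Icc 0 T, ℓ (z t) ≤ s - κ := by
  have h1 : ∀ i : ℕ, ∃ j ≥ i, actionOn hT.le ℓ (j + 1) γ ≤ s - κ + 1 / ((i : ℝ) + 1) := by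
    intro i
    have hi : (0 : ℝ) < 1 / ((i : ℝ) + 1) := by positivity
    have h2 := h.trans_lt ((ENNReal.ofReal_lt_ofReal_iff (by linarith)).2
      (lt_add_of_pos_right s hi))
    obtain ⟨j, hj, hij⟩ := ((frequently_lt_of_liminf_lt (by isBoundedDefault) h2).and_eventually
      (eventually_ge_atTop i)).exists
    have := ((ENNReal.ofReal_lt_ofReal_iff (by linarith)).1 hj).le
    exact ⟨j, hij, by linarith⟩
  choose φ hφ hle using h1
  refine exists_hasWDeriv_of_actionOn_le hT hq hl hlo hgrowth γ (φ := fun i => φ i + 1)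
    (tendsto_atTop_mono (fun i => (hφ i).trans (Nat.le_succ _)) tendsto_id)
    (fun i => Nat.succ_pos _) ?_ hle
  simpa using tendsto_one_div_add_atTop_nhds_zero_nat.const_add (s - κ)

variable [MeasurableSpace (PathSpace T d)] [BorelSpace (PathSpace T d)]
  {q lo hi Cl Cb Cw : ℝ} {w : ℝ → ℝ} {ℓ : (Fin d → ℝ) → ℝ}
  {f g : (Fin d → ℝ) → Measure (Fin d → ℝ) → ℝ}

namespace IsLimitOfApprox

variable {hT : 0 < T} {N : ℕ → ℕ} {G : ℕ → Set (Fin d → ℝ)} {R C : ℝ} {e : ℕ → ℝ}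
  {ξ : ℕ → Measure (PathSpace T d)} {ξs : Measure (PathSpace T d)}

lemma eventually_integral_le (h : IsLimitOfApprox hT q ℓ f g N G R C e ξ ξs)
    (hc : IsAdmissibleCost q lo hi Cl Cb Cw w ℓ f g) {δ : ℕ → ℝ} (hδ : ∀ n, 0 < δ n)
    (hG : ∀ ρ : ℝ, ∀ᶠ n in atTop, ∀ x, ‖x‖ ≤ ρ → ∃ y ∈ G n, ‖y - x‖ ≤ δ n)
    (hδN : Tendsto (fun n => δ n / (T / N n)) atTop (𝓝 0)) {M : ℕ} (hM : 0 < M) {η : ℝ}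
    (hη : 0 < η) :
    ∀ᶠ n in atTop, ∫ γ, (actionOn hT.le ℓ M γ + limitCost hT.le f g ξs γ -
      limitValue hT.le q ℓ f g ξs (ev hT.le γ 0)) ∂(ξ n) ≤ η := by
  have hq := hc.one_lt
  have hC : 0 ≤ C := (integral_nonneg fun γ => Finset.sum_nonneg fun k _ => by
    have := hT.le
    positivity).trans (h.energy_le 0)
  set D := 1 + |R| ^ q + C with hD
  have hD0 : 0 < D := by positivity
  have hη3 : 0 < η / 3 := by positivity
  filter_upwards [h.tendsto_e.eventually (ge_mem_nhds hη3),
    h.eventually_exists_le_limitValue hc hδ hG hδN hη3,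
    h.eventually_flowCost_close hc (show 0 < η / 3 / D by positivity)] with n hn1 hn2 hn3
  have happ := h.approx n
  have := happ.prob
  have hint := happ.integrable
  have h1 := happ.le _ _ hn2
  have h2 : ∫ γ, (actionOn hT.le ℓ M γ + limitCost hT.le f g ξs γ) ∂(ξ n) ≤
      ∫ γ, (nodeCost hT.le ℓ f g (ξ n) (N n) (fun k => ev hT.le γ (k * (T / N n))) +
        η / 3 / D * (1 + |R| ^ q + actionOn hT.le (fun v => ‖v‖ ^ q) (N n) γ)) ∂(ξ n) := by
    refine integral_mono_ae (hint _) (hint _) ?_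
    filter_upwards [happ.ae_start, happ.ae_deriv] with γ hγ hz
    obtain ⟨z, hz, hzφ⟩ := hz
    have h3 := (abs_le.1 (hn3 γ z hz)).1
    have h4 := hz.actionOn_le hT hc.convex hc.continuous (hc.integrableOn_comp hz) hM
    rw [hzφ ℓ] at h4
    rw [hzφ fun v => ‖v‖ ^ q] at h3
    have h5 : ‖ev hT.le γ 0‖ ^ q ≤ |R| ^ q :=
      Real.rpow_le_rpow (norm_nonneg _) (hγ.trans (le_abs_self R)) (by linarith)
    have h6 : η / 3 / D *
        (1 + ‖ev hT.le γ 0‖ ^ q + actionOn hT.le (fun v => ‖v‖ ^ q) (N n) γ) ≤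
        η / 3 / D * (1 + |R| ^ q + actionOn hT.le (fun v => ‖v‖ ^ q) (N n) γ) := by gcongr
    rw [nodeCost_ev]
    linarith
  rw [integral_add (hint _) (hint _), integral_add (hint _) (hint _), integral_const_mul,
    integral_add (hint _) (hint _), integral_const, probReal_univ, one_smul] at h2
  have h3 : η / 3 / D * (1 + |R| ^ q + ∫ γ, actionOn hT.le (fun v => ‖v‖ ^ q) (N n) γ ∂(ξ n)) ≤
      η / 3 := by
    calc _ ≤ η / 3 / D * D := by
          rw [hD]
          gcongr
          exact h.energy_le n
      _ = _ := div_mul_cancel₀ _ hD0.ne'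
  rw [integral_sub (hint _) (hint _), integral_add (hint _) (hint _)]
  linarith

/-- Almost every path of the limit measure is optimal against the limit flow. -/
theorem ae_exists_le_limitValue (h : IsLimitOfApprox hT q ℓ f g N G R C e ξ ξs)
    (hc : IsAdmissibleCost q lo hi Cl Cb Cw w ℓ f g) {δ : ℕ → ℝ} (hδ : ∀ n, 0 < δ n)
    (hG : ∀ ρ : ℝ, ∀ᶠ n in atTop, ∀ x, ‖x‖ ≤ ρ → ∃ y ∈ G n, ‖y - x‖ ≤ δ n)
    (hδN : Tendsto (fun n => δ n / (T / N n)) atTop (𝓝 0)) :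
    ∀ᵐ γ ∂ξs, ∃ z, HasWDeriv T q hT.le γ z ∧
      (∫ t in Icc 0 T, ℓ (z t)) + limitCost hT.le f g ξs γ ≤
        limitValue hT.le q ℓ f g ξs (ev hT.le γ 0) := by
  have := h.prob
  have hCl := hc.Cl_pos
  have hCb := hc.Cb_pos
  have hl0 := hc.neg_le 0
  set c := T * Cl + (T * Cb + Cb) + (T * ℓ 0 + (T * Cb + Cb)) with hcdef
  have hc0 : 0 ≤ c := by
    have : 0 ≤ T * (Cl + ℓ 0) := mul_nonneg hT.le (by linarith)
    have : 0 < T * Cb := by positivity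
    rw [hcdef]
    linarith
  set κ : PathSpace T d → ℝ := fun γ =>
    limitCost hT.le f g ξs γ - limitValue hT.le q ℓ f g ξs (ev hT.le γ 0) + c with hκ
  have hκc : Continuous κ := ((h.continuous_limitCost hc).sub
    ((h.continuous_limitValue hc).comp (continuous_ev_left hT.le 0))).add continuous_const
  have hFc : ∀ j : ℕ, Continuous fun γ => actionOn hT.le ℓ (j + 1) γ + κ γ := fun j =>
    (continuous_actionOn hT.le hc.continuous _).add hκc
  have hF0 : ∀ (j : ℕ) (γ : PathSpace T d), 0 ≤ actionOn hT.le ℓ (j + 1) γ + κ γ := fun j γ => by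
    have h1 : 0 ≤ actionOn hT.le (fun v => ℓ v + Cl) (j + 1) γ :=
      Finset.sum_nonneg fun k _ => mul_nonneg (by have := hT.le; positivity)
        (by linarith [hc.neg_le ((T / ((j + 1 : ℕ) : ℝ))⁻¹ •
          (ev hT.le γ (((k : ℝ) + 1) * (T / ((j + 1 : ℕ) : ℝ))) -
            ev hT.le γ (k * (T / ((j + 1 : ℕ) : ℝ)))))])
    rw [actionOn_add_const hT.le ℓ Cl (Nat.succ_pos j)] at h1
    have h2 := (abs_le.1 (h.abs_limitCost_le hc γ)).1
    have h3 := h.limitValue_le_const hc (ev hT.le γ 0)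
    simp only [hκ]
    linarith
  have hFi : ∀ j : ℕ, Integrable (fun γ => actionOn hT.le ℓ (j + 1) γ + κ γ) ξs ∧
      ∫ γ, actionOn hT.le ℓ (j + 1) γ + κ γ ∂ξs ≤ c := by
    intro j
    have h1 : ∀ η > 0, Integrable (fun γ => actionOn hT.le ℓ (j + 1) γ + κ γ) ξs ∧
        ∫ γ, actionOn hT.le ℓ (j + 1) γ + κ γ ∂ξs ≤ c + η := fun η hη =>
      have := fun n => (h.approx n).prob
      integrable_and_integral_le_of_narrow h.narrow (hFc j) (hF0 j) tendsto_const_nhds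
        (fun n => (h.approx n).integrable _) (by
          filter_upwards [h.eventually_integral_le hc hδ hG hδN (Nat.succ_pos j) hη] with n hn
          have hint := (h.approx n).integrable
          have e1 : (fun γ => actionOn hT.le ℓ (j + 1) γ + κ γ) = fun γ =>
              (actionOn hT.le ℓ (j + 1) γ + limitCost hT.le f g ξs γ -
                limitValue hT.le q ℓ f g ξs (ev hT.le γ 0)) + c := by
            funext γ
            simp only [hκ]
            ring
          rw [e1, integral_add (hint _) (hint _), integral_const, probReal_univ, one_smul]
          linarith)
    exact ⟨(h1 1 one_pos).1, le_of_forall_pos_le_add fun η hη => (h1 η hη).2⟩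
  have hlow : ∀ (γ : PathSpace T d) (s : ℝ), 0 ≤ s →
      liminf (fun j : ℕ => ENNReal.ofReal (actionOn hT.le ℓ (j + 1) γ + κ γ)) atTop ≤
        ENNReal.ofReal s →
      ∃ z, HasWDeriv T q hT.le γ z ∧ (∫ t in Icc 0 T, ℓ (z t)) + limitCost hT.le f g ξs γ ≤
        limitValue hT.le q ℓ f g ξs (ev hT.le γ 0) + (s - c) := by
    intro γ s hs hle
    obtain ⟨z, hz, hzs⟩ := exists_hasWDeriv_of_liminf_actionOn_le hT hc.one_lt hc.continuous
      hc.lo_pos hc.lower γ hs hle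
    refine ⟨z, hz, ?_⟩
    simp only [hκ] at hzs
    linarith
  have hge : ∀ γ : PathSpace T d, ENNReal.ofReal c ≤
      liminf (fun j : ℕ => ENNReal.ofReal (actionOn hT.le ℓ (j + 1) γ + κ γ)) atTop := by
    intro γ
    by_contra! hlt
    obtain ⟨z, hz, hzs⟩ := hlow γ _ ENNReal.toReal_nonneg
      (ENNReal.ofReal_toReal (hlt.trans ENNReal.ofReal_lt_top).ne).ge
    have h1 := h.limitValue_le hc hz
    have h2 := ENNReal.toReal_lt_of_lt_ofReal hlt
    linarith
  have hfatou : ∫⁻ γ, liminf (fun j : ℕ =>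
      ENNReal.ofReal (actionOn hT.le ℓ (j + 1) γ + κ γ)) atTop ∂ξs ≤ ENNReal.ofReal c := by
    refine (lintegral_liminf_le fun j => (hFc j).measurable.ennreal_ofReal).trans ?_
    refine (liminf_le_liminf (Eventually.of_forall fun j => ?_)).trans_eq
      (liminf_const (f := (atTop : Filter ℕ)) (ENNReal.ofReal c))
    rw [← ofReal_integral_eq_lintegral_ofReal (hFi j).1 (ae_of_all _ (hF0 j))]
    exact ENNReal.ofReal_le_ofReal (hFi j).2
  have hae := ae_eq_of_ae_le_of_lintegral_le (ae_of_all ξs hge) (by simp)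
    (Measurable.liminf fun j => (hFc j).measurable.ennreal_ofReal).aemeasurable
    (by simpa using hfatou)
  filter_upwards [hae] with γ hγ
  simpa using hlow γ c hc0 hγ.ge

end IsLimitOfApprox

end Conclusion

section Grid

variable {d : ℕ}

/-- A finite cover whose masses add up to one turns masses into a quadrature formula. -/
lemma abs_sum_measure_mul_sub_integral_le {X S : Type*} [MeasurableSpace X] {m : Measure X}
    [IsProbabilityMeasure m] {A : Finset S} {E : S → Set X} (hE : ∀ i, MeasurableSet (E i))
    (hsum : ∑ i ∈ A, (m (E i)).toReal = 1) (hcov : ∀ᵐ x ∂m, ∃ i ∈ A, x ∈ E i) {F : X → ℝ}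
    (hF : Integrable F m) (a : S → ℝ) {κ : ℝ}
    (h : ∀ᵐ x ∂m, ∀ i ∈ A, x ∈ E i → |a i - F x| ≤ κ) :
    |∑ i ∈ A, (m (E i)).toReal * a i - ∫ x, F x ∂m| ≤ κ := by
  have hind : ∀ (i : S) (c : ℝ), Integrable ((E i).indicator fun _ => c) m := fun i c =>
    (integrable_const c).indicator (hE i)
  have hval : ∀ b : S → ℝ, ∫ x, ∑ i ∈ A, (E i).indicator (fun _ => b i) x ∂m =
      ∑ i ∈ A, (m (E i)).toReal * b i := fun b => by
    rw [integral_finsetSum _ fun i _ => hind i (b i)]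
    refine Finset.sum_congr rfl fun i _ => ?_
    rw [integral_indicator (hE i), setIntegral_const, smul_eq_mul, Measure.real]
  have hsi : ∀ b : S → ℝ, Integrable (fun x => ∑ i ∈ A, (E i).indicator (fun _ => b i) x) m :=
    fun b => integrable_finsetSum _ fun i _ => hind i (b i)
  have hge : ∀ᵐ x ∂m, 0 ≤ ∑ i ∈ A, (E i).indicator (fun _ => (1 : ℝ)) x - 1 := by
    filter_upwards [hcov] with x hx
    obtain ⟨i, hi, hxi⟩ := hx
    have := Finset.single_le_sum (f := fun i => (E i).indicator (fun _ => (1 : ℝ)) x)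
      (fun j _ => indicator_nonneg (fun _ _ => zero_le_one) x) hi
    simp only [indicator_of_mem hxi] at this
    linarith
  have hone : ∀ᵐ x ∂m, ∑ i ∈ A, (E i).indicator (fun _ => (1 : ℝ)) x - 1 = 0 := by
    refine (integral_eq_zero_iff_of_nonneg_ae hge ((hsi fun _ => 1).sub (integrable_const 1))).1 ?_
    rw [integral_sub (hsi fun _ => 1) (integrable_const 1), hval]
    simp [hsum]
  rw [← hval, ← integral_sub (hsi a) hF, ← Real.norm_eq_abs]
  refine (norm_integral_le_of_norm_le_const (C := κ) ?_).trans_eq (by simp)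
  filter_upwards [hone, h] with x hx1 hx
  have e1 : ∑ i ∈ A, (E i).indicator (fun _ => a i) x - F x =
      ∑ i ∈ A, (E i).indicator (fun _ => (1 : ℝ)) x * (a i - F x) := by
    simp only [mul_sub, Finset.sum_sub_distrib]
    rw [← Finset.sum_mul, sub_eq_zero.1 hx1, one_mul]
    simp only [sub_left_inj]
    refine Finset.sum_congr rfl fun i _ => ?_
    by_cases hi : x ∈ E i <;> simp [hi]
  rw [e1]
  refine (norm_sum_le _ _).trans ?_
  calc _ ≤ ∑ i ∈ A, (E i).indicator (fun _ => (1 : ℝ)) x * κ := by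
        refine Finset.sum_le_sum fun i hi => ?_
        by_cases hxi : x ∈ E i
        · simpa [hxi] using hx i hi hxi
        · simp [hxi]
    _ = κ := by rw [← Finset.sum_mul, sub_eq_zero.1 hx1, one_mul]

lemma exists_gpt_near {Ns : ℕ → ℕ} {n : ℕ} (hNs : 0 < Ns n) {ρ : ℝ} (hρ : ρ + 1 ≤ Ns n)
    {x : Fin d → ℝ} (hx : ‖x‖ ≤ ρ) :
    ∃ i ∈ gridIdx d Ns n, ‖gpt d Ns n i - x‖ ≤ dxn Ns n / 2 := by
  have hN : (1 : ℝ) ≤ Ns n := by exact_mod_cast hNs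
  refine ⟨fun j => round (x j * Ns n), ?_, ?_⟩
  · have key : ∀ j, |((round (x j * Ns n) : ℤ) : ℝ)| ≤ (Ns n : ℝ) ^ 2 := by
      intro j
      have h1 := abs_sub_round (x j * Ns n)
      have h2 : |x j| ≤ ρ := (norm_le_pi_norm x j).trans hx
      have h3 : |x j * Ns n| ≤ ρ * Ns n := by
        rw [abs_mul, Nat.abs_cast]
        gcongr
      rw [abs_le] at h1 h3 ⊢
      constructor <;> nlinarith
    simp only [gridIdx, Finset.mem_Icc, Pi.le_def]
    refine ⟨fun j => ?_, fun j => ?_⟩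
    · exact_mod_cast (abs_le.1 (key j)).1
    · exact_mod_cast (abs_le.1 (key j)).2
  · rw [dxn, pi_norm_le_iff_of_nonneg (by positivity)]
    intro j
    have h1 := abs_sub_round (x j * Ns n)
    have e1 : (gpt d Ns n (fun j => round (x j * Ns n)) - x) j =
        (round (x j * Ns n) - x j * Ns n) * (1 / (Ns n : ℝ)) := by
      simp only [gpt, dxn, Pi.sub_apply]
      field_simp
    rw [e1, Real.norm_eq_abs, abs_mul, abs_of_pos (show (0 : ℝ) < 1 / Ns n by positivity),
      abs_sub_comm, mul_comm]
    exact (mul_le_mul_of_nonneg_left h1 (by positivity)).trans_eq (by ring)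

lemma log_card_gridIdx_le {Ns : ℕ → ℕ} {n : ℕ} (hNs : 3 ≤ Ns n) :
    Real.log (gridIdx d Ns n).card ≤ 3 * d * Real.log (Ns n) := by
  have h1 : (gridIdx d Ns n).card = (2 * Ns n ^ 2 + 1) ^ d := by
    rw [gridIdx, Pi.card_Icc]
    simp only [Int.card_Icc, Finset.prod_const, Finset.card_univ, Fintype.card_fin]
    congr 1
    have : (Ns n : ℤ) ^ 2 + 1 - -(Ns n : ℤ) ^ 2 = ((2 * Ns n ^ 2 + 1 : ℕ) : ℤ) := by
      push_cast
      ring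
    rw [this, Int.toNat_natCast]
  have h2 : 2 * Ns n ^ 2 + 1 ≤ Ns n ^ 3 := by nlinarith [sq_nonneg (Ns n)]
  have h3 : ((2 * Ns n ^ 2 + 1 : ℕ) : ℝ) ≤ (Ns n : ℝ) ^ 3 := by exact_mod_cast h2
  rw [h1, Nat.cast_pow, Real.log_pow]
  calc (d : ℝ) * Real.log ((2 * Ns n ^ 2 + 1 : ℕ) : ℝ) ≤ d * Real.log ((Ns n : ℝ) ^ 3) := by
        gcongr
    _ = _ := by
      rw [Real.log_pow]
      push_cast
      ring

lemma tendsto_dxn {Ns : ℕ → ℕ} (hNs : Tendsto (fun n => (Ns n : ℝ)) atTop atTop) :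
    Tendsto (dxn Ns) atTop (𝓝 0) :=
  (tendsto_inv_atTop_zero.comp hNs).congr fun _ => (one_div _).symm

lemma tendsto_sum_Mzero_mul {Ns : ℕ → ℕ} (hNs0 : ∀ n, 0 < Ns n)
    (hNs : Tendsto (fun n => (Ns n : ℝ)) atTop atTop) {m0 : Measure (Fin d → ℝ)}
    [IsProbabilityMeasure m0] {R : ℝ} (hR : m0 (Metric.closedBall 0 R)ᶜ = 0)
    (hsum : ∀ n, ∑ i ∈ gridIdx d Ns n, Mzero d Ns n m0 i = 1)
    (F : BoundedContinuousFunction (Fin d → ℝ) ℝ) :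
    Tendsto (fun n => ∑ i ∈ gridIdx d Ns n, Mzero d Ns n m0 i * F (gpt d Ns n i)) atTop
      (𝓝 (∫ x, F x ∂m0)) := by
  have hae : ∀ᵐ x ∂m0, ‖x‖ ≤ R := by
    filter_upwards [compl_mem_ae_iff.2 hR] with x hx
    simpa using hx
  rw [Metric.tendsto_nhds]
  intro ε hε
  have huc := (isCompact_closedBall (0 : Fin d → ℝ) (R + 1)).uniformContinuousOn_of_continuous
    F.continuous.continuousOn
  obtain ⟨δ, hδ, hF⟩ := Metric.uniformContinuousOn_iff.1 huc (ε / 2) (half_pos hε)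
  have hdx := tendsto_dxn hNs
  filter_upwards [hNs.eventually_ge_atTop (R + 1), hdx.eventually (gt_mem_nhds hδ),
    hdx.eventually (gt_mem_nhds one_pos)] with n hn1 hn2 hn3
  have hpos : 0 < dxn Ns n := one_div_pos.2 (by exact_mod_cast hNs0 n)
  rw [Real.dist_eq]
  refine (abs_sum_measure_mul_sub_integral_le (κ := ε / 2) (fun i => measurableSet_closedBall)
    (hsum n) ?_ (F.integrable m0) _ ?_).trans_lt (half_lt_self hε)
  · filter_upwards [hae] with x hx
    obtain ⟨i, hi, hxi⟩ := exists_gpt_near (hNs0 n) hn1 hx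
    exact ⟨i, hi, by rwa [Metric.mem_closedBall, dist_comm, dist_eq_norm]⟩
  · filter_upwards [hae] with x hx i _ hxi
    rw [Metric.mem_closedBall, dist_comm] at hxi
    have h1 : ‖gpt d Ns n i‖ ≤ R + 1 := by
      have := norm_le_norm_add_norm_sub' (gpt d Ns n i) x
      rw [← dist_eq_norm] at this
      linarith
    have := hF _ (mem_closedBall_zero_iff.2 h1) x (mem_closedBall_zero_iff.2 (by linarith))
      (by linarith)
    rw [Real.dist_eq] at this
    exact this.le

end Grid

section Main

variable {d : ℕ} {T : ℝ} [MeasurableSpace (PathSpace T d)] [BorelSpace (PathSpace T d)]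
  {q lo hi Cl Cb Cw : ℝ} {w : ℝ → ℝ} {ℓ : (Fin d → ℝ) → ℝ}
  {f g : (Fin d → ℝ) → Measure (Fin d → ℝ) → ℝ}

theorem IsLimitOfApprox.isMFGEquilibrium {hT : 0 < T} {N : ℕ → ℕ} {G : ℕ → Set (Fin d → ℝ)}
    {R C : ℝ} {e : ℕ → ℝ} {ξ : ℕ → Measure (PathSpace T d)} {ξs : Measure (PathSpace T d)}
    (h : IsLimitOfApprox hT q ℓ f g N G R C e ξ ξs)
    (hc : IsAdmissibleCost q lo hi Cl Cb Cw w ℓ f g) {δ : ℕ → ℝ} (hδ : ∀ n, 0 < δ n)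
    (hG : ∀ ρ : ℝ, ∀ᶠ n in atTop, ∀ x, ‖x‖ ≤ ρ → ∃ y ∈ G n, ‖y - x‖ ≤ δ n)
    (hδN : Tendsto (fun n => δ n / (T / N n)) atTop (𝓝 0)) {m0 : Measure (Fin d → ℝ)}
    (h0 : ξs.map (fun γ => ev hT.le γ 0) = m0) :
    IsMFGEquilibrium d T hT.le q ℓ f g m0 ξs := by
  have hfi : ∀ γ : PathSpace T d, IntegrableOn
      (fun t => f (ev hT.le γ t) (ξs.map fun γ' => ev hT.le γ' t)) (Icc 0 T) := fun γ =>
    (h.continuousOn_cost hc γ).integrableOn_compact isCompact_Icc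
  refine ⟨h0, fun t _ => h.isP1 hc.one_lt t, fun ε hε => h.exists_W1_limit_lt hc.one_lt hε, ?_⟩
  filter_upwards [h.ae_exists_le_limitValue hc hδ hG hδN] with γ hγ
  obtain ⟨z, hz, hle⟩ := hγ
  refine ⟨z, hz, (hc.integrableOn_comp hz).add (hfi γ), fun γ₁ z₁ hz₁ h01 _ => ?_⟩
  have h1 := h.limitValue_le hc hz₁
  rw [h01] at h1
  rw [integral_add (hc.integrableOn_comp hz) (hfi γ),
    integral_add (hc.integrableOn_comp hz₁) (hfi γ₁)]
  simp only [limitCost] at hle h1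
  linarith

lemma map_ev_zero_eq_of_narrow (hT : 0 ≤ T) {Ns : ℕ → ℕ} (hNs0 : ∀ n, 0 < Ns n)
    (hNs : Tendsto (fun n => (Ns n : ℝ)) atTop atTop) {m0 : Measure (Fin d → ℝ)}
    [IsProbabilityMeasure m0] {R : ℝ} (hR : m0 (Metric.closedBall 0 R)ᶜ = 0)
    (hsum : ∀ n, ∑ i ∈ gridIdx d Ns n, Mzero d Ns n m0 i = 1)
    {ξ : ℕ → Measure (PathSpace T d)} {ξs : Measure (PathSpace T d)} [IsProbabilityMeasure ξs]
    (hξ : ∀ n, (ξ n).map (fun γ => ev hT γ 0) = discMeas d Ns n (Mzero d Ns n m0))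
    {φ : ℕ → ℕ} (hφ : Tendsto φ atTop atTop)
    (hlim : ∀ F : BoundedContinuousFunction (PathSpace T d) ℝ,
      Tendsto (fun j => ∫ γ, F γ ∂(ξ (φ j))) atTop (𝓝 (∫ γ, F γ ∂ξs))) :
    ξs.map (fun γ => ev hT γ 0) = m0 := by
  have hev := continuous_ev_left (d := d) hT 0
  have := Measure.isProbabilityMeasure_map (μ := ξs) hev.measurable.aemeasurable
  refine ext_of_forall_integral_eq_of_IsFiniteMeasure fun F => ?_
  have hmap : ∀ μ : Measure (PathSpace T d),
      ∫ x, F x ∂(μ.map fun γ => ev hT γ 0) = ∫ γ, F (ev hT γ 0) ∂μ := fun μ =>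
    integral_map hev.measurable.aemeasurable F.continuous.aestronglyMeasurable
  have h1 := hlim (F.compContinuous ⟨_, hev⟩)
  have h2 := (tendsto_sum_Mzero_mul hNs0 hNs hR hsum F).comp hφ
  rw [hmap]
  refine tendsto_nhds_unique h1 (h2.congr fun j => ?_)
  have h3 := integral_finset_sum_dirac (B := gridIdx d Ns (φ j)) (w := Mzero d Ns (φ j) m0)
    (fun i _ => ENNReal.toReal_nonneg) (gpt d Ns (φ j)) F
  rw [Function.comp_apply, ← h3, ← discMeas, ← hξ, hmap]
  rfl

lemma tendsto_entropy_error {Ns Nt : ℕ → ℕ} {eps : ℕ → ℝ} (heps : ∀ n, 0 < eps n)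
    (hNs : Tendsto (fun n => (Ns n : ℝ)) atTop atTop)
    (h : Tendsto (fun n => eps n * ((Nt n : ℝ) * Real.log (Ns n))) atTop (𝓝 0)) :
    Tendsto (fun n => Nt n * (eps n * Real.log (gridIdx d Ns n).card)) atTop (𝓝 0) := by
  have h1 : Tendsto (fun n => 3 * (d : ℝ) * (eps n * ((Nt n : ℝ) * Real.log (Ns n)))) atTop
      (𝓝 0) := by simpa using h.const_mul (3 * (d : ℝ))
  refine squeeze_zero' (Eventually.of_forall fun n => ?_) ?_ h1
  · have := (heps n).le
    have := Real.log_natCast_nonneg (gridIdx d Ns n).card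
    positivity
  · filter_upwards [hNs.eventually_ge_atTop 3] with n hn
    have h2 := log_card_gridIdx_le (d := d) (Ns := Ns) (n := n) (by exact_mod_cast hn)
    calc _ ≤ Nt n * (eps n * (3 * d * Real.log (Ns n))) := by
          have := (heps n).le
          gcongr
      _ = _ := by ring

end Main

/-- Theorem 4.7 of the paper (main result): under (H3)–(H4), with `N^t_n/N^s_n → 0` and
`ε_n = o(1/(N^t_n log N^s_n))`, the sequence `(ξ_n)` of path measures induced by the
solutions of the finite MFGs has at least one limit point for the narrow topology, and
every such limit point is a MFG equilibrium of the continuous first order MFG. -/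
theorem finite_mfg_converges_to_first_order_mfg
    (d : ℕ) (T : ℝ) (hT : 0 < T) (q : ℝ) (hq : 1 < q)
    [MeasurableSpace (PathSpace T d)] [BorelSpace (PathSpace T d)]
    -- (H3)(i)
    (ℓ : (Fin d → ℝ) → ℝ) (hlcont : Continuous ℓ)
    (lo hi Cℓ : ℝ) (hlo : 0 < lo) (hhi : 0 < hi) (hCℓ : 0 < Cℓ)
    (hgrowth : ∀ α : Fin d → ℝ, lo * ‖α‖ ^ q - Cℓ ≤ ℓ α ∧ ℓ α ≤ hi * ‖α‖ ^ q + Cℓ)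
    -- (H3)(ii)
    (f g : (Fin d → ℝ) → Measure (Fin d → ℝ) → ℝ)
    (Cb : ℝ) (hCb : 0 < Cb)
    (hbound : ∀ m, IsP1 m → ∀ x, |f x m| ≤ Cb ∧ |g x m| ≤ Cb)
    (hxLip : ∀ m, IsP1 m → ∀ x y,
      |f x m - f y m| ≤ Cb * ‖x - y‖ ∧ |g x m - g y m| ≤ Cb * ‖x - y‖)
    (hcont : ∀ x m, IsP1 m → ∀ ε > (0 : ℝ), ∃ δ > (0 : ℝ), ∀ y m', IsP1 m' →
      ‖y - x‖ < δ → W1 m m' < δ → |f y m' - f x m| < ε ∧ |g y m' - g x m| < ε)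
    -- (H3)(iii)
    (m0 : Measure (Fin d → ℝ)) (hm0 : IsProbabilityMeasure m0)
    (hm0supp : ∃ R : ℝ, m0 (Metric.closedBall 0 R)ᶜ = 0)
    -- (H4)(i): ℓ is convex
    (hconv : ConvexOn ℝ Set.univ ℓ)
    -- (H4)(ii): modulus-of-continuity estimate in the measure argument
    (ω : ℝ → ℝ) (hωpos : ∀ r, 0 ≤ ω r)
    (hωmono : ∀ r r', 0 ≤ r → r ≤ r' → ω r ≤ ω r')
    (hω0 : ∀ ε > (0 : ℝ), ∃ δ > (0 : ℝ), ∀ r, 0 ≤ r → r ≤ δ → ω r ≤ ε)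
    (Cω : ℝ) (hCω : 0 < Cω)
    (hmod : ∀ x, ∀ m m', IsP1 m → IsP1 m' →
      |f x m - f x m'| ≤ Cω * (1 + ‖x‖ ^ q) * ω (W1 m m') ∧
      |g x m - g x m'| ≤ Cω * (1 + ‖x‖ ^ q) * ω (W1 m m'))
    -- the grids
    (Ns Nt : ℕ → ℕ) (hNs : ∀ n, 0 < Ns n) (hNt : ∀ n, 0 < Nt n)
    (hNsInfty : Tendsto (fun n => (Ns n : ℝ)) atTop atTop)
    (hNtInfty : Tendsto (fun n => (Nt n : ℝ)) atTop atTop)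
    -- N^t_n / N^s_n → 0
    (hratio : Tendsto (fun n => (Nt n : ℝ) / (Ns n : ℝ)) atTop (𝓝 0))
    (eps : ℕ → ℝ) (heps : ∀ n, 0 < eps n)
    -- ε_n = o(1/(N^t_n log N^s_n))
    (hepsO : Tendsto (fun n => eps n * ((Nt n : ℝ) * Real.log (Ns n))) atTop (𝓝 0))
    -- the solutions of the finite MFGs and the induced path measures
    (U M : ℕ → ℕ → (Fin d → ℤ) → ℝ)
    (P : ℕ → ℕ → (Fin d → ℤ) → (Fin d → ℤ) → ℝ)
    (hsol : ∀ n, SolvesDiscreteMFG d T Ns Nt eps ℓ f g m0 n (U n) (M n) (P n))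
    (interp : (n : ℕ) → (Fin (Nt n + 1) → Fin d → ℤ) → PathSpace T d)
    (hinterp : ∀ n, ∀ s : Fin (Nt n + 1) → Fin d → ℤ, ∀ k : Fin (Nt n), ∀ t : ℝ,
      t ∈ Set.Icc (((k : ℕ) : ℝ) * dtn T Nt n) ((((k : ℕ) : ℝ) + 1) * dtn T Nt n) →
      ev hT.le (interp n s) t = gpt d Ns n (s k.castSucc) +
        ((t - ((k : ℕ) : ℝ) * dtn T Nt n) / dtn T Nt n) •
          (gpt d Ns n (s k.succ) - gpt d Ns n (s k.castSucc))) :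
    (∃ ξstar : Measure (PathSpace T d), IsProbabilityMeasure ξstar ∧
      IsNarrowLimitPoint (fun n => xiMeas d T Ns Nt m0 n (P n) (interp n)) ξstar) ∧
    ∀ ξstar : Measure (PathSpace T d), IsProbabilityMeasure ξstar →
      IsNarrowLimitPoint (fun n => xiMeas d T Ns Nt m0 n (P n) (interp n)) ξstar →
      IsMFGEquilibrium d T hT.le q ℓ f g m0 ξstar := by
  obtain ⟨R, hR⟩ := hm0supp
  have hc : IsAdmissibleCost q lo hi Cℓ Cb Cω ω ℓ f g :=
    ⟨hq, hlo, hhi, hCℓ, hCb, hCω, hlcont, hconv, fun v => (hgrowth v).1, fun v => (hgrowth v).2,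
      hbound, hxLip, hcont, hω0, hmod⟩
  set ξ : ℕ → Measure (PathSpace T d) := fun n => xiMeas d T Ns Nt m0 n (P n) (interp n) with hξ
  set e : ℕ → ℝ := fun n => Nt n * (eps n * Real.log (gridIdx d Ns n).card) with he
  set G : ℕ → Set (Fin d → ℝ) := fun n => gpt d Ns n '' gridIdx d Ns n with hG
  have happ := fun n => (hsol n).isApproxEquilibrium hT q heps hR (hNs n) (hNt n) (hinterp n)
  have hprob : ∀ n, IsProbabilityMeasure (ξ n) := fun n => (happ n).1.prob
  have he0 : Tendsto e atTop (𝓝 0) := tendsto_entropy_error heps hNsInfty hepsO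
  obtain ⟨B, hB⟩ := he0.bddAbove_range
  set C := (T * ℓ 0 + 2 * (T * Cb + Cb) + B + T * Cℓ) / lo with hC
  have hE : ∀ n, ∫ γ, actionOn hT.le (fun v => ‖v‖ ^ q) (Nt n) γ ∂(ξ n) ≤ C := fun n => by
    refine ((happ n).1.integral_energy_le hc (hNt n)).trans ?_
    have : e n ≤ B := hB (mem_range_self n)
    rw [hC]
    gcongr
  refine ⟨exists_isNarrowLimitPoint hT hq (fun n => actionOn hT.le (fun v => ‖v‖ ^ q) (Nt n))
    (R := R + 1) (C := C) (fun n => ?_) (fun n => (happ n).1.integrable _) hE, ?_⟩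
  · filter_upwards [(happ n).1.ae_start, (happ n).1.ae_deriv] with γ h1 h2
    obtain ⟨z, hz, hzφ⟩ := h2
    exact ⟨h1, z, hz, hzφ fun v => ‖v‖ ^ q⟩
  rintro ξs hξs ⟨φ, hφ, hlim⟩
  have hφt := hφ.tendsto_atTop
  have hlimit : IsLimitOfApprox hT q ℓ f g (Nt ∘ φ) (G ∘ φ) (R + 1) C (e ∘ φ) (ξ ∘ φ) ξs :=
    ⟨fun n => (happ (φ n)).1, fun n => hNt _, (tendsto_natCast_atTop_iff.1 hNtInfty).comp hφt,
      he0.comp hφt, fun n => hE (φ n), hξs, hlim⟩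
  have hdx : ∀ n, 0 < dxn Ns n := fun n => one_div_pos.2 (by exact_mod_cast hNs n)
  refine hlimit.isMFGEquilibrium hc (δ := dxn Ns ∘ φ) (fun n => hdx _) (fun ρ => ?_) ?_ ?_
  · filter_upwards [(hNsInfty.comp hφt).eventually_ge_atTop (ρ + 1)] with n hn x hx
    obtain ⟨i, hi, hix⟩ := exists_gpt_near (hNs (φ n)) hn hx
    exact ⟨_, mem_image_of_mem _ hi, hix.trans (half_le_self (hdx _).le)⟩
  · have h1 := (hratio.comp hφt).const_mul T⁻¹
    rw [mul_zero] at h1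
    refine h1.congr fun n => ?_
    have : (0 : ℝ) < Nt (φ n) := by exact_mod_cast hNt _
    have : (0 : ℝ) < Ns (φ n) := by exact_mod_cast hNs _
    simp only [Function.comp_apply, dxn]
    field_simp
  · refine map_ev_zero_eq_of_narrow hT.le hNs hNsInfty hR (fun n => ?_) (fun n => (happ n).2)
      hφt hlim
    obtain ⟨-, -, h0, -, hs⟩ := hsol n
    rw [← (hs 0 (Nat.zero_le _)).2.2]
    exact Finset.sum_congr rfl fun i hi => (h0 i hi).symm
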